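/- arXiv:2510.23841 — 2 statements merged into one kernel-verified Lean document; each statement's English description precedes it below -/
import Mathlib

section
/- Let G be a finite group such that exactly two elements of cs(G) are composite numbers. Then G is not almost simple; that is, G does not contain a nonabelian simple normal subgroup N with trivial centralizer C_G(N) = 1. -/
/-- The set of conjugacy class sizes of a group `G`. -/
def csSet (G : Type*) [Group G] : Set ℕ :=
  {n | ∃ g : G, n = (Subgroup.centralizer {g} : Subgroup G).index}

/-- A natural number is composite if it is greater than 1 and not prime. -/
def IsCompositeNat (n : ℕ) : Prop := 1 < n ∧ ¬ n.Prime


theorem aux_root_pow {d n : ℕ} (A : Matrix (Fin d) (Fin d) ℂ) (hA : A ^ n = 1) :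
    ∀ l ∈ A.charpoly.roots, l ^ n = 1 := by
  intro l hl
  have h1 : l ∈ spectrum ℂ A :=
    Matrix.mem_spectrum_iff_isRoot_charpoly.2 (Polynomial.isRoot_of_mem_roots hl)
  have h2 := spectrum.pow_mem_pow A n h1
  rw [hA] at h2
  cases subsingleton_or_nontrivial (Matrix (Fin d) (Fin d) ℂ) with
  | inl h => rw [spectrum.of_subsingleton] at h2; exact absurd h2 (by simp)
  | inr h => rw [spectrum.one_eq] at h2; simpa using h2

theorem aux_trace_integral {d n : ℕ} (hn : 0 < n) (A : Matrix (Fin d) (Fin d) ℂ) (hA : A ^ n = 1) :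
    IsIntegral ℤ A.trace := by
  rw [Matrix.trace_eq_sum_roots_charpoly]
  apply IsIntegral.multiset_sum
  intro l hl
  have := aux_root_pow A hA l hl
  exact IsIntegral.of_pow hn (by rw [this]; exact isIntegral_one)

theorem aux_kronecker {n d : ℕ} (hn : 0 < n) (hd : 0 < d) (s : Multiset ℂ) (hs : s.card = d)
    (h1 : ∀ l ∈ s, l ^ n = 1) (hint : IsIntegral ℤ (s.sum / d)) (h0 : s.sum / d ≠ 0) :
    ∃ k, 0 < k ∧ (s.sum / d) ^ k = 1 := by
  let T : Set ℂ := {z | z ^ n = 1}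
  have hT : T.Finite := by
    refine ((Polynomial.nthRoots n (1 : ℂ)).toFinset.finite_toSet).subset ?_
    intro z hz
    have hz' : z ^ n = 1 := hz
    simp [Polynomial.mem_nthRoots hn, hz']
  have : Finite T := hT
  let K := IntermediateField.adjoin ℚ T
  have hfd : FiniteDimensional ℚ K := IntermediateField.finiteDimensional_adjoin (by
    intro x hx
    exact IsIntegral.of_pow hn (by rw [show x ^ n = 1 from hx]; exact isIntegral_one))
  let : NumberField K := { to_charZero := inferInstance, to_finiteDimensional := hfd }
  have hmem : ∀ l ∈ s, l ∈ K := fun l hl => IntermediateField.subset_adjoin ℚ T (h1 l hl)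
  let s' : Multiset K := s.attach.map fun l => ⟨l.1, hmem l.1 l.2⟩
  have hs' : s'.map (algebraMap K ℂ) = s := by
    simp only [s', Multiset.map_map]
    conv_rhs => rw [← Multiset.attach_map_val s]
    rfl
  have hcard : s'.card = d := by simp [s', hs]
  let y : K := s'.sum / d
  have hy : algebraMap K ℂ y = s.sum / d := by
    simp only [y, map_div₀, map_multiset_sum, hs', map_natCast]
  have h1' : ∀ l ∈ s', l ^ n = 1 := by
    intro l hl
    apply (algebraMap K ℂ).injective
    rw [map_pow, map_one]
    apply h1
    rw [← hs']
    exact Multiset.mem_map_of_mem _ hl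
  obtain ⟨k, hk, hk1⟩ := NumberField.Embeddings.pow_eq_one_of_norm_le_one (x := y) K ℂ
    (by intro h; apply h0; rw [← hy, h, map_zero])
    ((isIntegral_algebraMap_iff (algebraMap K ℂ).injective).1 (by rw [hy]; exact hint))
    (by
      intro φ
      have hdpos : (0 : ℝ) < d := by exact_mod_cast hd
      simp only [y, map_div₀, map_multiset_sum, map_natCast, norm_div, RCLike.norm_natCast]
      rw [div_le_one hdpos]
      refine (norm_multiset_sum_le _).trans ?_
      rw [Multiset.map_map]
      have : ∀ l ∈ s', (norm ∘ φ) l = 1 := by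
        intro l hl
        have := h1' l hl
        have h2 : (φ l) ^ n = 1 := by rw [← map_pow, this, map_one]
        exact Complex.norm_eq_one_of_pow_eq_one h2 hn.ne'
      rw [Multiset.map_congr rfl this]
      simp [hcard])
  exact ⟨k, hk, by rw [← hy, ← map_pow, hk1, map_one]⟩

theorem aux_all_eq {d : ℕ} (hd : 0 < d) (s : Multiset ℂ) (hs : s.card = d)
    (h1 : ∀ l ∈ s, ‖l‖ = 1) (h2 : ‖s.sum / d‖ = 1) : ∀ l ∈ s, l = s.sum / d := by
  have hd' : (d : ℂ) ≠ 0 := by exact_mod_cast hd.ne'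
  set α := s.sum / d with hα
  have hα0 : α ≠ 0 := by intro h; rw [h] at h2; simp at h2
  have hsum : s.sum = d * α := by rw [hα]; field_simp
  have hle : ∀ l ∈ s, (l / α).re ≤ 1 := by
    intro l hl
    refine (Complex.re_le_norm _).trans ?_
    rw [norm_div, h1 l hl, h2]; simp
  have hs1 : (s.map (fun l => 1 - (l / α).re)).sum = 0 := by
    have e1 : (s.map (fun l => (l / α).re)).sum = d := by
      have : (s.map (fun l => (l / α))).sum = d := by
        rw [Multiset.sum_map_div, Multiset.map_id', hsum]; field_simp
      have h3 := congrArg Complex.reAddGroupHom this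
      rw [map_multiset_sum, Multiset.map_map] at h3
      simpa using h3
    rw [Multiset.sum_map_sub, e1]; simp [hs]
  intro l hl
  have hz : 1 - (l / α).re = 0 := by
    have hnn : ∀ x ∈ s.map (fun l => 1 - (l / α).re), 0 ≤ x := by
      intro x hx
      obtain ⟨m, hm, rfl⟩ := Multiset.mem_map.1 hx
      linarith [hle m hm]
    refine le_antisymm ?_ (by linarith [hle l hl])
    rw [← hs1]
    exact Multiset.single_le_sum hnn _ (Multiset.mem_map_of_mem _ hl)
  have hn : ‖l / α‖ = 1 := by rw [norm_div, h1 l hl, h2]; simp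
  have : l / α = 1 := by
    have h3 := Complex.sq_norm (l / α)
    rw [hn, Complex.normSq_apply] at h3
    have h4 : (l/α).re = 1 := by linarith
    have h5 : (l/α).im = 0 := by rw [h4] at h3; nlinarith
    apply Complex.ext <;> simp [h4, h5]
  rwa [div_eq_one_iff_eq hα0] at this

theorem aux_scalar {d n : ℕ} (hn : 0 < n) (hd : 0 < d) (A : Matrix (Fin d) (Fin d) ℂ)
    (hA : A ^ n = 1) (hint : IsIntegral ℤ (A.trace / d)) (h0 : A.trace ≠ 0) :
    ∃ α : ℂ, A = algebraMap ℂ _ α := by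
  have hd' : (d : ℂ) ≠ 0 := by exact_mod_cast hd.ne'
  have hcard : A.charpoly.roots.card = d := by
    have := (IsAlgClosed.splits A.charpoly).natDegree_eq_card_roots
    rw [← this, Matrix.charpoly_natDegree_eq_dim]; simp
  have hroots := aux_root_pow A hA
  rw [Matrix.trace_eq_sum_roots_charpoly] at hint h0
  obtain ⟨k, hk, hk1⟩ := aux_kronecker hn hd _ hcard hroots hint (div_ne_zero h0 hd')
  have hall := aux_all_eq hd _ hcard
    (fun l hl => Complex.norm_eq_one_of_pow_eq_one (hroots l hl) hn.ne')
    (Complex.norm_eq_one_of_pow_eq_one hk1 hk.ne')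
  set α := A.charpoly.roots.sum / d
  refine ⟨α, ?_⟩
  have hch : A.charpoly = (Polynomial.X - Polynomial.C α) ^ d := by
    have h := (IsAlgClosed.splits A.charpoly).eq_prod_roots_of_monic A.charpoly_monic
    rw [Multiset.eq_replicate.2 ⟨hcard, hall⟩] at h
    rw [h]; simp
  have hαn : α ^ n = 1 := by
    have : α ∈ A.charpoly.roots := by
      rw [Multiset.eq_replicate.2 ⟨hcard, hall⟩]
      exact Multiset.mem_replicate.2 ⟨hd.ne', rfl⟩
    exact hroots α this
  have hroot : (Polynomial.X ^ n - 1 : Polynomial ℂ).IsRoot α := by simp [hαn]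
  obtain ⟨q, hq⟩ := Polynomial.dvd_iff_isRoot.2 hroot
  have hsep : (Polynomial.X ^ n - 1 : Polynomial ℂ).Separable := by
    rw [Polynomial.X_pow_sub_one_separable_iff]; exact_mod_cast hn.ne'
  rw [hq] at hsep
  have hcop : IsCoprime ((Polynomial.X - Polynomial.C α) ^ d) q :=
    (hsep.isCoprime).pow_left
  obtain ⟨u, v, huv⟩ := hcop
  have hB : Polynomial.aeval A ((Polynomial.X - Polynomial.C α)) = 0 := by
    have e : (Polynomial.X - Polynomial.C α) = (Polynomial.X - Polynomial.C α) * u * (Polynomial.X - Polynomial.C α) ^ d + v * ((Polynomial.X - Polynomial.C α) * q) := by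
      linear_combination (-(Polynomial.X - Polynomial.C α)) * huv
    rw [e, ← hch, ← hq]
    simp [Matrix.aeval_self_charpoly, hA]
  simpa [sub_eq_zero] using hB

theorem aux_trace_reg {G : Type*} [Group G] [Finite G] {m : ℕ} (d : Fin m → ℕ)
    (e : MonoidAlgebra ℂ G ≃ₐ[ℂ] ((i : Fin m) → Matrix (Fin (d i)) (Fin (d i)) ℂ))
    (x : G) (hx : x ≠ 1) :
    ∑ i, (d i : ℂ) * (e (MonoidAlgebra.of ℂ G x) i).trace = 0 := by
  classical
  have := Fintype.ofFinite G
  have h1 : LinearMap.trace ℂ _ (LinearMap.mulLeft ℂ (MonoidAlgebra.of ℂ G x)) = 0 := by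
    rw [LinearMap.trace_eq_matrix_trace ℂ (MonoidAlgebra.basis G ℂ)]
    rw [Matrix.trace]
    apply Finset.sum_eq_zero
    intro g _
    rw [Matrix.diag_apply, LinearMap.toMatrix_apply]
    have h := (MonoidAlgebra.basis G ℂ).repr_self (x * g)
    rw [MonoidAlgebra.basis_apply] at h
    simp [h, hx]
  have h2 := LinearMap.trace_conj' (LinearMap.mulLeft ℂ (MonoidAlgebra.of ℂ G x)) e.toLinearEquiv
  rw [h1] at h2
  have h3 : e.toLinearEquiv.conj (LinearMap.mulLeft ℂ (MonoidAlgebra.of ℂ G x)) =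
      LinearMap.mulLeft ℂ (e (MonoidAlgebra.of ℂ G x)) := by
    apply LinearMap.ext
    intro y
    simp [LinearEquiv.conj_apply]
  rw [h3] at h2
  rw [← h2, LinearMap.trace_eq_matrix_trace ℂ (Pi.basis fun i => Matrix.stdBasis ℂ (Fin (d i)) (Fin (d i)))]
  rw [Matrix.trace, Fintype.sum_sigma]
  apply Finset.sum_congr rfl
  intro i _
  rw [Fintype.sum_prod_type]
  have key : ∀ a b : Fin (d i), ((LinearMap.toMatrix
      (Pi.basis fun i => Matrix.stdBasis ℂ (Fin (d i)) (Fin (d i)))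
      (Pi.basis fun i => Matrix.stdBasis ℂ (Fin (d i)) (Fin (d i))))
      (LinearMap.mulLeft ℂ (e (MonoidAlgebra.of ℂ G x)))).diag ⟨i, (a, b)⟩
      = e (MonoidAlgebra.of ℂ G x) i a a := by
    intro a b
    rw [Matrix.diag_apply, LinearMap.toMatrix_apply, Pi.basis_repr, Pi.basis_apply,
      Matrix.stdBasis_eq_single]
    simp [Matrix.stdBasis]
  simp only [key]
  simp [Matrix.trace, Finset.mul_sum]



theorem aux_conj_card {G : Type*} [Group G] [Finite G] (x : G) :
    Nat.card {y : G | IsConj x y} = (Subgroup.centralizer {x} : Subgroup G).index := by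
  have h := MulAction.index_stabilizer (ConjAct G) x
  rw [ConjAct.stabilizer_eq_centralizer] at h
  have h2 : MulAction.orbit (ConjAct G) x = {y : G | IsConj x y} := by
    ext y; rw [ConjAct.mem_orbit_conjAct]; exact isConj_comm
  rw [h2] at h
  exact h.symm

theorem aux_integral_inv (p : ℕ) (hp : p.Prime) : ¬ IsIntegral ℤ ((1 : ℂ) / p) := by
  intro h
  have h1 : IsIntegral ℤ ((1 : ℚ) / p) := by
    rw [← isIntegral_algebraMap_iff (algebraMap ℚ ℂ).injective]
    simpa using h
  obtain ⟨y, hy⟩ := IsIntegrallyClosed.isIntegral_iff.1 h1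
  have hp0 : (p : ℚ) ≠ 0 := by exact_mod_cast hp.ne_zero
  have h2 : (y : ℚ) * p = 1 := by
    have : (y : ℚ) = 1 / p := hy
    rw [this]; field_simp
  have h3 : y * p = 1 := by exact_mod_cast h2
  have h4 : (p : ℤ) ∣ 1 := ⟨y, by linarith⟩
  have h5 : p ∣ 1 := by exact_mod_cast h4
  exact hp.one_lt.ne' (Nat.dvd_one.1 h5)

theorem burnside_prime {S : Type*} [Group S] [Finite S] [IsSimpleGroup S] (x : S) (p : ℕ) (hp : p.Prime)
    (hx : (Subgroup.centralizer {x} : Subgroup S).index = p) : False := by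
  classical
  have := Fintype.ofFinite S
  obtain ⟨m, d, hd, ⟨e⟩⟩ :=
    IsSemisimpleRing.exists_algEquiv_pi_matrix_of_isAlgClosed ℂ (MonoidAlgebra ℂ S)
  have hd0 : ∀ i, 0 < d i := fun i => (hd i).pos
  let π (i : Fin m) : MonoidAlgebra ℂ S →ₐ[ℂ] Matrix (Fin (d i)) (Fin (d i)) ℂ :=
    (Pi.evalAlgHom ℂ _ i).comp e.toAlgHom
  let ρ (i : Fin m) : S →* Matrix (Fin (d i)) (Fin (d i)) ℂ :=
    (π i : MonoidAlgebra ℂ S →* _).comp (MonoidAlgebra.of ℂ S)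
  have hsurj : ∀ i, Function.Surjective (π i) := by
    intro i M
    exact ⟨e.symm (Pi.single i M), by simp [π]⟩
  have hx1 : x ≠ 1 := by
    rintro rfl
    have : (Subgroup.centralizer {1} : Subgroup S) = ⊤ := by
      ext; simp [Subgroup.mem_centralizer_iff]
    rw [this, Subgroup.index_top] at hx
    exact hp.one_lt.ne hx
  have hcomm : ∃ g : S, g * x ≠ x * g := by
    by_contra! hc
    have : (Subgroup.centralizer {x} : Subgroup S) = ⊤ := by
      ext g; simp [Subgroup.mem_centralizer_iff, (hc g)]
    rw [this, Subgroup.index_top] at hx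
    exact hp.one_lt.ne hx
  have hp0 : (p : ℂ) ≠ 0 := by exact_mod_cast hp.ne_zero
  have hcen : ∀ i (c : MonoidAlgebra ℂ S), (∀ g : S, Commute c (MonoidAlgebra.of ℂ S g)) →
      ∃ w : ℂ, π i c = algebraMap ℂ _ w := by
    intro i c hc
    have h1 : ∀ a, Commute c a := by
      intro a
      induction a using MonoidAlgebra.induction_on with
      | of g => exact hc g
      | add f g hf hg => exact hf.add_right hg
      | smul r f hf => exact hf.smul_right r
    have h2 : π i c ∈ Set.center (Matrix (Fin (d i)) (Fin (d i)) ℂ) := by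
      rw [Semigroup.mem_center_iff]
      intro M
      obtain ⟨a, rfl⟩ := hsurj i M
      exact ((h1 a).map (π i)).eq.symm
    rw [Matrix.center_eq_range] at h2
    obtain ⟨w, hw⟩ := h2
    exact ⟨w, by rw [← hw]; rfl⟩
  have hpow : ∀ i, ρ i x ^ Nat.card S = 1 := by
    intro i; rw [← map_pow, pow_card_eq_one', map_one]
  have hω : ∀ i, ∃ w : ℂ, IsIntegral ℤ w ∧ p * (ρ i x).trace = d i * w := by
    intro i
    let X : Finset S := Finset.univ.filter fun y => IsConj x y
    have hX : X.card = p := by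
      rw [← hx, ← aux_conj_card, Nat.card_eq_fintype_card, ← Set.toFinset_card]
      congr 1
      ext; simp [X]
    let cZ : MonoidAlgebra ℤ S := ∑ y ∈ X, MonoidAlgebra.of ℤ S y
    let c : MonoidAlgebra ℂ S := ∑ y ∈ X, MonoidAlgebra.of ℂ S y
    have hc : MonoidAlgebra.mapRingHom S (algebraMap ℤ ℂ) cZ = c := by
      simp [c, cZ]
    obtain ⟨w, hw⟩ := hcen i c (by
      intro g
      have : MonoidAlgebra.of ℂ S g * c = c * MonoidAlgebra.of ℂ S g := by
        simp only [c, Finset.mul_sum, Finset.sum_mul, ← map_mul]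
        refine Finset.sum_bij (fun y _ => g * y * g⁻¹) ?_ ?_ ?_ ?_
        · intro y hy
          simp only [X, Finset.mem_filter, Finset.mem_univ, true_and] at hy ⊢
          exact hy.trans (isConj_iff.2 ⟨g, rfl⟩)
        · intro a _ b _ h; simpa using h
        · intro y hy
          refine ⟨g⁻¹ * y * g, ?_, by group⟩
          simp only [X, Finset.mem_filter, Finset.mem_univ, true_and] at hy ⊢
          exact hy.trans (isConj_iff.2 ⟨g⁻¹, by group⟩)
        · intro y _; congr 1; group
      exact this.symm)
    refine ⟨w, ?_, ?_⟩
    · have h1 : IsIntegral ℤ cZ := IsIntegral.of_finite ℤ cZ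
      have h2 : IsIntegral ℤ (((π i).toRingHom.comp
        (MonoidAlgebra.mapRingHom S (algebraMap ℤ ℂ))).toIntAlgHom cZ) := h1.map _
      have h3 : ((π i).toRingHom.comp
        (MonoidAlgebra.mapRingHom S (algebraMap ℤ ℂ))).toIntAlgHom cZ = algebraMap ℂ _ w := by
        rw [← hw, ← hc]; rfl
      rw [h3] at h2
      have : NeZero (d i) := hd i
      exact (isIntegral_algebraMap_iff
        (FaithfulSMul.algebraMap_injective ℂ (Matrix (Fin (d i)) (Fin (d i)) ℂ))).1 h2
    · have h1 := congrArg Matrix.trace hw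
      have h2 : (π i c).trace = ∑ y ∈ X, (ρ i y).trace := by
        simp only [c, map_sum, Matrix.trace_sum]; rfl
      have h3 : ∀ y ∈ X, (ρ i y).trace = (ρ i x).trace := by
        intro y hy
        simp only [X, Finset.mem_filter, Finset.mem_univ, true_and] at hy
        obtain ⟨g, rfl⟩ := isConj_iff.1 hy
        rw [map_mul, Matrix.trace_mul_comm, ← map_mul]
        congr 2; group
      rw [h2, Finset.sum_congr rfl h3, Finset.sum_const, hX, nsmul_eq_mul,
        Matrix.algebraMap_eq_diagonal, Matrix.trace_diagonal] at h1
      simpa using h1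
  let ε : MonoidAlgebra ℂ S →ₐ[ℂ] ℂ := MonoidAlgebra.lift ℂ ℂ S (1 : S →* ℂ)
  have htriv1 : ∀ i, (∀ g, ρ i g = 1) → ∀ a, π i a = algebraMap ℂ _ (ε a) := by
    intro i hi a
    have : π i = (Algebra.ofId ℂ _).comp ε := by
      apply MonoidAlgebra.algHom_ext
      intro g
      have := hi g
      simp only [ρ, MonoidHom.comp_apply] at this
      simp [ε, Algebra.ofId_apply]
      exact this
      case single_one_left => exact Subsingleton.elim _ _
    rw [this]; rfl
  have hinj : ∀ i, Function.Injective (algebraMap ℂ (Matrix (Fin (d i)) (Fin (d i)) ℂ)) := by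
    intro i
    have : NeZero (d i) := hd i
    exact FaithfulSMul.algebraMap_injective ℂ (Matrix (Fin (d i)) (Fin (d i)) ℂ)
  have hdim : ∀ i, (∀ g, ρ i g = 1) → d i = 1 := by
    intro i hi
    by_contra hne
    have h2 : 2 ≤ d i := by have := hd0 i; omega
    let a : Fin (d i) := ⟨0, by omega⟩
    let b : Fin (d i) := ⟨1, by omega⟩
    have hab : a ≠ b := by simp [a, b]
    obtain ⟨y, hy⟩ := hsurj i (Matrix.single a b 1)
    rw [htriv1 i hi] at hy
    have := congrFun (congrFun hy a) b
    rw [Matrix.algebraMap_eq_diagonal, Matrix.diagonal_apply_ne _ hab] at this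
    simp at this
  have huniq : ∀ i j, (∀ g, ρ i g = 1) → (∀ g, ρ j g = 1) → i = j := by
    intro i j hi hj
    by_contra hne
    let u := e.symm (Pi.single i 1)
    have h1 : π i u = 1 := by simp [π, u]
    have h2 : π j u = 0 := by simp [π, u, Ne.symm hne]
    rw [htriv1 i hi] at h1
    rw [htriv1 j hj] at h2
    have h3 : ε u = 1 := hinj i (by rw [h1, map_one])
    have h4 : ε u = 0 := hinj j (by rw [h2, map_zero])
    rw [h3] at h4
    exact one_ne_zero h4
  have hex : ∃ i, ∀ g, ρ i g = 1 := by
    let c : MonoidAlgebra ℂ S := ∑ y : S, MonoidAlgebra.of ℂ S y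
    have hl : ∀ g, MonoidAlgebra.of ℂ S g * c = c := by
      intro g
      simp only [c, Finset.mul_sum, ← map_mul]
      exact Fintype.sum_equiv (Equiv.mulLeft g) _ _ (fun _ => rfl)
    have hr : ∀ g, c * MonoidAlgebra.of ℂ S g = c := by
      intro g
      simp only [c, Finset.sum_mul, ← map_mul]
      exact Fintype.sum_equiv (Equiv.mulRight g) _ _ (fun _ => rfl)
    have hc0 : c ≠ 0 := by
      intro h
      have h1 := congrArg ε h
      simp only [c, map_sum, map_zero, ε] at h1
      simp at h1
    have hec : e c ≠ 0 := by
      intro h; exact hc0 (e.injective (by rw [h, map_zero]))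
    obtain ⟨i, hi⟩ := Function.ne_iff.1 hec
    refine ⟨i, fun g => ?_⟩
    obtain ⟨w, hw⟩ := hcen i c (fun g => by
      rw [Commute, SemiconjBy, hl, hr])
    have hπ : π i c ≠ 0 := hi
    have hw0 : w ≠ 0 := by
      rintro rfl; rw [map_zero] at hw; exact hπ hw
    have h1 : π i (MonoidAlgebra.of ℂ S g * c) = π i c := by rw [hl]
    rw [map_mul, hw, Algebra.algebraMap_eq_smul_one, mul_smul_comm, mul_one] at h1
    exact smul_right_injective _ hw0 h1
  have hnontriv : ∀ i, (¬ ∀ g, ρ i g = 1) → ¬ ∃ α : ℂ, ρ i x = algebraMap ℂ _ α := by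
    rintro i hi ⟨α, hα⟩
    apply hi
    obtain ⟨g, hg⟩ := hcomm
    have hk : (ρ i).ker = ⊤ := by
      refine (IsSimpleGroup.eq_bot_or_eq_top_of_normal (ρ i).ker inferInstance).resolve_left ?_
      intro hb
      have hmem : g * x * g⁻¹ * x⁻¹ ∈ (ρ i).ker := by
        rw [MonoidHom.mem_ker, map_mul, map_mul, map_mul, hα, ← Algebra.commutes, ← hα,
          ← map_mul, ← map_mul, ← map_mul]
        simp
      rw [hb, Subgroup.mem_bot] at hmem
      apply hg
      have : g * x = (g * x * g⁻¹ * x⁻¹) * (x * g) := by group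
      rw [this, hmem, one_mul]
    intro y
    have : y ∈ (ρ i).ker := by rw [hk]; trivial
    exact this
  obtain ⟨i₀, hi₀⟩ := hex
  have hterm : ∀ i, i ≠ i₀ → IsIntegral ℤ ((d i : ℂ) * (ρ i x).trace / p) := by
    intro i hne
    have hi : ¬ ∀ g, ρ i g = 1 := fun h => hne (huniq i i₀ h hi₀)
    have hdi : (d i : ℂ) ≠ 0 := by exact_mod_cast (hd0 i).ne'
    obtain ⟨w, hwi, hw⟩ := hω i
    have hcardpos : 0 < Nat.card S := Nat.card_pos
    by_cases hpd : p ∣ d i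
    · obtain ⟨k, hk⟩ := hpd
      have : (d i : ℂ) * (ρ i x).trace / p = (k : ℂ) * k * w := by
        have hk' : (d i : ℂ) = p * k := by exact_mod_cast hk
        have h5 : (ρ i x).trace = k * w := by
          apply mul_left_cancel₀ hp0
          rw [hw, hk']; ring
        rw [h5, hk']; field_simp
      rw [this]
      have hki : IsIntegral ℤ (k : ℂ) := by
        simpa using (isIntegral_algebraMap (R := ℤ) (A := ℂ) (x := (k : ℤ)))
      exact (hki.mul hki).mul hwi
    · have htr := aux_trace_integral hcardpos (ρ i x) (hpow i)
      have h0 : (ρ i x).trace = 0 := by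
        by_contra hne0
        apply hnontriv i hi
        refine aux_scalar hcardpos (hd0 i) (ρ i x) (hpow i) ?_ hne0
        have hcop : IsCoprime (p : ℤ) (d i : ℤ) :=
          Nat.isCoprime_iff_coprime.2 ((Nat.Prime.coprime_iff_not_dvd hp).2 hpd)
        obtain ⟨u, v, huv⟩ := hcop
        have huv' : (u : ℂ) * p + v * d i = 1 := by exact_mod_cast huv
        have : (ρ i x).trace / d i = u * w + v * (ρ i x).trace := by
          rw [div_eq_iff hdi]
          linear_combination (-(ρ i x).trace) * huv' + u * hw
        rw [this]
        have hui : IsIntegral ℤ (u : ℂ) := by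
          simpa using (isIntegral_algebraMap (R := ℤ) (A := ℂ) (x := u))
        have hvi : IsIntegral ℤ (v : ℂ) := by
          simpa using (isIntegral_algebraMap (R := ℤ) (A := ℂ) (x := v))
        exact (hui.mul hwi).add (hvi.mul htr)
      rw [h0]; simpa using isIntegral_zero
  have hsum : ∑ i, (d i : ℂ) * (ρ i x).trace = 0 := aux_trace_reg d e x hx1
  rw [← Finset.add_sum_erase _ _ (Finset.mem_univ i₀), hi₀ x, Matrix.trace_one,
    Fintype.card_fin, hdim i₀ hi₀] at hsum
  have hfin : (1 : ℂ) / p = - ∑ i ∈ Finset.univ.erase i₀, (d i : ℂ) * (ρ i x).trace / p := by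
    rw [← Finset.sum_div]
    field_simp
    push_cast at hsum
    linear_combination hsum
  apply aux_integral_inv p hp
  rw [hfin]
  apply IsIntegral.neg
  apply IsIntegral.sum
  intro i hi
  exact hterm i (Finset.ne_of_mem_erase hi)


/-- Conjugacy class size. -/
noncomputable abbrev kk {G : Type*} [Group G] (x : G) : ℕ :=
  (Subgroup.centralizer {x} : Subgroup G).index

theorem kk_conj {G : Type*} [Group G] [Finite G] {x y : G} (h : IsConj x y) : kk x = kk y := by
  rw [kk, kk, ← aux_conj_card, ← aux_conj_card]
  have : {z : G | IsConj x z} = {z : G | IsConj y z} := by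
    ext z; exact ⟨fun h' => h.symm.trans h', fun h' => h.trans h'⟩
  rw [this]

theorem kk_pos {G : Type*} [Group G] [Finite G] (x : G) : 0 < kk x :=
  Nat.pos_of_ne_zero Subgroup.index_ne_zero_of_finite

theorem normal_contains {G : Type*} [Group G] {N : Subgroup G} (hN : N.Normal)
    (hs : IsSimpleGroup N) (hc : Subgroup.centralizer (N : Set G) = ⊥)
    (K : Subgroup G) (hK : K.Normal) (hK0 : K ≠ ⊥) : N ≤ K := by
  rcases IsSimpleGroup.eq_bot_or_eq_top_of_normal (K.subgroupOf N) inferInstance with h | h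
  · exfalso
    apply hK0
    rw [eq_bot_iff, ← hc]
    intro k hk
    rw [Subgroup.mem_centralizer_iff]
    intro n hn
    have hd : Disjoint K N := Subgroup.subgroupOf_eq_bot.1 h
    exact (Subgroup.commute_of_normal_of_disjoint K N hK hN hd k n hk hn).eq.symm
  · exact Subgroup.subgroupOf_eq_top.1 h

theorem eq_one_of_normal_le {G : Type*} [Group G] {N : Subgroup G} (hN : N.Normal)
    (hs : IsSimpleGroup N) (hc : Subgroup.centralizer (N : Set G) = ⊥)
    (K : Subgroup G) (hK : K.Normal) (hK0 : K ≠ ⊥) (x : G)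
    (hx : K ≤ Subgroup.centralizer {x}) : x = 1 := by
  have h := (normal_contains hN hs hc K hK hK0).trans hx
  rw [← Subgroup.mem_bot, ← hc, Subgroup.mem_centralizer_iff]
  intro n hn
  have := h hn
  rw [Subgroup.mem_centralizer_iff] at this
  exact (this x rfl).symm

theorem simple_ne_bot {G : Type*} [Group G] {N : Subgroup G}
    (hs : IsSimpleGroup N) : N ≠ ⊥ := by
  rintro rfl
  exact not_nontrivial _ hs.toNontrivial

theorem kk_eq_one {G : Type*} [Group G] {N : Subgroup G} (hN : N.Normal)
    (hs : IsSimpleGroup N) (hc : Subgroup.centralizer (N : Set G) = ⊥) (x : G)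
    (hx : kk x = 1) : x = 1 := by
  rw [kk, Subgroup.index_eq_one] at hx
  exact eq_one_of_normal_le hN hs hc N hN (simple_ne_bot hs) x (by rw [hx]; exact le_top)

theorem relIndex_dvd_of_normal' {G : Type*} [Group G] [Finite G] (C K : Subgroup G) [K.Normal] :
    C.relIndex K ∣ C.index := by
  have h1 := Subgroup.relIndex_mul_index (inf_le_left : C ⊓ K ≤ C)
  have h2 := Subgroup.relIndex_mul_index (inf_le_right : C ⊓ K ≤ K)
  rw [Subgroup.inf_relIndex_left] at h1
  rw [Subgroup.inf_relIndex_right] at h2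
  obtain ⟨t, ht⟩ := Subgroup.relIndex_dvd_index_of_normal K C
  have h0 : K.relIndex C ≠ 0 := by
    rw [Subgroup.relIndex]; exact Subgroup.index_ne_zero_of_finite
  refine ⟨t, ?_⟩
  apply mul_left_cancel₀ h0
  rw [h1, ← h2, ht]; ring

theorem eq_one_of_coprime {G : Type*} [Group G] [Finite G] {N : Subgroup G} (hN : N.Normal)
    (hs : IsSimpleGroup N) (hc : Subgroup.centralizer (N : Set G) = ⊥)
    (K : Subgroup G) (hK : K.Normal) (hK0 : K ≠ ⊥) (x : G)
    (hx : (Nat.card K).Coprime (kk x)) : x = 1 := by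
  apply eq_one_of_normal_le hN hs hc K hK hK0
  rw [← Subgroup.relIndex_eq_one]
  exact Nat.eq_one_of_dvd_coprimes hx (Subgroup.relIndex_dvd_card _ _)
    (relIndex_dvd_of_normal' _ _)

theorem pair_index {G : Type*} [Group G] [Finite G] (x y : G) (h : (kk x).Coprime (kk y)) :
    (MulAction.stabilizer (ConjAct G) (x, y)).index = kk x * kk y ∧
      ∀ x' y', IsConj x x' → IsConj y y' → IsConj (x * y) (x' * y') := by
  have hx : (MulAction.stabilizer (ConjAct G) x).index = kk x := by
    rw [ConjAct.stabilizer_eq_centralizer]; rfl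
  have hy : (MulAction.stabilizer (ConjAct G) y).index = kk y := by
    rw [ConjAct.stabilizer_eq_centralizer]; rfl
  have : Finite (ConjAct G) := inferInstanceAs (Finite G)
  have h1 : kk x ∣ (MulAction.stabilizer (ConjAct G) (x, y)).index := by
    rw [← hx]
    apply Subgroup.index_dvd_of_le
    intro g hg
    exact congrArg Prod.fst hg
  have h2 : kk y ∣ (MulAction.stabilizer (ConjAct G) (x, y)).index := by
    rw [← hy]
    apply Subgroup.index_dvd_of_le
    intro g hg
    exact congrArg Prod.snd hg
  have h3 := h.mul_dvd_of_dvd_of_dvd h1 h2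
  have h4 : kk x * kk y ≤ (MulAction.stabilizer (ConjAct G) (x, y)).index :=
    Nat.le_of_dvd (Nat.pos_of_ne_zero Subgroup.index_ne_zero_of_finite) h3
  have hsub : MulAction.orbit (ConjAct G) (x, y) ⊆
      {z : G | IsConj x z} ×ˢ {z : G | IsConj y z} := by
    rintro _ ⟨g, rfl⟩
    refine ⟨?_, ?_⟩
    · exact isConj_iff.2 ⟨ConjAct.ofConjAct g, rfl⟩
    · exact isConj_iff.2 ⟨ConjAct.ofConjAct g, rfl⟩
  have hcard : ({z : G | IsConj x z} ×ˢ {z : G | IsConj y z}).ncard = kk x * kk y := by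
    rw [Set.ncard_prod, ← Nat.card_coe_set_eq, ← Nat.card_coe_set_eq, aux_conj_card,
      aux_conj_card]
  rw [MulAction.index_stabilizer] at h4 ⊢
  have heq := Set.eq_of_subset_of_ncard_le hsub (by rw [hcard]; exact h4) (Set.toFinite _)
  refine ⟨by rw [heq, hcard], ?_⟩
  intro x' y' hx' hy'
  have hm : (x', y') ∈ MulAction.orbit (ConjAct G) (x, y) := by
    rw [heq]; exact ⟨hx', hy'⟩
  obtain ⟨g, hg⟩ := hm
  have e1 : ConjAct.ofConjAct g * x * (ConjAct.ofConjAct g)⁻¹ = x' := congrArg Prod.fst hg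
  have e2 : ConjAct.ofConjAct g * y * (ConjAct.ofConjAct g)⁻¹ = y' := congrArg Prod.snd hg
  rw [← e1, ← e2]
  exact isConj_iff.2 ⟨ConjAct.ofConjAct g, by group⟩

theorem kk_mul_dvd {G : Type*} [Group G] [Finite G] (x y : G) (h : (kk x).Coprime (kk y)) :
    kk (x * y) ∣ kk x * kk y := by
  rw [← (pair_index x y h).1]
  have hxy : (MulAction.stabilizer (ConjAct G) (x * y)).index = kk (x * y) := by
    rw [ConjAct.stabilizer_eq_centralizer]; rfl
  rw [← hxy]
  apply Subgroup.index_dvd_of_le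
  intro g hg
  have e1 : g • x = x := congrArg Prod.fst hg
  have e2 : g • y = y := congrArg Prod.snd hg
  rw [MulAction.mem_stabilizer_iff, smul_mul', e1, e2]

theorem kk_mul_comm {G : Type*} [Group G] [Finite G] (x y : G) : kk (x * y) = kk (y * x) :=
  kk_conj (isConj_iff.2 ⟨x⁻¹, by group⟩)

theorem kk_le {G : Type*} [Group G] [Finite G] (x y : G) (h : (kk x).Coprime (kk y)) :
    kk y ≤ kk (x * y) := by
  have h1 : (fun b => x * b) '' {z : G | IsConj y z} ⊆ {z : G | IsConj (x * y) z} := by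
    rintro _ ⟨b, hb, rfl⟩
    exact (pair_index x y h).2 x b (IsConj.refl x) hb
  have h2 := Set.ncard_le_ncard h1 (Set.toFinite _)
  rw [Set.ncard_image_of_injective _ (mul_right_injective x), ← Nat.card_coe_set_eq,
    ← Nat.card_coe_set_eq, aux_conj_card, aux_conj_card] at h2
  exact h2

theorem card_dvd_of_free {G : Type*} [Group G] [Finite G] (K : Subgroup G) (B : Set G)
    (h : ∀ k ∈ K, ∀ b ∈ B, k * b ∈ B) : Nat.card K ∣ Nat.card B := by
  let act : MulAction K B :=
    { smul := fun k b => ⟨k.1 * b.1, h k.1 k.2 b.1 b.2⟩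
      one_smul := fun b => Subtype.ext (one_mul _)
      mul_smul := fun k l b => Subtype.ext (mul_assoc _ _ _) }
  have hfree : ∀ b : B, MulAction.stabilizer K b = ⊥ := by
    intro b
    rw [eq_bot_iff]
    intro k hk
    have h1 : k.1 * b.1 = b.1 := congrArg Subtype.val hk
    rw [Subgroup.mem_bot]
    exact Subtype.ext (by simpa using h1)
  have := Nat.card_congr (MulAction.selfEquivOrbitsQuotientProd hfree)
  rw [Nat.card_prod] at this
  exact ⟨_, by rw [this, mul_comm]⟩

theorem kk_mul_ne {G : Type*} [Group G] [Finite G] {N : Subgroup G} (hN : N.Normal)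
    (hs : IsSimpleGroup N) (hc : Subgroup.centralizer (N : Set G) = ⊥)
    (x y : G) (hx1 : x ≠ 1) (h : (kk x).Coprime (kk y)) : kk (x * y) ≠ kk y := by
  intro heq
  set B : Set G := {z : G | IsConj y z} with hB
  have hcard : B.ncard = kk y := by rw [← Nat.card_coe_set_eq, aux_conj_card]
  have hcard2 : {z : G | IsConj (x * y) z}.ncard = kk y := by
    rw [← Nat.card_coe_set_eq, aux_conj_card, ← heq]
  have himg : ∀ x', IsConj x x' → (fun b => x' * b) '' B = {z : G | IsConj (x * y) z} := by
    intro x' hx'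
    refine Set.eq_of_subset_of_ncard_le ?_ ?_ (Set.toFinite _)
    · rintro _ ⟨b, hb, rfl⟩
      exact (pair_index x y h).2 x' b hx' hb
    · rw [Set.ncard_image_of_injective _ (mul_right_injective x'), hcard, hcard2]
  let K : Subgroup G :=
    { carrier := {k | ∀ b, k * b ∈ B ↔ b ∈ B}
      one_mem' := by intro b; simp
      mul_mem' := by
        intro k l hk hl b
        rw [mul_assoc, hk, hl]
      inv_mem' := by
        intro k hk b
        rw [← hk (k⁻¹ * b)]; simp }
  have hBconj : ∀ g b, g * b * g⁻¹ ∈ B ↔ b ∈ B := by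
    intro g b
    have hc : IsConj b (g * b * g⁻¹) := isConj_iff.2 ⟨g, rfl⟩
    exact ⟨fun h => IsConj.trans h hc.symm, fun h => IsConj.trans h hc⟩
  have hK : K.Normal := by
    constructor
    intro k hk g b
    rw [← hBconj g⁻¹ (g * k * g⁻¹ * b), ← hBconj g⁻¹ b]
    rw [← hk (g⁻¹ * b * g⁻¹⁻¹)]
    have : g⁻¹ * (g * k * g⁻¹ * b) * g⁻¹⁻¹ = k * (g⁻¹ * b * g⁻¹⁻¹) := by group
    rw [this]
  have hKmem : ∀ x', IsConj x x' → x⁻¹ * x' ∈ K := by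
    intro x' hx' b
    have h1 := himg x (IsConj.refl x)
    have h2 := himg x' hx'
    have h3 : b ∈ B ↔ x' * b ∈ {z : G | IsConj (x * y) z} := by
      rw [← h2]; simp
    have h4 : x⁻¹ * x' * b ∈ B ↔ x' * b ∈ {z : G | IsConj (x * y) z} := by
      rw [← h1]
      constructor
      · intro hb; exact ⟨_, hb, by group⟩
      · rintro ⟨c, hc, hce⟩
        have : x⁻¹ * x' * b = c := by
          rw [mul_assoc, ← hce]; simp
        rw [this]; exact hc
    rw [h3, h4]
  have hdvd : Nat.card K ∣ kk y := by
    have h1 := card_dvd_of_free K B (fun k hk b hb => (hk b).2 hb)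
    rwa [Nat.card_coe_set_eq, hcard] at h1
  have hK0 : K ≠ ⊥ := by
    intro hbot
    apply hx1
    apply eq_one_of_normal_le hN hs hc N hN (simple_ne_bot hs)
    intro g _
    have h1 := hKmem (g * x * g⁻¹) (isConj_iff.2 ⟨g, rfl⟩)
    rw [hbot, Subgroup.mem_bot] at h1
    rw [Subgroup.mem_centralizer_iff]
    intro t ht
    rw [Set.mem_singleton_iff] at ht
    rw [ht]
    have h2 : g * x * g⁻¹ = x := by
      have := congrArg (fun t => x * t) h1
      simpa [mul_assoc] using this
    calc x * g = g * x * g⁻¹ * g := by rw [h2]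
      _ = g * x := by group
  exact hx1 (eq_one_of_coprime hN hs hc K hK hK0 x
    ((h.coprime_dvd_right hdvd).symm))

theorem exists_not_dvd {G : Type*} [Group G] [Finite G] (K : Subgroup G) (hK : K.Normal)
    (r : ℕ) (hr : r.Prime) (hrK : r ∣ Nat.card K) : ∃ z ∈ K, z ≠ 1 ∧ ¬ r ∣ kk z := by
  have : Fact r.Prime := ⟨hr⟩
  obtain ⟨P⟩ : Nonempty (Sylow r G) := inferInstance
  let act : MulAction P K := MulAction.compHom K ((MulAut.conjNormal (H := K)).comp P.1.subtype)
  have hsm : ∀ (g : P) (k : K), ((g • k : K) : G) = g.1 * k.1 * (g.1)⁻¹ := fun g k =>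
    MulAut.conjNormal_apply g.1 k
  obtain ⟨z, hz, hz1⟩ := P.isPGroup'.exists_fixed_point_of_prime_dvd_card_of_fixed_point K hrK
    (a := 1) (by intro g; apply Subtype.ext; rw [hsm]; simp)
  refine ⟨z.1, z.2, fun h => hz1 (Subtype.ext h.symm), fun hd => ?_⟩
  have hle : P.1 ≤ Subgroup.centralizer {z.1} := by
    intro g hg
    have h1 := congrArg Subtype.val (hz ⟨g, hg⟩)
    rw [hsm] at h1
    rw [Subgroup.mem_centralizer_iff]
    rintro _ rfl
    calc z.1 * g = g * z.1 * g⁻¹ * g := by rw [h1]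
      _ = g * z.1 := by group
  exact P.not_dvd_index (hd.trans (Subgroup.index_dvd_of_le hle))

theorem prime_le {G : Type*} [Group G] [Finite G] {N : Subgroup G} (hN : N.Normal)
    (hs : IsSimpleGroup N) (hc : Subgroup.centralizer (N : Set G) = ⊥)
    (x y : G) (hx : (kk x).Prime) (hy : (kk y).Prime) : kk x ≤ kk y := by
  have hcore : (Subgroup.centralizer {y} : Subgroup G).normalCore = ⊥ := by
    by_contra h0
    have h1 := eq_one_of_normal_le hN hs hc _ inferInstance h0 y (Subgroup.normalCore_le _)
    subst h1
    have : (Subgroup.centralizer {1} : Subgroup G) = ⊤ := by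
      ext; simp [Subgroup.mem_centralizer_iff]
    rw [kk, this, Subgroup.index_top] at hy
    exact Nat.not_prime_one hy
  rw [Subgroup.normalCore_eq_ker] at hcore
  have h1 := Subgroup.card_dvd_of_injective _ ((MonoidHom.ker_eq_bot_iff _).1 hcore)
  rw [Nat.card_perm] at h1
  have h2 : kk x ∣ (kk y).factorial := (Subgroup.index_dvd_card _).trans h1
  exact (hx.dvd_factorial).1 h2

theorem no_prime_relIndex {G : Type*} [Group G] [Finite G] {N : Subgroup G} (hN : N.Normal)
    (hs : IsSimpleGroup N) (hc : Subgroup.centralizer (N : Set G) = ⊥)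
    (s : G) (hsN : s ∈ N) (hs1 : s ≠ 1) (p : ℕ) (hp : p.Prime)
    (h : (Subgroup.centralizer {s} : Subgroup G).relIndex N ∣ p) : False := by
  rcases (Nat.dvd_prime hp).1 h with h1 | h1
  · rw [Subgroup.relIndex_eq_one] at h1
    exact hs1 (eq_one_of_normal_le hN hs hc N hN (simple_ne_bot hs) s h1)
  · apply burnside_prime (⟨s, hsN⟩ : N) p hp
    rw [← h1, Subgroup.relIndex]
    congr 1
    ext g
    simp [Subgroup.mem_centralizer_iff, Subgroup.mem_subgroupOf, Subtype.ext_iff]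
    constructor
    · intro h; exact h s hsN rfl
    · rintro h a _ rfl; exact h

theorem core_prime {G : Type*} [Group G] [Finite G] {N : Subgroup G} (hN : N.Normal)
    (hs : IsSimpleGroup N) (hc : Subgroup.centralizer (N : Set G) = ⊥)
    (a b : ℕ) (hab : a ≠ b) (hb : ¬ b.Prime)
    (hall : ∀ g : G, kk g = 1 ∨ (kk g).Prime ∨ kk g = a ∨ kk g = b)
    (x y : G) (hx : (kk x).Prime) (hy : kk y = a) (ha1 : 1 < a) (hpa : ¬ kk x ∣ a) : False := by
  have huniq : ∀ g : G, (kk g).Prime → kk g = kk x := fun g hg =>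
    le_antisymm (prime_le hN hs hc g x hg hx) (prime_le hN hs hc x g hx hg)
  have hone : ∀ g : G, kk g = 1 → g = 1 := kk_eq_one hN hs hc
  have kone : kk (1 : G) = 1 := by
    have : (Subgroup.centralizer {1} : Subgroup G) = ⊤ := by
      ext; simp [Subgroup.mem_centralizer_iff]
    rw [kk, this, Subgroup.index_top]
  have hx1 : x ≠ 1 := by rintro rfl; rw [kone] at hx; exact Nat.not_prime_one hx
  have hy1 : y ≠ 1 := by rintro rfl; rw [kone] at hy; omega
  have hcop : (kk x).Coprime (kk y) := by
    rw [hy]; exact (Nat.Prime.coprime_iff_not_dvd hx).2 hpa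
  have hle := kk_le x y hcop
  have hne1 := kk_mul_ne hN hs hc x y hx1 hcop
  have hne2 : kk (x * y) ≠ kk x := by
    rw [kk_mul_comm]; exact kk_mul_ne hN hs hc y x hy1 hcop.symm
  have hdvd := kk_mul_dvd x y hcop
  have hkb : kk (x * y) = b := by
    rcases hall (x * y) with h | h | h | h
    · omega
    · exact absurd (huniq _ h) hne2
    · exact absurd (h.trans hy.symm) hne1
    · exact h
  rw [hkb, hy] at hdvd
  have hpb : kk x ∣ b := by
    by_contra hpb
    have h1 : b ∣ a :=
      (((Nat.Prime.coprime_iff_not_dvd hx).2 hpb).symm).dvd_of_dvd_mul_left hdvd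
    have := Nat.le_of_dvd (by omega) h1
    omega
  obtain ⟨b', hb'⟩ := hpb
  have hb'a : b' ∣ a := by
    rw [hb'] at hdvd
    exact Nat.dvd_of_mul_dvd_mul_left hx.pos hdvd
  have hpN : ∀ s ∈ N, s ≠ 1 → kk s ≠ kk x := by
    intro s hsN hs1 hk
    apply no_prime_relIndex hN hs hc s hsN hs1 (kk x) hx
    rw [← hk]
    exact relIndex_dvd_of_normal' _ _
  by_cases hcb : (Nat.card N).Coprime b'
  · have hka : ∀ s ∈ N, s ≠ 1 → kk s = a := by
      intro s hsN hs1
      rcases hall s with h | h | h | h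
      · exact absurd (hone s h) hs1
      · exact absurd (huniq s h) (hpN s hsN hs1)
      · exact h
      · exfalso
        apply no_prime_relIndex hN hs hc s hsN hs1 (kk x) hx
        have h1 : (Subgroup.centralizer {s} : Subgroup G).relIndex N ∣ kk s :=
          relIndex_dvd_of_normal' _ _
        rw [h, hb'] at h1
        exact (hcb.coprime_dvd_left (Subgroup.relIndex_dvd_card _ _)).dvd_of_dvd_mul_right h1
    obtain ⟨t, ht⟩ := Subgroup.ne_bot_iff_exists_ne_one.1 (simple_ne_bot hs)
    have hsN : t.1 ∈ N := t.2
    have hs1 : t.1 ≠ 1 := fun h => ht (Subtype.ext h)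
    apply hs1
    apply eq_one_of_coprime hN hs hc N hN (simple_ne_bot hs)
    rw [hka _ hsN hs1]
    apply Nat.Coprime.symm
    apply Nat.coprime_of_dvd
    intro r hr hra hrN
    obtain ⟨z, hzN, hz1, hrz⟩ := exists_not_dvd N hN r hr hrN
    rw [hka z hzN hz1] at hrz
    exact hrz hra
  · obtain ⟨r, hr, hrN, hrb⟩ := Nat.Prime.not_coprime_iff_dvd.1 hcb
    obtain ⟨z, hzN, hz1, hrz⟩ := exists_not_dvd N hN r hr hrN
    rcases hall z with h | h | h | h
    · exact hz1 (hone z h)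
    · exact hpN z hzN hz1 (huniq z h)
    · rw [h] at hrz; exact hrz (hrb.trans hb'a)
    · rw [h, hb'] at hrz; exact hrz (hrb.mul_left _)

theorem core_main {G : Type*} [Group G] [Finite G] {N : Subgroup G} (hN : N.Normal)
    (hs : IsSimpleGroup N) (hc : Subgroup.centralizer (N : Set G) = ⊥)
    (a b : ℕ) (hab : a ≠ b) (ha1 : 1 < a) (hb1 : 1 < b) (ha : ¬ a.Prime) (hb : ¬ b.Prime)
    (hall : ∀ g : G, kk g = 1 ∨ (kk g).Prime ∨ kk g = a ∨ kk g = b)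
    (u v : G) (hu : kk u = a) (hv : kk v = b) : False := by
  have hone : ∀ g : G, kk g = 1 → g = 1 := kk_eq_one hN hs hc
  have hz : ∀ r, r.Prime → (∃ g : G, r ∣ kk g) → ∃ z : G, z ≠ 1 ∧ ¬ r ∣ kk z := by
    rintro r hr ⟨g, hg⟩
    obtain ⟨z, -, h⟩ := exists_not_dvd (⊤ : Subgroup G) inferInstance r hr (by
      rw [Subgroup.card_top]; exact hg.trans (Subgroup.index_dvd_card _))
    exact ⟨z, h⟩
  have kone : kk (1 : G) = 1 := by
    have : (Subgroup.centralizer {1} : Subgroup G) = ⊤ := by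
      ext; simp [Subgroup.mem_centralizer_iff]
    rw [kk, this, Subgroup.index_top]
  by_cases hp : ∃ x : G, (kk x).Prime
  · obtain ⟨x, hx⟩ := hp
    obtain ⟨z, hz1, hzx⟩ := hz (kk x) hx ⟨x, dvd_rfl⟩
    rcases hall z with h | h | h | h
    · exact hz1 (hone z h)
    · have : kk z = kk x :=
        le_antisymm (prime_le hN hs hc z x h hx) (prime_le hN hs hc x z hx h)
      exact hzx (by rw [this])
    · rw [h] at hzx
      exact core_prime hN hs hc a b hab hb hall x u hx hu ha1 hzx
    · rw [h] at hzx
      refine core_prime hN hs hc b a hab.symm ha ?_ x v hx hv hb1 hzx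
      intro g
      rcases hall g with h | h | h | h <;> simp [h]
  · push Not at hp
    have hcop : (kk u).Coprime (kk v) := by
      rw [hu, hv]
      apply Nat.coprime_of_dvd
      intro r hr hra hrb
      obtain ⟨z, hz1, hrz⟩ := hz r hr ⟨u, by rw [hu]; exact hra⟩
      rcases hall z with h | h | h | h
      · exact hz1 (hone z h)
      · exact hp z h
      · rw [h] at hrz; exact hrz hra
      · rw [h] at hrz; exact hrz hrb
    have hu1 : u ≠ 1 := by rintro rfl; rw [kone] at hu; omega
    have hv1 : v ≠ 1 := by rintro rfl; rw [kone] at hv; omega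
    rcases hall (u * v) with h | h | h | h
    · have := kk_le u v hcop
      omega
    · exact hp _ h
    · refine kk_mul_ne hN hs hc v u hv1 hcop.symm ?_
      rw [← kk_mul_comm, h, hu]
    · exact kk_mul_ne hN hs hc u v hu1 hcop (by rw [h, hv])

/-- If a finite group has exactly two composite conjugacy class sizes, then `G` is not
almost simple: there is no nonabelian simple normal subgroup `N` of `G` with trivial
centralizer `C_G(N) = 1`. -/
theorem stmt_5 (G : Type*) [Group G] [Finite G]
    (hcomp : {n ∈ csSet G | IsCompositeNat n}.ncard = 2) :
    ¬ ∃ N : Subgroup G, N.Normal ∧ IsSimpleGroup N ∧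
      (¬ ∀ x ∈ N, ∀ y ∈ N, x * y = y * x) ∧
      Subgroup.centralizer (N : Set G) = ⊥ := by
  rintro ⟨N, hN, hs, -, hc⟩
  obtain ⟨a, b, hab, hset⟩ := Set.ncard_eq_two.1 hcomp
  have ha : a ∈ {n ∈ csSet G | IsCompositeNat n} := by rw [hset]; simp
  have hb : b ∈ {n ∈ csSet G | IsCompositeNat n} := by rw [hset]; simp
  obtain ⟨⟨u, hu⟩, ha1, hap⟩ := ha
  obtain ⟨⟨v, hv⟩, hb1, hbp⟩ := hb
  refine core_main hN hs hc a b hab ha1 hb1 hap hbp ?_ u v hu.symm hv.symm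
  intro g
  by_cases h1 : kk g = 1
  · exact Or.inl h1
  by_cases h2 : (kk g).Prime
  · exact Or.inr (Or.inl h2)
  have hpos := kk_pos g
  have hmem : kk g ∈ {n ∈ csSet G | IsCompositeNat n} := ⟨⟨g, rfl⟩, by omega, h2⟩
  rw [hset] at hmem
  exact Or.inr (Or.inr (by simpa using hmem))
end

section
/- Let G be a finite group with |cs(G)| ≥ 4 such that exactly two elements of cs(G) are composite numbers, and one of these two composite class sizes is a prime power. Then G is soluble. -/
section
open Polynomial

/-- average of roots of unity -/
theorem avg_root_unity (N : ℕ) (hN : 0 < N) (S : Multiset ℂ) (hS : ∀ z ∈ S, z ^ N = 1) (hd : S.card ≠ 0)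
    (α : ℂ) (hα : (S.card : ℂ) * α = S.sum) (hint : IsIntegral ℤ α) (h0 : α ≠ 0) :
    ∀ z ∈ S, z = α := by
  have hnorm1 : ‖α‖ = 1 := by
    let A : Set ℂ := {z | z ^ N = 1}
    have hfin : A.Finite := by
      have : A ⊆ ((nthRoots N (1:ℂ)).toFinset : Set ℂ) := by
        intro z hz
        simp [mem_nthRoots hN]
        exact hz
      exact Set.Finite.subset (Finset.finite_toSet _) this
    let K := IntermediateField.adjoin ℚ A
    have : Finite A := hfin
    have : FiniteDimensional ℚ K := by
      apply IntermediateField.finiteDimensional_adjoin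
      intro z hz
      exact ((IsIntegral.of_pow hN (by rw [show z ^ N = 1 from hz]; exact isIntegral_one)))
    have : NumberField K := { }
    have hdC : (S.card : ℂ) ≠ 0 := by exact_mod_cast hd
    -- lift S
    obtain ⟨S', hS'⟩ : ∃ S' : Multiset K, S'.map (algebraMap K ℂ) = S := by
      have : CanLift ℂ K (algebraMap K ℂ) (fun z => z ∈ K) := ⟨fun z hz => ⟨⟨z, hz⟩, rfl⟩⟩
      have := Multiset.canLift (algebraMap K ℂ) (fun z => z ∈ K)
      have h := this.prf S (fun z hz => IntermediateField.subset_adjoin ℚ A (hS z hz))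
      exact h
    have hcard : S'.card = S.card := by rw [← hS']; simp
    have hsum : algebraMap K ℂ S'.sum = S.sum := by rw [← hS', map_multiset_sum]
    have hS1 : ∀ z ∈ S', z ^ N = 1 := by
      intro z hz
      have := hS (algebraMap K ℂ z) (by rw [← hS']; exact Multiset.mem_map_of_mem _ hz)
      apply (algebraMap K ℂ).injective
      rw [map_pow, this, map_one]
    let β : K := S'.sum / S'.card
    have hβ : algebraMap K ℂ β = α := by
      simp only [β]
      rw [map_div₀, hsum, map_natCast, hcard, ← hα]
      field_simp
    have hβint : IsIntegral ℤ β := by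
      rw [← isIntegral_algebraMap_iff (algebraMap K ℂ).injective (R := ℤ), hβ]
      exact hint
    have hle : ∀ φ : K →+* ℂ, ‖φ β‖ ≤ 1 := by
      intro φ
      simp only [β]
      rw [map_div₀, map_natCast, map_multiset_sum, norm_div]
      have : ‖(S'.map φ).sum‖ ≤ S'.card := by
        calc ‖(S'.map φ).sum‖ ≤ ((S'.map φ).map (fun z => ‖z‖)).sum := norm_multiset_sum_le _
          _ ≤ ((S'.map φ).map (fun z => ‖z‖)).card • (1:ℝ) := by
              apply Multiset.sum_le_card_nsmul
              intro r hr
              simp only [Multiset.map_map, Multiset.mem_map, Function.comp] at hr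
              obtain ⟨z, hz, rfl⟩ := hr
              have : φ z ^ N = 1 := by rw [← map_pow, hS1 z hz, map_one]
              exact (Complex.norm_eq_one_of_pow_eq_one this hN.ne').le
          _ = S'.card := by simp
      simp only [Complex.norm_natCast]
      exact div_le_one_of_le₀ this (by positivity)
    have hβ0 : β ≠ 0 := by rintro h; rw [h, map_zero] at hβ; exact h0 hβ.symm
    obtain ⟨m, hm, hp⟩ := NumberField.Embeddings.pow_eq_one_of_norm_le_one K ℂ hβ0 hβint hle
    have : α ^ m = 1 := by rw [← hβ, ← map_pow, hp, map_one]
    exact (Complex.norm_eq_one_of_pow_eq_one this hm.ne')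
  -- strict convexity
  have hn : ∀ z ∈ S, ‖z‖ = 1 := fun z hz => Complex.norm_eq_one_of_pow_eq_one (hS z hz) hN.ne'
  have hle : ∀ z ∈ S, (z * (starRingEnd ℂ) α).re ≤ 1 := by
    intro z hz
    calc _ ≤ ‖z * (starRingEnd ℂ) α‖ := Complex.re_le_norm _
      _ = 1 := by rw [norm_mul, hn z hz, RCLike.norm_conj, hnorm1]; norm_num
  have hαα : α * (starRingEnd ℂ) α = 1 := by
    rw [Complex.mul_conj, Complex.normSq_eq_norm_sq, hnorm1]; norm_num
  have hsum : (S.map (fun z => 1 - (z * (starRingEnd ℂ) α).re)).sum = 0 := by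
    rw [Multiset.sum_map_sub]
    have : (S.map (fun z => (z * (starRingEnd ℂ) α).re)).sum = (S.card : ℝ) := by
      have h1 : (S.map (fun z => (z * (starRingEnd ℂ) α))).sum = S.card := by
        rw [Multiset.sum_map_mul_right, Multiset.map_id', ← hα, mul_assoc, hαα, mul_one]
      have h2 := congrArg Complex.re h1
      rw [← Complex.coe_reAddGroupHom, map_multiset_sum] at h2
      simpa using h2
    rw [this]; simp
  have hz0 : ∀ r ∈ S.map (fun z => 1 - (z * (starRingEnd ℂ) α).re), r = 0 := by
    have hnn : ∀ r ∈ S.map (fun z => 1 - (z * (starRingEnd ℂ) α).re), 0 ≤ r := by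
      intro r hr
      obtain ⟨z, hz, rfl⟩ := Multiset.mem_map.mp hr
      linarith [hle z hz]
    intro r hr
    exact le_antisymm (hsum ▸ Multiset.single_le_sum hnn r hr) (hnn r hr)
  intro z hz
  have h1 := hz0 _ (Multiset.mem_map_of_mem _ hz)
  have h2 : (z * (starRingEnd ℂ) α).re = 1 := by linarith
  have h3 : ‖z * (starRingEnd ℂ) α‖ = 1 := by rw [norm_mul, hn z hz, RCLike.norm_conj, hnorm1]; norm_num
  have h4 : z * (starRingEnd ℂ) α = 1 := by
    have := Complex.sq_norm (z * (starRingEnd ℂ) α)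
    rw [h3, Complex.normSq_apply, h2] at this
    apply Complex.ext
    · simpa using h2
    · have : (z * (starRingEnd ℂ) α).im * (z * (starRingEnd ℂ) α).im = 0 := by linarith
      simpa using mul_self_eq_zero.mp this
  calc z = z * (α * (starRingEnd ℂ) α) := by rw [hαα, mul_one]
    _ = (z * (starRingEnd ℂ) α) * α := by ring
    _ = α := by rw [h4, one_mul]
end

section
open Polynomial Module

theorem charpoly_root_pow {E : Type*} [AddCommGroup E] [Module ℂ E] [FiniteDimensional ℂ E]
    (f : End ℂ E) (N : ℕ) (hf : f ^ N = 1) (z : ℂ) (hz : z ∈ f.charpoly.roots) : z ^ N = 1 := by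
  have h1 : f.HasEigenvalue z := by
    rw [End.hasEigenvalue_iff_isRoot_charpoly]
    exact (mem_roots (LinearMap.charpoly_monic f).ne_zero).mp hz
  obtain ⟨v, hv⟩ := h1.exists_hasEigenvector
  have h2 := hv.pow_apply N
  rw [hf] at h2
  have h3 : (z ^ N - 1) • v = 0 := by rw [sub_smul, ← h2]; simp
  rcases smul_eq_zero.mp h3 with h | h
  · exact sub_eq_zero.mp h
  · exact absurd h hv.2

theorem scalar_of_roots {E : Type*} [AddCommGroup E] [Module ℂ E] [FiniteDimensional ℂ E]
    (f : End ℂ E) (N : ℕ) (hN : 0 < N) (hf : f ^ N = 1) (α : ℂ) (h : ∀ z ∈ f.charpoly.roots, z = α) :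
    f = α • (1 : End ℂ E) := by
  have hs : f.charpoly.Splits := IsAlgClosed.splits _
  have h1 : f.charpoly = (X - C α) ^ (f.charpoly.roots.card) := by
    conv_lhs => rw [hs.eq_prod_roots_of_monic (LinearMap.charpoly_monic f)]
    rw [Multiset.eq_replicate_card.mpr h]
    simp
  have h2 : minpoly ℂ f ∣ (X - C α) ^ (f.charpoly.roots.card) := by
    rw [← h1]; exact LinearMap.minpoly_dvd_charpoly f
  have h3 : minpoly ℂ f ∣ X ^ N - 1 := minpoly.dvd _ _ (by simp [hf])
  have hsep : (X ^ N - 1 : ℂ[X]).Separable := by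
    apply Polynomial.separable_X_pow_sub_C (1:ℂ) _ one_ne_zero
    exact_mod_cast hN.ne'
  have h4 : Squarefree (minpoly ℂ f) := (hsep.squarefree).squarefree_of_dvd h3
  have h5 : minpoly ℂ f ∣ X - C α := h4.isRadical _ _ h2
  have h6 : aeval f (X - C α) = 0 := by
    obtain ⟨q, hq⟩ := h5
    rw [hq, map_mul, minpoly.aeval, zero_mul]
  simp at h6
  rw [sub_eq_zero] at h6
  rw [h6]; ext v; simp [Algebra.algebraMap_eq_smul_one]

theorem lemL0 {T : Type*} [Group T] [Finite T] {E : Type*} [AddCommGroup E] [Module ℂ E]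
    [FiniteDimensional ℂ E] (ρ : T →* End ℂ E) (x : T) (Y : Finset T)
    (hY : ∀ y, y ∈ Y ↔ IsConj x y) (u k : ℕ) (hu : u.Prime) (hcard : Y.card = u ^ k)
    (D : Subgroup T) (hD : D = Subgroup.closure {z | ∃ y ∈ Y, ∃ y' ∈ Y, z = y * y'⁻¹})
    (hfix : ∀ v, (∀ d ∈ D, ρ d v = v) → v = 0) (ω : ℂ) (hω : ω ≠ 0) (hint : IsIntegral ℤ ω)
    (hnil : IsNilpotent ((∑ y ∈ Y, ρ y) - ω • (1 : End ℂ E))) : u ∣ finrank ℂ E := by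
  by_contra hnd
  have hdne : finrank ℂ E ≠ 0 := fun h => hnd (h ▸ dvd_zero u)
  set d := finrank ℂ E with hd
  set N := orderOf x
  have hN : 0 < N := orderOf_pos x
  have hxN : (ρ x) ^ N = 1 := by rw [← map_pow, pow_orderOf_eq_one, map_one]
  have htrc : ∀ y ∈ Y, LinearMap.trace ℂ E (ρ y) = LinearMap.trace ℂ E (ρ x) := by
    intro y hy
    obtain ⟨c, hc⟩ := isConj_iff.mp ((hY y).mp hy)
    rw [← hc, map_mul, LinearMap.trace_mul_comm, ← map_mul]
    simp
  have htr : (d : ℂ) * ω = (u:ℂ) ^ k * LinearMap.trace ℂ E (ρ x) := by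
    have h1 := (LinearMap.isNilpotent_trace_of_isNilpotent hnil).eq_zero
    rw [map_sub, map_sum, Finset.sum_congr rfl htrc, Finset.sum_const, hcard, map_smul,
      LinearMap.trace_one, sub_eq_zero] at h1
    simp only [nsmul_eq_mul, smul_eq_mul] at h1
    push_cast at h1
    rw [h1]; ring
  set S := (ρ x).charpoly.roots with hS
  have hSr : ∀ z ∈ S, z ^ N = 1 := fun z hz => charpoly_root_pow _ N hxN z hz
  have hSsum : LinearMap.trace ℂ E (ρ x) = S.sum :=
    Module.End.trace_eq_sum_roots_charpoly_of_splits (IsAlgClosed.splits _)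
  have hScard : S.card = d := by
    rw [hS, ← (IsAlgClosed.splits _).natDegree_eq_card_roots, LinearMap.charpoly_natDegree]
  have hSint : IsIntegral ℤ S.sum := by
    apply IsIntegral.multiset_sum
    intro z hz
    exact IsIntegral.of_pow hN (by rw [hSr z hz]; exact isIntegral_one)
  have hdC : (d : ℂ) ≠ 0 := by exact_mod_cast hdne
  set α : ℂ := S.sum / d with hα
  have hαS : (S.card : ℂ) * α = S.sum := by rw [hScard, hα]; field_simp
  have hωα : ω = (u : ℂ) ^ k * α := by
    rw [hα, ← hSsum]; field_simp; rw [← htr]; ring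
  have hα0 : α ≠ 0 := by intro h; rw [h, mul_zero] at hωα; exact hω hωα
  have hcop : IsCoprime (d : ℤ) ((u : ℤ) ^ k) := by
    have : Nat.Coprime d (u ^ k) := Nat.Coprime.pow_right _ ((Nat.Prime.coprime_iff_not_dvd hu).mpr hnd).symm
    have := Nat.isCoprime_iff_coprime.mpr this
    simpa using this
  have hαint : IsIntegral ℤ α := by
    obtain ⟨a, b, hab⟩ := hcop
    have : α = (a : ℂ) * S.sum + (b : ℂ) * ω := by
      rw [hωα, ← hαS, hScard]
      have : (a : ℂ) * d + b * (u : ℂ) ^ k = 1 := by exact_mod_cast hab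
      linear_combination (-α) * this
    rw [this]
    exact ((isIntegral_algebraMap (R := ℤ) (x := a)).mul hSint).add ((isIntegral_algebraMap (R := ℤ) (x := b)).mul hint)
  have hall := avg_root_unity N hN S hSr (by rw [hScard]; exact hdne) α hαS hαint hα0
  have hscal := scalar_of_roots (ρ x) N hN hxN α hall
  have hall' : ∀ y ∈ Y, ρ y = α • (1 : End ℂ E) := by
    intro y hy
    obtain ⟨c, hc⟩ := isConj_iff.mp ((hY y).mp hy)
    rw [← hc, map_mul, map_mul, hscal]
    rw [mul_smul_comm, mul_one, smul_mul_assoc, ← map_mul, mul_inv_cancel, map_one]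
  have hDtriv : D ≤ ρ.ker := by
    rw [hD, Subgroup.closure_le]
    rintro z ⟨y, hy, y', hy', rfl⟩
    have h1 : ρ (y * y'⁻¹) * ρ y' = ρ y := by rw [← map_mul]; simp
    rw [hall' y hy, hall' y' hy'] at h1
    simp only [mul_smul_comm, mul_one] at h1
    exact smul_right_injective _ hα0 h1
  have : Subsingleton E := ⟨fun a b => by
    rw [hfix a (fun d hd => by rw [MonoidHom.mem_ker.mp (hDtriv hd)]; rfl),
      hfix b (fun d hd => by rw [MonoidHom.mem_ker.mp (hDtriv hd)]; rfl)]⟩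
  exact hdne (finrank_zero_of_subsingleton)

/-- restricting a representation to an invariant subspace -/
def subRep {T : Type*} [Monoid T] {E : Type*} [AddCommGroup E] [Module ℂ E]
    (ρ : T →* End ℂ E) (W : Submodule ℂ E) (hW : ∀ t, ∀ w ∈ W, ρ t w ∈ W) : T →* End ℂ W where
  toFun t := (ρ t).restrict (hW t)
  map_one' := by ext; simp
  map_mul' a b := by ext; simp

theorem lemL {T : Type*} [Group T] [Finite T] {E : Type*} [AddCommGroup E] [Module ℂ E]
    [FiniteDimensional ℂ E] (ρ : T →* End ℂ E) (x : T) (Y : Finset T)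
    (hY : ∀ y, y ∈ Y ↔ IsConj x y) (u k : ℕ) (hu : u.Prime) (hcard : Y.card = u ^ k)
    (D : Subgroup T) (hD : D = Subgroup.closure {z | ∃ y ∈ Y, ∃ y' ∈ Y, z = y * y'⁻¹})
    (hfix : ∀ v, (∀ d ∈ D, ρ d v = v) → v = 0) (ω : ℂ) (hω : ω ≠ 0) (hint : IsIntegral ℤ ω) :
    u ∣ (∑ y ∈ Y, ρ y).charpoly.rootMultiplicity ω := by
  classical
  rw [← LinearMap.finrank_maxGenEigenspace_eq]
  set K := ∑ y ∈ Y, ρ y with hK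
  set W := End.maxGenEigenspace K ω with hWdef
  have hcomm : ∀ t, Commute K (ρ t) := by
    intro t
    show K * ρ t = ρ t * K
    rw [hK, Finset.sum_mul, Finset.mul_sum]
    refine Finset.sum_bij' (fun y _ => t⁻¹ * y * t) (fun y _ => t * y * t⁻¹) ?_ ?_ ?_ ?_ ?_
    · intro y hy
      rw [hY] at hy ⊢
      exact hy.trans (isConj_iff.mpr ⟨t⁻¹, by group⟩)
    · intro y hy
      rw [hY] at hy ⊢
      exact hy.trans (isConj_iff.mpr ⟨t, by group⟩)
    · intro y hy; group
    · intro y hy; group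
    · intro y hy
      rw [← map_mul, ← map_mul]; congr 1; group
  have hW : ∀ t, ∀ w ∈ W, ρ t w ∈ W := fun t => End.mapsTo_maxGenEigenspace_of_comm (hcomm t) ω
  refine lemL0 (subRep ρ W hW) x Y hY u k hu hcard D hD ?_ ω hω hint ?_
  · intro v hv
    have := hfix v.1 (fun d hd => congrArg Subtype.val (hv d hd))
    exact Subtype.ext this
  · have h1 := End.isNilpotent_restrict_maxGenEigenspace_sub_algebraMap K ω
    convert h1 using 1
    ext w
    simp [subRep, hK, LinearMap.sum_apply, Algebra.algebraMap_eq_smul_one]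
end

section
open Polynomial Module

theorem charpoly_isCompl {E : Type*} [AddCommGroup E] [Module ℂ E] [FiniteDimensional ℂ E]
    (f : End ℂ E) (F W : Submodule ℂ E) (h : IsCompl F W) (hF : ∀ v ∈ F, f v ∈ F) (hW : ∀ v ∈ W, f v ∈ W) :
    f.charpoly = (f.restrict hF).charpoly * (f.restrict hW).charpoly := by
  let e := Submodule.prodEquivOfIsCompl F W h
  rw [← LinearMap.charpoly_prodMap, ← e.charpoly_conj]
  congr 1
  ext v
  obtain ⟨⟨a, b⟩, rfl⟩ := e.surjective v
  simp [e, LinearEquiv.conj_apply]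

/-- the invariants of `D` -/
def invD {T : Type*} [Group T] {E : Type*} [AddCommGroup E] [Module ℂ E] (ρ : T →* End ℂ E) (D : Subgroup T) :
    Submodule ℂ E where
  carrier := {v | ∀ d ∈ D, ρ d v = v}
  add_mem' ha hb d hd := by rw [map_add, ha d hd, hb d hd]
  zero_mem' d hd := map_zero _
  smul_mem' c v hv d hd := by rw [map_smul, hv d hd]

theorem lemA {T : Type*} [Group T] [Finite T] {E : Type*} [AddCommGroup E] [Module ℂ E]
    [FiniteDimensional ℂ E] (ρ : T →* End ℂ E) (x : T) (Y : Finset T)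
    (hY : ∀ y, y ∈ Y ↔ IsConj x y) (u k : ℕ) (hu : u.Prime) (hcard : Y.card = u ^ k)
    (D : Subgroup T) (hD : D = Subgroup.closure {z | ∃ y ∈ Y, ∃ y' ∈ Y, z = y * y'⁻¹})
    (hfix : ∀ v, (∀ d ∈ D, ρ d v = v) → v = 0)
    (hint : ∀ ω ∈ (∑ y ∈ Y, ρ y).charpoly.roots, IsIntegral ℤ ω)
    (Q : ℂ → Prop) [DecidablePred Q] (hQ0 : ¬ Q 0) :
    u ∣ ((∑ y ∈ Y, ρ y).charpoly.roots.filter Q).card := by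
  classical
  rw [← Multiset.toFinset_sum_count_eq]
  apply Finset.dvd_sum
  intro ω hω
  rw [Multiset.mem_toFinset, Multiset.mem_filter] at hω
  rw [Multiset.count_filter, if_pos hω.2, count_roots]
  exact lemL ρ x Y hY u k hu hcard D hD hfix ω (fun h => hQ0 (h ▸ hω.2)) (hint ω hω.1)

theorem lemB {T : Type*} [Group T] [Finite T] {E : Type*} [AddCommGroup E] [Module ℂ E]
    [FiniteDimensional ℂ E] (ρ : T →* End ℂ E) (x : T) (Y : Finset T)
    (hY : ∀ y, y ∈ Y ↔ IsConj x y) (u k : ℕ) (hu : u.Prime) (hcard : Y.card = u ^ k)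
    (D : Subgroup T) [D.Normal] (hD : D = Subgroup.closure {z | ∃ y ∈ Y, ∃ y' ∈ Y, z = y * y'⁻¹})
    (hint : ∀ ω ∈ (∑ y ∈ Y, ρ y).charpoly.roots, IsIntegral ℤ ω)
    (Q : ℂ → Prop) [DecidablePred Q] (hQ0 : ¬ Q 0) (hQ : ∀ z : ℂ, z ^ orderOf x = 1 → Q ((u : ℂ) ^ k * z)) :
    ∃ m, ((∑ y ∈ Y, ρ y).charpoly.roots.filter Q).card = u * m + finrank ℂ (invD ρ D) := by
  classical
  have := Fintype.ofFinite D
  set K := ∑ y ∈ Y, ρ y with hK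
  let S : End ℂ E := ∑ d : D, ρ d
  have hSc : ∀ t, S * ρ t = ρ t * S := by
    intro t
    simp only [S]
    rw [Finset.sum_mul, Finset.mul_sum]
    let e : D ≃ D := (MulAut.conjNormal (H := D) t⁻¹).toEquiv
    refine Fintype.sum_equiv e _ _ ?_
    intro d
    rw [← map_mul, ← map_mul]; congr 1
    simp [e, MulAut.conjNormal_apply]
    group
  have hSD : ∀ d ∈ D, ρ d * S = S := by
    intro d hd
    simp only [S]
    rw [Finset.mul_sum]
    refine Fintype.sum_equiv (Equiv.mulLeft ⟨d, hd⟩) _ _ ?_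
    intro d'
    rw [← map_mul]; rfl
  have hSF : ∀ v ∈ invD ρ D, S v = (Fintype.card D : ℂ) • v := by
    intro v hv
    simp only [S, LinearMap.sum_apply]
    rw [Finset.sum_congr rfl (fun d _ => hv d.1 d.2)]
    simp [← Nat.cast_smul_eq_nsmul ℂ]
  have hD0 : (Fintype.card D : ℂ) ≠ 0 := by exact_mod_cast Fintype.card_ne_zero
  have hcompl : IsCompl (invD ρ D) (LinearMap.ker S) := by
    rw [isCompl_iff, Submodule.disjoint_def, codisjoint_iff]
    constructor
    · intro v hv hv'
      have := hSF v hv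
      rw [LinearMap.mem_ker.mp hv'] at this
      exact (smul_eq_zero.mp this.symm).resolve_left hD0
    · rw [eq_top_iff]
      intro v _
      rw [Submodule.mem_sup]
      have hmem : S v ∈ invD ρ D := fun d hd => by
        rw [← Module.End.mul_apply, hSD d hd]
      refine ⟨(Fintype.card D : ℂ)⁻¹ • S v, Submodule.smul_mem _ _ hmem, v - (Fintype.card D : ℂ)⁻¹ • S v, ?_, by simp⟩
      rw [LinearMap.mem_ker, map_sub, map_smul, hSF _ hmem, smul_smul, inv_mul_cancel₀ hD0, one_smul, sub_self]
  have hFinv : ∀ t, ∀ v ∈ invD ρ D, ρ t v ∈ invD ρ D := by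
    intro t v hv d hd
    have h1 := hv (t⁻¹ * d * t) (by simpa using Subgroup.Normal.conj_mem ‹D.Normal› d hd t⁻¹)
    have h2 : ρ d (ρ t v) = ρ t (ρ (t⁻¹ * d * t) v) := by
      simp only [← Module.End.mul_apply, ← map_mul]; congr 2; group
    rw [h2, h1]
  have hWinv : ∀ t, ∀ v ∈ LinearMap.ker S, ρ t v ∈ LinearMap.ker S := by
    intro t v hv
    rw [LinearMap.mem_ker, ← Module.End.mul_apply, hSc, Module.End.mul_apply, LinearMap.mem_ker.mp hv, map_zero]
  have hKF : ∀ v ∈ invD ρ D, K v ∈ invD ρ D := by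
    intro v hv
    rw [hK, LinearMap.sum_apply]
    exact Submodule.sum_mem _ (fun y _ => hFinv y v hv)
  have hKW : ∀ v ∈ LinearMap.ker S, K v ∈ LinearMap.ker S := by
    intro v hv
    rw [hK, LinearMap.sum_apply]
    exact Submodule.sum_mem _ (fun y _ => hWinv y v hv)
  have hfac := charpoly_isCompl K _ _ hcompl hKF hKW
  have hKWe : K.restrict hKW = ∑ y ∈ Y, subRep ρ _ hWinv y := by
    ext w; simp [subRep, hK, LinearMap.sum_apply]
  have hroots : K.charpoly.roots = (K.restrict hKF).charpoly.roots + (K.restrict hKW).charpoly.roots := by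
    rw [hfac, roots_mul]
    exact mul_ne_zero (LinearMap.charpoly_monic _).ne_zero (LinearMap.charpoly_monic _).ne_zero
  obtain ⟨m, hm⟩ : u ∣ ((K.restrict hKW).charpoly.roots.filter Q).card := by
    rw [hKWe]
    refine lemA (subRep ρ _ hWinv) x Y hY u k hu hcard D hD ?_ ?_ Q hQ0
    · intro v hv
      have h1 : v.1 ∈ invD ρ D := fun d hd => congrArg Subtype.val (hv d hd)
      exact Subtype.ext (Submodule.disjoint_def.mp hcompl.disjoint v.1 h1 v.2)
    · intro ω hω
      apply hint
      rw [hroots, hKWe]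
      exact Multiset.mem_add.mpr (Or.inr hω)
  refine ⟨m, ?_⟩
  rw [hroots, Multiset.filter_add, Multiset.card_add, hm, add_comm]
  congr 1
  have hxx : K.restrict hKF = ((u : ℂ) ^ k) • (subRep ρ _ hFinv x) := by
    ext v
    simp only [LinearMap.coe_restrict_apply, hK, LinearMap.sum_apply]
    have : ∀ y ∈ Y, ρ y v = ρ x v := by
      intro y hy
      have hd : y * x⁻¹ ∈ D := by
        rw [hD]; exact Subgroup.subset_closure ⟨y, hy, x, (hY x).mpr (IsConj.refl x), rfl⟩
      have := hFinv x v.1 v.2 _ hd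
      rw [← Module.End.mul_apply, ← map_mul] at this
      simpa using this
    rw [Finset.sum_congr rfl this]
    simp [hcard, subRep, ← Nat.cast_smul_eq_nsmul ℂ]
  have hall : (K.restrict hKF).charpoly.roots.filter Q = (K.restrict hKF).charpoly.roots := by
    rw [Multiset.filter_eq_self]
    intro ω hω
    have h1 : End.HasEigenvalue (K.restrict hKF) ω := by
      rw [End.hasEigenvalue_iff_isRoot_charpoly]
      exact (mem_roots (LinearMap.charpoly_monic _).ne_zero).mp hω
    obtain ⟨v, hv⟩ := h1.exists_hasEigenvector
    have h2 := hv.apply_eq_smul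
    have hu0 : (u : ℂ) ^ k ≠ 0 := by
      have := hu.ne_zero
      positivity
    have h3 : (subRep ρ _ hFinv x) v = (ω / (u : ℂ) ^ k) • v := by
      rw [hxx, LinearMap.smul_apply] at h2
      rw [div_eq_inv_mul, mul_smul, ← h2, smul_smul, inv_mul_cancel₀ hu0, one_smul]
    have h4 : (subRep ρ _ hFinv x).HasEigenvector (ω / (u : ℂ) ^ k) v := ⟨by simpa [End.mem_eigenspace_iff] using h3, hv.2⟩
    have h5 : (ω / (u : ℂ) ^ k) ^ orderOf x = 1 := by
      apply charpoly_root_pow (subRep ρ _ hFinv x) _ (by rw [← map_pow, pow_orderOf_eq_one, map_one])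
      rw [mem_roots (LinearMap.charpoly_monic _).ne_zero, ← End.hasEigenvalue_iff_isRoot_charpoly]
      exact End.hasEigenvalue_of_hasEigenvector h4
    have := hQ _ h5
    rwa [mul_div_cancel₀ _ hu0] at this
  rw [hall, ← (IsAlgClosed.splits _).natDegree_eq_card_roots, LinearMap.charpoly_natDegree]
end

section
open Polynomial Module

section mono
variable {T : Type*} [Group T] (P : Subgroup T)

theorem mono_mem (t : T) (a : T ⧸ P) :
    (Quotient.out (t⁻¹ • a))⁻¹ * (t⁻¹ * Quotient.out a) ∈ P := by
  rw [← QuotientGroup.eq]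
  have h2 : ((t⁻¹ * Quotient.out a : T) : T ⧸ P) = t⁻¹ • a := by
    conv_rhs => rw [← QuotientGroup.out_eq' a]
    rfl
  rw [h2]
  exact QuotientGroup.out_eq' _

/-- cocycle -/
noncomputable def monoC (t : T) (a : T ⧸ P) : P := ⟨_, mono_mem P t a⟩

theorem monoC_one (a : T ⧸ P) : monoC P 1 a = 1 := by
  apply Subtype.ext
  simp [monoC]

theorem monoC_mul (s t : T) (a : T ⧸ P) : monoC P (t * s) a = monoC P s (t⁻¹ • a) * monoC P t a := by
  apply Subtype.ext
  simp [monoC, mul_smul, mul_assoc]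

variable {P}
open Classical in
/-- monomial matrix -/
noncomputable def monoM {R : Type*} [CommRing R] (χ : P →* R) (t : T) : Matrix (T ⧸ P) (T ⧸ P) R :=
  fun a b => if t⁻¹ • a = b then χ (monoC P t a) else 0

theorem monoM_map {R S : Type*} [CommRing R] [CommRing S] (f : R →+* S) (χ : P →* R) (t : T) :
    (monoM χ t).map f = monoM ((f : R →* S).comp χ) t := by
  ext a b
  simp only [monoM, Matrix.map_apply]
  split_ifs <;> simp

theorem monoM_mulVec [Fintype (T ⧸ P)] {R : Type*} [CommRing R] (χ : P →* R) (t : T) (f : T ⧸ P → R) (a : T ⧸ P) :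
    (monoM χ t).mulVec f a = χ (monoC P t a) * f (t⁻¹ • a) := by
  simp [monoM, Matrix.mulVec, dotProduct]

/-- monomial representation -/
noncomputable def monoRep [Fintype (T ⧸ P)] [DecidableEq (T ⧸ P)] (χ : P →* ℂ) : T →* End ℂ (T ⧸ P → ℂ) where
  toFun t := Matrix.toLin' (monoM χ t)
  map_one' := by
    apply LinearMap.ext; intro f
    rw [Matrix.toLin'_apply]
    funext a
    rw [monoM_mulVec, monoC_one]; simp
  map_mul' t s := by
    apply LinearMap.ext; intro f
    rw [Module.End.mul_apply, Matrix.toLin'_apply, Matrix.toLin'_apply, Matrix.toLin'_apply]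
    funext a
    rw [monoM_mulVec, monoM_mulVec, monoM_mulVec, monoC_mul, map_mul, mul_inv_rev, mul_smul]
    ring

theorem monoRep_apply [Fintype (T ⧸ P)] [DecidableEq (T ⧸ P)] (χ : P →* ℂ) (t : T) (f : T ⧸ P → ℂ) (a : T ⧸ P) :
    monoRep χ t f a = χ (monoC P t a) * f (t⁻¹ • a) := by
  rw [← monoM_mulVec]; rfl

theorem invD_mono_bot [Fintype (T ⧸ P)] [DecidableEq (T ⧸ P)] (χ : P →* ℂ) (D : Subgroup T) [D.Normal] (g : P) (hg : g.1 ∈ D)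
    (hχ : χ g ≠ 1) : finrank ℂ (invD (monoRep χ) D) = 0 := by
  have : invD (monoRep χ) D = ⊥ := by
    rw [eq_bot_iff]
    intro f hf
    rw [Submodule.mem_bot]
    funext a
    let r : T := Quotient.out a
    have hr : ((r : T) : T ⧸ P) = a := QuotientGroup.out_eq' a
    have h1 := congrFun (hf (r * g.1⁻¹ * r⁻¹) (Subgroup.Normal.conj_mem ‹_› _ (inv_mem hg) r)) a
    rw [monoRep_apply] at h1
    have h2 : (r * g.1⁻¹ * r⁻¹)⁻¹ • a = a := by
      conv_lhs => rw [← hr]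
      conv_rhs => rw [← hr]
      show ((((r * g.1⁻¹ * r⁻¹)⁻¹ * r : T)) : T ⧸ P) = _
      rw [QuotientGroup.eq]
      have : ((r * g.1⁻¹ * r⁻¹)⁻¹ * r)⁻¹ * r = g.1⁻¹ := by group
      rw [this]; exact inv_mem g.2
    have h3 : monoC P (r * g.1⁻¹ * r⁻¹) a = g := by
      apply Subtype.ext
      simp only [monoC, h2]
      show r⁻¹ * ((r * g.1⁻¹ * r⁻¹)⁻¹ * r) = g.1
      group
    rw [h2, h3] at h1
    have : (χ g - 1) * f a = 0 := by rw [sub_mul, h1]; ring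
    exact (mul_eq_zero.mp this).resolve_left (sub_ne_zero.mpr hχ)
  rw [this]; simp

theorem invD_mono_one [Finite T] [Fintype (T ⧸ P)] [DecidableEq (T ⧸ P)] (D : Subgroup T) [D.Normal] (hPD : P ≤ D) :
    finrank ℂ (invD (monoRep (1 : P →* ℂ)) D) = Nat.card (T ⧸ D) := by
  have := Fintype.ofFinite (T ⧸ D)
  let π : T ⧸ P → T ⧸ D := Quotient.map' id (fun a b h => by
    rw [QuotientGroup.leftRel_apply] at h ⊢; exact hPD h)
  have hπ : ∀ t : T, π (t : T ⧸ P) = (t : T ⧸ D) := fun t => rfl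
  have hπs : Function.Surjective π := by
    intro b
    obtain ⟨t, rfl⟩ := QuotientGroup.mk_surjective b
    exact ⟨t, hπ t⟩
  let F : (T ⧸ D → ℂ) →ₗ[ℂ] (T ⧸ P → ℂ) := LinearMap.funLeft ℂ ℂ π
  have hFi : Function.Injective F := LinearMap.funLeft_injective_of_surjective ℂ ℂ π hπs
  have hr : LinearMap.range F = invD (monoRep (1 : P →* ℂ)) D := by
    ext f
    constructor
    · rintro ⟨h, rfl⟩ d hd
      funext a
      obtain ⟨t, rfl⟩ := QuotientGroup.mk_surjective a
      rw [monoRep_apply]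
      simp only [MonoidHom.one_apply, one_mul]
      show h (π ((d⁻¹ * t : T) : T ⧸ P)) = h (π (t : T ⧸ P))
      rw [hπ, hπ]
      congr 1
      rw [QuotientGroup.eq]
      have := Subgroup.Normal.conj_mem ‹D.Normal› d hd t⁻¹
      convert this using 1; group
    · intro hf
      refine ⟨fun b => f ((Quotient.out b : T) : T ⧸ P), ?_⟩
      funext a
      obtain ⟨t, rfl⟩ := QuotientGroup.mk_surjective a
      show f (((Quotient.out (t : T ⧸ D)) : T) : T ⧸ P) = f (t : T ⧸ P)
      set r : T := Quotient.out (t : T ⧸ D)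
      have h1 : ((r : T) : T ⧸ D) = (t : T ⧸ D) := QuotientGroup.out_eq' _
      rw [QuotientGroup.eq] at h1
      have hd : r * t⁻¹ ∈ D := by
        have := Subgroup.Normal.conj_mem ‹D.Normal› _ (inv_mem h1) t
        convert this using 1; group
      have h2 := congrFun (hf _ hd) (r : T ⧸ P)
      rw [monoRep_apply] at h2
      simp only [MonoidHom.one_apply, one_mul] at h2
      rw [← h2]
      congr 1
      show (((r * t⁻¹)⁻¹ * r : T) : T ⧸ P) = _
      congr 1; group
  rw [← hr, LinearMap.finrank_range_of_inj hFi]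
  simp
end mono
end

section
open Polynomial Module

local notation "OO" => integralClosure ℤ ℂ

theorem split_O (p : (OO)[X]) (hp : p.Monic) : ∃ S : Multiset (OO), p = (S.map (fun r => X - C r)).prod := by
  set pC := p.map (algebraMap (OO) ℂ) with hpC
  have hm : pC.Monic := hp.map _
  have hint : ∀ r ∈ pC.roots, r ∈ OO := by
    intro r hr
    have : IsIntegral (OO) r := ⟨p, hp, by
      have := (mem_roots hm.ne_zero).mp hr
      rwa [IsRoot.def, hpC, eval_map] at this⟩
    exact isIntegral_trans (R := ℤ) (A := OO) r this
  have cl : CanLift ℂ (OO) (algebraMap (OO) ℂ) (fun z => z ∈ OO) := ⟨fun z hz => ⟨⟨z, hz⟩, rfl⟩⟩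
  obtain ⟨S, hS⟩ := (Multiset.canLift (algebraMap (OO) ℂ) (fun z => z ∈ OO)).prf pC.roots hint
  refine ⟨S, ?_⟩
  apply Polynomial.map_injective (algebraMap (OO) ℂ) (Subtype.val_injective)
  rw [← hpC, (IsAlgClosed.splits pC).eq_prod_roots_of_monic hm, ← hS, Polynomial.map_multiset_prod]
  simp [Multiset.map_map, Function.comp_def]

open Classical in
theorem count_eq (m : Ideal (OO)) [m.IsMaximal] (p p' : (OO)[X]) (hp : p.Monic) (hp' : p'.Monic)
    (h : p.map (Ideal.Quotient.mk m) = p'.map (Ideal.Quotient.mk m)) :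
    ((p.map (algebraMap (OO) ℂ)).roots.filter (fun r => ¬ ∃ a ∈ m, (a : ℂ) = r)).card =
    ((p'.map (algebraMap (OO) ℂ)).roots.filter (fun r => ¬ ∃ a ∈ m, (a : ℂ) = r)).card := by
  have key : ∀ q : (OO)[X], q.Monic →
      ((q.map (algebraMap (OO) ℂ)).roots.filter (fun r => ¬ ∃ a ∈ m, (a : ℂ) = r)).card =
      ((q.map (Ideal.Quotient.mk m)).roots.filter (fun r => r ≠ 0)).card := by
    intro q hq
    obtain ⟨S, rfl⟩ := split_O q hq
    rw [Polynomial.map_multiset_prod, Polynomial.map_multiset_prod]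
    have e1 : (Multiset.map (Polynomial.map (algebraMap (OO) ℂ)) (Multiset.map (fun r => X - C r) S)) =
      Multiset.map (fun r => X - C r) (S.map (algebraMap (OO) ℂ)) := by
      simp [Multiset.map_map, Function.comp_def]
    have e2 : (Multiset.map (Polynomial.map (Ideal.Quotient.mk m)) (Multiset.map (fun r => X - C r) S)) =
      Multiset.map (fun r => X - C r) (S.map (Ideal.Quotient.mk m)) := by
      simp [Multiset.map_map, Function.comp_def]
    have : IsDomain ((OO) ⧸ m) := Ideal.Quotient.isDomain m
    rw [e1, e2, roots_multiset_prod_X_sub_C, roots_multiset_prod_X_sub_C, ← Multiset.countP_eq_card_filter,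
      ← Multiset.countP_eq_card_filter, Multiset.countP_map, Multiset.countP_map]
    congr 1
    apply Multiset.filter_congr
    intro a _
    rw [Ne, Ideal.Quotient.eq_zero_iff_mem]
    apply not_congr
    constructor
    · rintro ⟨b, hb, hab⟩
      have : b = a := Subtype.ext hab
      rwa [← this]
    · intro ha; exact ⟨a, ha, rfl⟩
  rw [key p hp, key p' hp', h]

theorem exists_max (s : ℕ) (hs : s.Prime) : ∃ m : Ideal (OO), m.IsMaximal ∧ (s : OO) ∈ m := by
  have : ¬ IsUnit (s : OO) := by
    intro h
    obtain ⟨b, hb⟩ := h.exists_right_inv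
    have h1 : (s : ℂ) * (b : ℂ) = 1 := by exact_mod_cast congrArg Subtype.val hb
    have h2 : IsIntegral ℤ (algebraMap ℚ ℂ (1 / s)) := by
      have : (algebraMap ℚ ℂ (1 / s)) = b := by
        have hs0 : (s : ℂ) ≠ 0 := by exact_mod_cast hs.ne_zero
        simp; field_simp; exact h1.symm
      rw [this]; exact b.2
    rw [isIntegral_algebraMap_iff (algebraMap ℚ ℂ).injective] at h2
    obtain ⟨z, hz⟩ := IsIntegrallyClosed.isIntegral_iff.mp h2
    have hs0 : (s : ℚ) ≠ 0 := by exact_mod_cast hs.ne_zero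
    simp at hz
    have h3 : (z : ℚ) * s = 1 := by rw [hz]; field_simp
    have h4 : z * s = 1 := by exact_mod_cast h3
    have h5 := Int.isUnit_iff.mp (IsUnit.of_mul_eq_one_right _ h4)
    have := hs.two_le
    omega
  obtain ⟨m, hm, h⟩ := Ideal.exists_le_maximal (Ideal.span {(s : OO)}) (by
    rwa [Ne, Ideal.span_singleton_eq_top])
  exact ⟨m, hm, h (Ideal.mem_span_singleton_self _)⟩

theorem D_not_dvd {T : Type*} [Group T] [Finite T] (x : T) (Y : Finset T)
    (hY : ∀ y, y ∈ Y ↔ IsConj x y) (u k : ℕ) (hu : u.Prime) (hcard : Y.card = u ^ k)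
    (D : Subgroup T) [D.Normal] (hD : D = Subgroup.closure {z | ∃ y ∈ Y, ∃ y' ∈ Y, z = y * y'⁻¹})
    (hTD : ¬ u ∣ Nat.card (T ⧸ D)) (s : ℕ) (hs : s.Prime) (hsu : s ≠ u) : ¬ s ∣ Nat.card D := by
  classical
  intro hsD
  have := Fact.mk hs
  obtain ⟨⟨g, hgD⟩, hg⟩ := exists_prime_orderOf_dvd_card' s hsD
  rw [Subgroup.orderOf_mk] at hg
  let P := Subgroup.zpowers g
  have := Fintype.ofFinite (T ⧸ P)
  have hPD : P ≤ D := by rw [Subgroup.zpowers_le]; exact hgD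
  have hPc : Nat.card P = s := by rw [Nat.card_zpowers, hg]
  let γ : P := ⟨g, Subgroup.mem_zpowers g⟩
  have hγ : γ ≠ 1 := by
    intro h
    have : g = 1 := congrArg Subtype.val h
    rw [this, orderOf_one] at hg
    exact hs.one_lt.ne hg
  obtain ⟨χ0, hχ0⟩ : ∃ χ : P →* ℂˣ, χ γ ≠ 1 := by
    let _ : CommGroup P := { (inferInstance : Group P) with mul_comm := fun a b => Std.Commutative.comm (op := (· * ·)) a b }
    have := Monoid.neZero_exponent_of_finite (G := P)
    exact CommGroup.exists_apply_ne_one_of_hasEnoughRootsOfUnity P ℂ hγ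
  have hpow : ∀ p : P, (χ0 p : ℂ) ^ s = 1 := by
    intro p
    have : p ^ s = 1 := by rw [← hPc]; exact pow_card_eq_one'
    rw [← Units.val_pow_eq_pow_val, ← map_pow, this]; simp
  let χ : P →* OO :=
    { toFun := fun p => ⟨(χ0 p : ℂ), IsIntegral.of_pow hs.pos (by rw [hpow]; exact isIntegral_one)⟩
      map_one' := by apply Subtype.ext; simp
      map_mul' := by intro a b; apply Subtype.ext; simp }
  obtain ⟨m, hm, hsm⟩ := exists_max s hs
  have hum : ∀ a ∈ m, ∀ z : ℂ, z ^ orderOf x = 1 → (a : ℂ) ≠ (u : ℂ) ^ k * z := by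
    intro a ha z hz hc
    have hzO : z ∈ OO := IsIntegral.of_pow (orderOf_pos x) (by rw [hz]; exact isIntegral_one)
    have h1 : (u : OO) ^ k ∈ m := by
      have h2 : (u : OO) ^ k = a * ⟨z, hzO⟩ ^ (orderOf x - 1) := by
        apply Subtype.ext
        push_cast
        rw [hc, mul_assoc, ← pow_succ', Nat.sub_add_cancel (orderOf_pos x), hz, mul_one]
      rw [h2]; exact Ideal.mul_mem_right _ _ ha
    have h3 : (u : OO) ∈ m := hm.isPrime.mem_of_pow_mem k h1
    have hcop : IsCoprime (s : ℤ) (u : ℤ) := Nat.isCoprime_iff_coprime.mpr ((Nat.coprime_primes hs hu).mpr hsu)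
    obtain ⟨a', b', hab⟩ := hcop
    have h4 : (a' : OO) * (s : OO) + (b' : OO) * (u : OO) = 1 := by exact_mod_cast congrArg (Int.cast : ℤ → OO) hab
    exact hm.ne_top ((Ideal.eq_top_iff_one m).mpr (h4 ▸ m.add_mem (Ideal.mul_mem_left _ _ hsm) (Ideal.mul_mem_left _ _ h3)))
  let A : (P →* OO) → Matrix (T ⧸ P) (T ⧸ P) (OO) := fun ψ => ∑ y ∈ Y, monoM ψ y
  let ι : (P →* OO) → (P →* ℂ) := fun ψ => ((algebraMap (OO) ℂ) : OO →* ℂ).comp ψ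
  have hcp : ∀ ψ : P →* OO, (∑ y ∈ Y, monoRep (ι ψ) y).charpoly = (A ψ).charpoly.map (algebraMap (OO) ℂ) := by
    intro ψ
    rw [← Matrix.charpoly_map]
    have h1 : (∑ y ∈ Y, monoRep (ι ψ) y) = Matrix.toLin' ((A ψ).map (algebraMap (OO) ℂ)) := by
      have : (A ψ).map (algebraMap (OO) ℂ) = ∑ y ∈ Y, monoM (ι ψ) y := by
        have := map_sum ((algebraMap (OO) ℂ).mapMatrix (m := T ⧸ P)) (fun y => monoM ψ y) Y
        simp only [RingHom.mapMatrix_apply] at this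
        rw [this]
        exact Finset.sum_congr rfl (fun y _ => monoM_map _ _ _)
      rw [this, map_sum]
      rfl
    rw [h1, Matrix.charpoly_toLin']
  have hmod : (A χ).charpoly.map (Ideal.Quotient.mk m) = (A 1).charpoly.map (Ideal.Quotient.mk m) := by
    rw [← Matrix.charpoly_map, ← Matrix.charpoly_map]
    congr 1
    have key : ((Ideal.Quotient.mk m : OO →+* _) : OO →* (OO) ⧸ m).comp χ = ((Ideal.Quotient.mk m : OO →+* _) : OO →* (OO) ⧸ m).comp 1 := by
      ext p
      let F := Ideal.Quotient.field m
      have hch : CharP ((OO) ⧸ m) s := by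
        have h0 : (s : (OO) ⧸ m) = 0 := by
          have := Ideal.Quotient.eq_zero_iff_mem.mpr hsm
          simpa using this
        exact (CharP.charP_iff_prime_eq_zero hs).mpr h0
      have : (Ideal.Quotient.mk m (χ p) - 1) ^ s = 0 := by
        rw [sub_pow_char, one_pow, ← map_pow]
        have : χ p ^ s = 1 := Subtype.ext (hpow p)
        rw [this]; simp
      have := pow_eq_zero_iff hs.ne_zero |>.mp this
      simpa using sub_eq_zero.mp this
    have e : ∀ ψ, (A ψ).map (Ideal.Quotient.mk m) = ∑ y ∈ Y, monoM (((Ideal.Quotient.mk m : OO →+* _) : OO →* (OO) ⧸ m).comp ψ) y := by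
      intro ψ
      have := map_sum ((Ideal.Quotient.mk m).mapMatrix (m := T ⧸ P)) (fun y => monoM ψ y) Y
      simp only [RingHom.mapMatrix_apply] at this
      rw [this]
      exact Finset.sum_congr rfl (fun y _ => monoM_map _ _ _)
    rw [e, e, key]
  have hc := count_eq m _ _ (Matrix.charpoly_monic (A χ)) (Matrix.charpoly_monic (A 1)) hmod
  rw [← hcp, ← hcp] at hc
  have hint : ∀ ψ, ∀ ω ∈ (∑ y ∈ Y, monoRep (ι ψ) y).charpoly.roots, IsIntegral ℤ ω := by
    intro ψ ω hω
    rw [hcp] at hω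
    have hmon := (Matrix.charpoly_monic (A ψ))
    have : IsIntegral (OO) ω := ⟨_, hmon, by
      have := (mem_roots (hmon.map _).ne_zero).mp hω
      rwa [IsRoot.def, eval_map] at this⟩
    exact isIntegral_trans (R := ℤ) (A := OO) ω this
  have main : ∀ ψ, ∃ n, ((∑ y ∈ Y, monoRep (ι ψ) y).charpoly.roots.filter (fun r => ¬ ∃ a ∈ m, (a : ℂ) = r)).card
      = u * n + finrank ℂ (invD (monoRep (ι ψ)) D) := by
    intro ψ
    refine lemB (monoRep (ι ψ)) x Y hY u k hu hcard D hD (hint ψ) (fun r => ¬ ∃ a ∈ m, (a : ℂ) = r) ?_ ?_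
    · rw [not_not]; exact ⟨0, m.zero_mem, rfl⟩
    · rintro z hz ⟨a, ha, haz⟩
      exact hum a ha z hz haz
  obtain ⟨n1, h1⟩ := main χ
  obtain ⟨n2, h2⟩ := main 1
  rw [hc, h2] at h1
  have e1 : finrank ℂ (invD (monoRep (ι χ)) D) = 0 := by
    apply invD_mono_bot (ι χ) D γ hgD
    intro h
    apply hχ0
    exact Units.ext h
  have e2 : finrank ℂ (invD (monoRep (ι 1)) D) = Nat.card (T ⧸ D) := by
    have : ι 1 = 1 := by ext; simp [ι]
    rw [this]
    exact invD_mono_one D hPD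
  rw [e1, e2, add_zero] at h1
  apply hTD
  exact (Nat.dvd_add_right (Dvd.intro _ rfl)).mp (h1 ▸ Dvd.intro _ rfl)
end

section
open Subgroup

section
variable {G : Type*} [Group G]

/-- conjugation orbit -/
def cl (H : Subgroup G) (x : G) : Set G := {y | ∃ h ∈ H, y = h * x * h⁻¹}

theorem ncard_cl (H : Subgroup G) (x : G) : (cl H x).ncard = (centralizer {x}).relIndex H := by
  let _ : MulAction H G := MulAction.compHom G ((ConjAct.toConjAct (G := G)).toMonoidHom.comp H.subtype)
  have hs : ∀ (h : H) (y : G), h • y = h.1 * y * h.1⁻¹ := fun h y => rfl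
  have h1 : MulAction.stabilizer H x = (centralizer {x}).subgroupOf H := by
    ext h
    rw [MulAction.mem_stabilizer_iff, mem_subgroupOf, mem_centralizer_singleton_iff, hs]
    constructor
    · intro h; rw [mul_inv_eq_iff_eq_mul] at h; exact h.symm ▸ rfl
    · intro h; rw [mul_inv_eq_iff_eq_mul]; exact h.symm ▸ rfl
  have h2 : MulAction.orbit H x = cl H x := by
    ext y
    constructor
    · rintro ⟨h, rfl⟩; exact ⟨h, h.2, rfl⟩
    · rintro ⟨h, hh, rfl⟩; exact ⟨⟨h, hh⟩, rfl⟩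
  rw [relIndex, ← h1, MulAction.index_stabilizer, h2]

theorem mem_cl_top {x y : G} : y ∈ cl ⊤ x ↔ IsConj x y := by
  rw [isConj_iff]
  constructor
  · rintro ⟨h, -, rfl⟩; exact ⟨h, rfl⟩
  · rintro ⟨h, rfl⟩; exact ⟨h, mem_top _, rfl⟩

theorem relIndex_le_index' [Finite G] (H K : Subgroup G) : H.relIndex K ≤ H.index := by
  rw [← relIndex_top_right]
  exact relIndex_le_of_le_right le_top (by rw [relIndex_top_right]; exact index_ne_zero_of_finite)

theorem relIndex_eq_of_coprime [Finite G] (H K : Subgroup G) (h : Nat.Coprime H.index K.index) :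
    H.relIndex K = H.index := by
  have h1 : H.relIndex K * K.index = (H ⊓ K).index := by
    rw [← inf_relIndex_right]; exact relIndex_mul_index inf_le_right
  have h2 : H.index ∣ H.relIndex K * K.index := by rw [h1]; exact index_dvd_of_le inf_le_left
  have h3 := h.dvd_of_dvd_mul_right h2
  refine le_antisymm (relIndex_le_index' H K) (Nat.le_of_dvd ?_ h3)
  exact Nat.pos_of_ne_zero (index_ne_zero_of_finite)

theorem exists_mul_of_relIndex [Finite G] (H K : Subgroup G) (h : H.relIndex K = H.index) (g : G) :
    ∃ k ∈ K, ∃ h ∈ H, g = k * h := by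
  let f : K ⧸ (H.subgroupOf K) → G ⧸ H := Quotient.map' K.subtype (fun a b h => by
    rw [QuotientGroup.leftRel_apply] at h ⊢; exact h)
  have hf : Function.Injective f := by
    intro a b
    obtain ⟨a, rfl⟩ := QuotientGroup.mk_surjective a
    obtain ⟨b, rfl⟩ := QuotientGroup.mk_surjective b
    intro hab
    change ((a.1 : G) : G ⧸ H) = ((b.1 : G) : G ⧸ H) at hab
    rw [QuotientGroup.eq] at hab ⊢
    exact hab
  have hb : Function.Bijective f := (Nat.bijective_iff_injective_and_card f).mpr ⟨hf, h⟩
  obtain ⟨a, ha⟩ := hb.2 (g : G ⧸ H)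
  obtain ⟨a, rfl⟩ := QuotientGroup.mk_surjective a
  change ((a.1 : G) : G ⧸ H) = (g : G ⧸ H) at ha
  rw [QuotientGroup.eq] at ha
  exact ⟨a.1, a.2, _, ha, by group⟩

theorem exists_mul_of_coprime [Finite G] (H K : Subgroup G) (h : Nat.Coprime H.index K.index) (g : G) :
    ∃ k ∈ K, ∃ h ∈ H, g = k * h := exists_mul_of_relIndex H K (relIndex_eq_of_coprime H K h) g

/-- relative index divides index for a normal subgroup -/
theorem relIndex_dvd_of_normal [Finite G] (H N : Subgroup G) [N.Normal] : H.relIndex N ∣ H.index := by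
  have h1 : H.relIndex N * N.index = (H ⊓ N).index := by
    rw [← inf_relIndex_right]; exact relIndex_mul_index inf_le_right
  have h2 : N.relIndex H * H.index = (H ⊓ N).index := by
    rw [inf_comm, ← inf_relIndex_right]; exact relIndex_mul_index inf_le_right
  obtain ⟨c, hc⟩ : N.relIndex H ∣ N.index := relIndex_dvd_index_of_normal N H
  have h0 : 0 < N.relIndex H := Nat.pos_of_ne_zero index_ne_zero_of_finite
  refine ⟨c, ?_⟩
  apply Nat.eq_of_mul_eq_mul_left h0
  rw [h2, ← h1, hc]; ring

/-- class size -/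
noncomputable def idx (g : G) : ℕ := (centralizer {g}).index

theorem idx_eq_ncard (g : G) : idx g = (cl ⊤ g).ncard := by
  rw [ncard_cl, relIndex_top_right]; rfl

theorem centralizer_le_of_mem_zpowers {a g : G} (h : a ∈ zpowers g) : centralizer {g} ≤ centralizer {a} := by
  obtain ⟨k, rfl⟩ := mem_zpowers_iff.mp h
  intro c hc
  rw [mem_centralizer_singleton_iff] at hc ⊢
  have : Commute c g := hc
  exact (this.zpow_right k)

theorem idx_dvd_of_mem_zpowers {a g : G} (h : a ∈ zpowers g) : idx a ∣ idx g :=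
  index_dvd_of_le (centralizer_le_of_mem_zpowers h)

theorem centralizer_conj (g x : G) : centralizer {g * x * g⁻¹} = (centralizer {x}).map (MulAut.conj g).toMonoidHom := by
  ext c
  rw [mem_map_equiv, mem_centralizer_singleton_iff, mem_centralizer_singleton_iff]
  simp only [MulAut.conj_symm_apply]
  constructor
  · intro h
    have : g⁻¹ * (c * (g * x * g⁻¹)) * g = g⁻¹ * (g * x * g⁻¹ * c) * g := by rw [h]
    simpa [mul_assoc] using this
  · intro h
    have : g * (g⁻¹ * c * g * x) * g⁻¹ = g * (x * (g⁻¹ * c * g)) * g⁻¹ := by rw [h]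
    simpa [mul_assoc] using this

theorem idx_conj (g x : G) : idx (g * x * g⁻¹) = idx x := by
  rw [idx, idx, centralizer_conj]
  exact index_map_equiv (centralizer {x}) (MulAut.conj g)

/-- primary decomposition -/
theorem exists_primary [Finite G] (g : G) (p : ℕ) (hp : p.Prime) :
    ∃ a ∈ zpowers g, ∃ b ∈ zpowers g, g = a * b ∧ (∃ i, orderOf a = p ^ i) ∧ ¬ p ∣ orderOf b := by
  have hn : orderOf g ≠ 0 := (orderOf_pos g).ne'
  obtain ⟨i, m, hm, he⟩ := Nat.exists_eq_pow_mul_and_not_dvd hn p hp.ne_one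
  have hc : IsCoprime ((p : ℤ) ^ i) (m : ℤ) := by
    have : Nat.Coprime (p ^ i) m := Nat.Coprime.pow_left _ ((Nat.Prime.coprime_iff_not_dvd hp).mpr hm)
    simpa using Nat.isCoprime_iff_coprime.mpr this
  obtain ⟨r, s, hrs⟩ := hc
  refine ⟨g ^ (s * m), zpow_mem (mem_zpowers g) _, g ^ (r * p ^ i), zpow_mem (mem_zpowers g) _, ?_, ?_, ?_⟩
  · rw [← zpow_add, add_comm, hrs, zpow_one]
  · have : (g ^ (s * (m : ℤ))) ^ (p ^ i) = 1 := by
      rw [← zpow_natCast, ← zpow_mul]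
      have : s * (m : ℤ) * ((p ^ i : ℕ) : ℤ) = (orderOf g : ℤ) * s := by rw [he]; push_cast; ring
      rw [this, zpow_mul, zpow_natCast, pow_orderOf_eq_one, one_zpow]
    obtain ⟨j, -, hj⟩ := (Nat.dvd_prime_pow hp).mp (orderOf_dvd_of_pow_eq_one this)
    exact ⟨j, hj⟩
  · have : (g ^ (r * (p : ℤ) ^ i)) ^ m = 1 := by
      rw [← zpow_natCast, ← zpow_mul]
      have : r * (p : ℤ) ^ i * (m : ℤ) = (orderOf g : ℤ) * r := by rw [he]; push_cast; ring
      rw [this, zpow_mul, zpow_natCast, pow_orderOf_eq_one, one_zpow]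
    intro h
    exact hm (h.trans (orderOf_dvd_of_pow_eq_one this))

theorem mem_of_pow_coprime {H : Subgroup G} {a : G} (n m : ℕ) (h : Nat.Coprime n m) (hn : a ^ n ∈ H) (hm : a ^ m ∈ H) : a ∈ H := by
  obtain ⟨r, s, hrs⟩ := Nat.isCoprime_iff_coprime.mpr h
  have : a = (a ^ n) ^ r * (a ^ m) ^ s := by
    rw [← zpow_natCast, ← zpow_natCast, ← zpow_mul, ← zpow_mul, ← zpow_add]
    have : (n : ℤ) * r + m * s = 1 := by rw [← hrs]; ring
    rw [this, zpow_one]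
  rw [this]
  exact mul_mem (zpow_mem hn _) (zpow_mem hm _)

/-- elements outside R have a primary part outside R -/
theorem exists_primary_not_mem [Finite G] (R : Subgroup G) (g : G) (hg : g ∉ R) :
    ∃ p, p.Prime ∧ ∃ a ∈ zpowers g, a ∉ R ∧ ∃ i, orderOf a = p ^ i := by
  by_contra hcon
  push Not at hcon
  -- minimal k>0 with g^k ∈ R
  have hex : ∃ k, 0 < k ∧ g ^ k ∈ R := ⟨orderOf g, orderOf_pos g, by rw [pow_orderOf_eq_one]; exact one_mem _⟩
  classical
  let k := Nat.find hex
  obtain ⟨hk0, hk⟩ := Nat.find_spec hex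
  have hk1 : k ≠ 1 := by intro h; change 0 < k at hk0; have : g ^ k ∈ R := hk; rw [h, pow_one] at this; exact hg this
  obtain ⟨p, hp, hpk⟩ := Nat.exists_prime_and_dvd hk1
  obtain ⟨m, hm⟩ := hpk
  have hm0 : 0 < m := Nat.pos_of_ne_zero (by rintro rfl; change 0 < k at hk0; omega)
  have hmk : m < k := by rw [hm]; nlinarith [hp.two_le]
  have hgm : g ^ m ∉ R := fun h => Nat.find_min hex hmk ⟨hm0, h⟩
  obtain ⟨a, ha, b, hb, hab, ⟨i, hi⟩, hbo⟩ := exists_primary (g ^ m) p hp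
  have hz : zpowers (g ^ m) ≤ zpowers g := by rw [zpowers_le]; exact pow_mem (mem_zpowers g) _
  by_cases haR : a ∈ R
  · have hbR : b ∉ R := fun h => hgm (hab ▸ mul_mem haR h)
    apply hbR
    refine mem_of_pow_coprime p (orderOf b) ((Nat.Prime.coprime_iff_not_dvd hp).mpr hbo) ?_ (by rw [pow_orderOf_eq_one]; exact one_mem _)
    have hcomm : Commute a b := by
      obtain ⟨r, rfl⟩ := mem_zpowers_iff.mp ha
      obtain ⟨s, rfl⟩ := mem_zpowers_iff.mp hb
      exact Commute.zpow_zpow_self _ _ _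
    have h1 : (g ^ m) ^ p = a ^ p * b ^ p := by conv_lhs => rw [hab]; rw [hcomm.mul_pow]
    have h2 : (g ^ m) ^ p ∈ R := by rw [← pow_mul, mul_comm m p, ← hm]; exact hk
    rw [h1] at h2
    exact (R.mul_mem_cancel_left (pow_mem haR p)).mp h2
  · exact hcon p hp a (hz ha) haR i hi

end
end

section
open Subgroup

section
variable {G : Type*} [Group G]

theorem sup_solvable (N M : Subgroup G) [N.Normal] [hN : Group.IsSolvable N] [hM : Group.IsSolvable M] :
    Group.IsSolvable (M ⊔ N : Subgroup G) := by
  let φ : M →* (↥(M ⊔ N) ⧸ N.subgroupOf (M ⊔ N)) := (QuotientGroup.mk' _).comp (inclusion le_sup_left)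
  have hφ : Function.Surjective φ := by
    intro b
    obtain ⟨⟨t, ht⟩, rfl⟩ := QuotientGroup.mk_surjective b
    obtain ⟨m, hm, n, hn, rfl⟩ := (mem_sup_of_normal_right).mp ht
    refine ⟨⟨m, hm⟩, ?_⟩
    show ((_ : ↥(M ⊔ N)) : ↥(M ⊔ N) ⧸ N.subgroupOf (M ⊔ N)) = _
    rw [QuotientGroup.eq, mem_subgroupOf]
    simpa using hn
  have h1 := Group.isSolvable_of_surjective hφ
  have h2 : Group.IsSolvable (N.subgroupOf (M ⊔ N)) :=
    Group.isSolvable_of_isSolvable_injective (subgroupOfEquivOfLe (le_sup_right : N ≤ M ⊔ N)).injective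
      (f := (subgroupOfEquivOfLe (le_sup_right : N ≤ M ⊔ N)).toMonoidHom)
  exact (Group.isSolvable_iff_subgroup_quotient (N.subgroupOf (M ⊔ N))).mpr ⟨h2, h1⟩

theorem solvable_of_le {H K : Subgroup G} (h : H ≤ K) [Group.IsSolvable K] : Group.IsSolvable H :=
  Group.isSolvable_of_isSolvable_injective (inclusion_injective h)

theorem exists_radical (G : Type*) [Group G] [Finite G] : ∃ R : Subgroup G, R.Normal ∧ Group.IsSolvable R ∧
    ∀ N : Subgroup G, N.Normal → Group.IsSolvable N → N ≤ R := by
  classical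
  have hfin : {N : Subgroup G | N.Normal ∧ Group.IsSolvable N}.Finite := Set.toFinite _
  obtain ⟨R, hR⟩ := hfin.exists_maximal ⟨⊥, inferInstance, inferInstance⟩
  refine ⟨R, hR.1.1, hR.1.2, fun N hN hs => ?_⟩
  have := hR.1.1
  have := hR.1.2
  have h1 : (N ⊔ R).Normal ∧ Group.IsSolvable (N ⊔ R : Subgroup G) := ⟨inferInstance, sup_solvable R N⟩
  exact le_sup_left.trans (hR.2 h1 le_sup_right)

theorem pgroup_solvable [Finite G] {p : ℕ} (hp : p.Prime) (h : IsPGroup p G) : Group.IsSolvable G := by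
  have := Fact.mk hp
  have := h.isNilpotent
  infer_instance

theorem isPGroup_of_dvd [Finite G] {u : ℕ} (h : ∀ s, s.Prime → s ∣ Nat.card G → s = u) : IsPGroup u G :=
  IsPGroup.of_card (n := (Nat.card G).primeFactorsList.length)
    (Nat.eq_prime_pow_of_unique_prime_dvd (Nat.card_pos.ne') (fun hd hdvd => h _ hd hdvd))

theorem kaz_coprime (n : ℕ) : ∀ (G : Type*) [Group G] [Finite G], Nat.card G ≤ n → ∀ (x : G) (u k : ℕ), u.Prime → idx x = u ^ k →
    ¬ u ∣ orderOf x → Group.IsSolvable (normalClosure {x}) := by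
  induction n with
  | zero => intro G _ _ h; have := Nat.card_pos (α := G); omega
  | succ n ih =>
  intro G _ _ hG x u k hu hx ho
  by_cases hL : normalClosure {x} = ⊤
  · -- the whole group
    classical
    rw [hL]
    have := Fintype.ofFinite G
    let Y : Finset G := Finset.univ.filter (fun y => IsConj x y)
    have hY : ∀ y, y ∈ Y ↔ IsConj x y := by simp [Y]
    have hYc : Y.card = u ^ k := by
      rw [← hx, idx_eq_ncard, ← Set.ncard_coe_finset]
      congr 1
      ext y; simp [Y, mem_cl_top]
    let S : Set G := {z | ∃ y ∈ Y, ∃ y' ∈ Y, z = y * y'⁻¹}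
    let D := Subgroup.closure S
    have hxY : x ∈ Y := (hY x).mpr (IsConj.refl x)
    have hDn : D.Normal := by
      have : S = Group.conjugatesOfSet S := by
        apply Set.Subset.antisymm Group.subset_conjugatesOfSet
        intro z hz
        obtain ⟨a, ⟨y, hy, y', hy', rfl⟩, hc⟩ := Group.mem_conjugatesOfSet_iff.mp hz
        obtain ⟨c, rfl⟩ := isConj_iff.mp hc
        refine ⟨c * y * c⁻¹, (hY _).mpr (((hY y).mp hy).trans (isConj_iff.mpr ⟨c, rfl⟩)),
          c * y' * c⁻¹, (hY _).mpr (((hY y').mp hy').trans (isConj_iff.mpr ⟨c, rfl⟩)), by group⟩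
      show (Subgroup.closure S).Normal
      rw [this]
      exact normalClosure_normal
    have hgen : ∀ t : G, (t : G ⧸ D) ∈ zpowers (x : G ⧸ D) := by
      have : (⊤ : Subgroup G) ≤ (zpowers (x : G ⧸ D)).comap (QuotientGroup.mk' D) := by
        rw [← hL, normalClosure, closure_le]
        intro y hy
        obtain ⟨a, ha, hc⟩ := Group.mem_conjugatesOfSet_iff.mp hy
        rw [Set.mem_singleton_iff] at ha
        subst ha
        have : (y : G ⧸ D) = (a : G ⧸ D) := by
          rw [eq_comm, QuotientGroup.eq]
          have h1 : y * a⁻¹ ∈ D := subset_closure ⟨y, (hY y).mpr hc, a, hxY, rfl⟩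
          have := hDn.conj_mem _ h1 a⁻¹
          convert this using 1; group
        show (y : G ⧸ D) ∈ zpowers (a : G ⧸ D)
        rw [this]; exact mem_zpowers _
      intro t
      exact this (mem_top t)
    have hcyc : IsCyclic (G ⧸ D) := ⟨(x : G ⧸ D), fun b => by
      obtain ⟨t, rfl⟩ := QuotientGroup.mk_surjective b; exact hgen t⟩
    have hcard : Nat.card (G ⧸ D) ∣ orderOf x := by
      rw [← orderOf_eq_card_of_forall_mem_zpowers (g := (x : G ⧸ D)) (fun b => by
        obtain ⟨t, rfl⟩ := QuotientGroup.mk_surjective b; exact hgen t)]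
      exact orderOf_map_dvd (QuotientGroup.mk' D) x
    have hp : IsPGroup u D := by
      apply isPGroup_of_dvd
      intro s hs hsd
      by_contra hne
      exact D_not_dvd x Y hY u k hu hYc D rfl (fun h => ho (h.trans hcard)) s hs hne hsd
    have h1 : Group.IsSolvable D := pgroup_solvable hu hp
    have h2 : Group.IsSolvable (G ⧸ D) := by
      let _ := IsCyclic.commGroup (α := G ⧸ D)
      exact Group.isSolvable_of_comm (fun a b => mul_comm a b)
    have h3 : Group.IsSolvable G := (Group.isSolvable_iff_subgroup_quotient D).mpr ⟨h1, h2⟩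
    infer_instance
  · set L := normalClosure {x} with hLd
    have hlt : Nat.card L ≤ n := by
      have h1 := Subgroup.card_le_card_group L
      have h2 : Nat.card L ≠ Nat.card G := fun h => hL (Subgroup.eq_top_of_card_eq L h)
      omega
    obtain ⟨R, hRn, hRs, hR⟩ := exists_radical L
    have key : ∀ y : L, IsConj x y.1 → y ∈ R := by
      intro y hy
      obtain ⟨c, hc⟩ := isConj_iff.mp hy
      have hyi : idx y.1 = u ^ k := by rw [← hc, idx_conj, hx]
      have h1 : idx y ∣ u ^ k := by
        have h2 : centralizer {y} = (centralizer {y.1}).subgroupOf L := by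
          ext z
          rw [mem_subgroupOf, mem_centralizer_singleton_iff, mem_centralizer_singleton_iff]
          exact Subtype.ext_iff
        rw [← hyi, idx, h2]
        exact relIndex_dvd_of_normal _ _
      obtain ⟨j, -, hj⟩ := (Nat.dvd_prime_pow hu).mp h1
      have h3 : orderOf y = orderOf x := by
        rw [← Subgroup.orderOf_coe, ← hc]
        exact orderOf_injective (MulAut.conj c).toMonoidHom (MulAut.conj c).injective x
      have h4 := ih L hlt y u j hu hj (by rw [h3]; exact ho)
      exact hR _ normalClosure_normal h4 (subset_normalClosure rfl)
    have hLR : L ≤ R.map L.subtype := by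
      refine (closure_le (K := R.map L.subtype)).mpr ?_
      intro y hy
      obtain ⟨a, ha, hc⟩ := Group.mem_conjugatesOfSet_iff.mp hy
      rw [Set.mem_singleton_iff] at ha
      subst ha
      have hyL : y ∈ L := conjugatesOfSet_subset_normalClosure hy
      exact ⟨⟨y, hyL⟩, key ⟨y, hyL⟩ hc, rfl⟩
    have : Group.IsSolvable (R.map L.subtype) := by
      exact Group.isSolvable_of_surjective (f := L.subtype.subgroupMap R) (L.subtype.subgroupMap_surjective R)
    exact solvable_of_le hLR

theorem kaz_pelt [Finite G] (x : G) (u k i : ℕ) (hu : u.Prime) (hx : idx x = u ^ k) (ho : orderOf x = u ^ i) :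
    Group.IsSolvable (normalClosure {x}) := by
  have := Fact.mk hu
  have hp : IsPGroup u (zpowers x) := IsPGroup.of_card (n := i) (by rw [Nat.card_zpowers, ho])
  obtain ⟨U, hU⟩ := hp.exists_le_sylow
  have hcop : Nat.Coprime (centralizer {x}).index U.index := by
    have : (centralizer {x}).index = u ^ k := hx
    rw [this]
    exact Nat.Coprime.pow_left _ ((Nat.Prime.coprime_iff_not_dvd hu).mpr U.not_dvd_index)
  have hle : normalClosure {x} ≤ U := by
    rw [normalClosure, closure_le]
    intro y hy
    obtain ⟨a, ha, hc⟩ := Group.mem_conjugatesOfSet_iff.mp hy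
    rw [Set.mem_singleton_iff] at ha
    subst ha
    obtain ⟨g, rfl⟩ := isConj_iff.mp hc
    obtain ⟨k, hk, c, hcc, rfl⟩ := exists_mul_of_coprime _ _ hcop g
    rw [mem_centralizer_singleton_iff] at hcc
    have : k * c * a * (k * c)⁻¹ = k * a * k⁻¹ := by
      rw [mul_assoc k c a, hcc]; group
    rw [this]
    have haU : a ∈ (U : Subgroup G) := hU (mem_zpowers a)
    exact mul_mem (mul_mem hk haU) (inv_mem hk)
  have : Group.IsSolvable (U : Subgroup G) := pgroup_solvable hu U.isPGroup'
  exact solvable_of_le hle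

theorem kazarin [Finite G] (x : G) (u k : ℕ) (hu : u.Prime) (hx : idx x = u ^ k) :
    Group.IsSolvable (normalClosure {x}) := by
  obtain ⟨a, ha, b, hb, hab, ⟨i, hi⟩, hbo⟩ := exists_primary x u hu
  obtain ⟨ja, -, hja⟩ := (Nat.dvd_prime_pow hu).mp (hx ▸ idx_dvd_of_mem_zpowers ha)
  obtain ⟨jb, -, hjb⟩ := (Nat.dvd_prime_pow hu).mp (hx ▸ idx_dvd_of_mem_zpowers hb)
  have h1 := kaz_pelt a u ja i hu hja hi
  have h2 := kaz_coprime _ G le_rfl b u jb hu hjb hbo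
  have := sup_solvable (normalClosure {a}) (normalClosure {b})
  refine solvable_of_le (K := normalClosure {b} ⊔ normalClosure {a}) ?_
  apply normalClosure_le_normal
  rw [Set.singleton_subset_iff, hab]
  exact mul_mem (mem_sup_right (subset_normalClosure rfl)) (mem_sup_left (subset_normalClosure rfl))
end
end

section
open Subgroup

theorem relIndex_mul_card' {Γ : Type*} [Group Γ] (P Q : Subgroup Γ) (h : P ≤ Q) :
    P.relIndex Q * Nat.card P = Nat.card Q := by
  have := relIndex_mul_relIndex ⊥ P Q bot_le h
  rw [relIndex_bot_left, relIndex_bot_left, mul_comm] at this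
  exact this

theorem norm_trick {A : Type*} [CommGroup A] (α β : MulAut A) (hc : Commute α β) (q : ℕ) (hq : q.Prime)
    (hα : α ^ q = 1) (l : ℕ)
    (h1 : ∀ v : A, v ^ l = 1 → ∏ j ∈ Finset.range q, (α ^ j) v = 1)
    (h2 : ∀ i, ∀ v : A, v ^ l = 1 → ∏ j ∈ Finset.range q, ((α ^ i * β) ^ j) v = 1)
    (v : A) (hv : v ^ l = 1) : v ^ q = 1 := by
  have e1 : ∏ i ∈ Finset.range q, ∏ j ∈ Finset.range q, ((α ^ i * β) ^ j) v = 1 :=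
    Finset.prod_eq_one (fun i _ => h2 i v hv)
  rw [Finset.prod_comm, ← Finset.prod_erase_mul _ _ (Finset.mem_range.mpr hq.pos)] at e1
  have e2 : ∏ j ∈ (Finset.range q).erase 0, ∏ i ∈ Finset.range q, ((α ^ i * β) ^ j) v = 1 := by
    apply Finset.prod_eq_one
    intro j hj
    rw [Finset.mem_erase, Finset.mem_range] at hj
    have hw : ((β ^ j) v) ^ l = 1 := by rw [← map_pow, hv, map_one]
    rw [← h1 _ hw]
    have hjq : Nat.Coprime j q := by
      rw [Nat.coprime_comm, Nat.Prime.coprime_iff_not_dvd hq]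
      intro h
      exact absurd (Nat.le_of_dvd (Nat.pos_of_ne_zero hj.1) h) (by omega)
    have hαmod : ∀ n, α ^ n = α ^ (n % q) := by
      intro n
      conv_lhs => rw [← Nat.div_add_mod n q, pow_add, pow_mul, hα, one_pow, one_mul]
    have hmaps : ∀ i ∈ Finset.range q, (i * j) % q ∈ Finset.range q := fun i _ =>
      Finset.mem_range.mpr (Nat.mod_lt _ hq.pos)
    have hinj : ∀ i ∈ Finset.range q, ∀ i' ∈ Finset.range q, (i * j) % q = (i' * j) % q → i = i' := by
      intro i hi i' hi' h
      rw [Finset.mem_range] at hi hi'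
      have := Nat.ModEq.cancel_right_of_coprime (m := q) (by rwa [Nat.coprime_comm, Nat.coprime_iff_gcd_eq_one] at hjq) (h : i * j ≡ i' * j [MOD q])
      unfold Nat.ModEq at this
      rwa [Nat.mod_eq_of_lt hi, Nat.mod_eq_of_lt hi'] at this
    refine Finset.prod_bij (fun i _ => (i * j) % q) hmaps (fun i hi i' hi' h => hinj i hi i' hi' h) ?_ ?_
    · intro b hb
      obtain ⟨a, ha, hab⟩ := Finset.surj_on_of_inj_on_of_card_le (fun i _ => (i * j) % q) hmaps
        (fun i i' hi hi' h => hinj i hi i' hi' h) le_rfl b hb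
      exact ⟨a, ha, hab.symm⟩
    · intro i hi
      rw [← hαmod, (hc.pow_left i).mul_pow, ← pow_mul]; rfl
  rw [e2, one_mul] at e1
  simpa using e1

section
variable {Γ : Type*} [Group Γ] [Finite Γ]

theorem gamma_sylow (X : Γ → Subgroup Γ) (hmem : ∀ g ≠ 1, g ∈ X g) (hpart : ∀ g ≠ 1, ∀ h ∈ X g, h ≠ 1 → X h = X g)
    (hab : ∀ g ≠ 1, ∀ a ∈ X g, ∀ b ∈ X g, a * b = b * a)
    (hconj : ∀ k g, g ≠ 1 → ∀ y ∈ X g, k * y * k⁻¹ ∈ X (k * g * k⁻¹))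
    (q : ℕ) (hq : q.Prime) (hqd : q ∣ Nat.card Γ) (l : ℕ) (hl : l.Prime) (hlq : l ≠ q)
    (hld : ∀ g ≠ 1, l ∣ Nat.card (X g)) (Q : Sylow q Γ) :
    ∃ g ≠ 1, Nat.card Q ≤ q * Nat.card (Q ⊓ X g : Subgroup Γ) := by
  have := Fact.mk hq
  have hQ1 : Nontrivial Q := by
    rw [← Finite.one_lt_card_iff_nontrivial]
    have := Q.dvd_card_of_dvd_card hqd
    exact lt_of_lt_of_le hq.one_lt (Nat.le_of_dvd Nat.card_pos this)
  have hZ := Q.isPGroup'.center_nontrivial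
  obtain ⟨z, hz1⟩ := exists_ne (1 : center Q)
  have hzpos : (z : Q) ≠ 1 := fun h => hz1 (Subtype.ext h)
  -- element of order q in the centre
  obtain ⟨x, hxQ, hxc, hx1, hxq⟩ : ∃ x : Γ, x ∈ Q ∧ (∀ y ∈ Q, y * x = x * y) ∧ x ≠ 1 ∧ x ^ q = 1 := by
    have hpc : IsPGroup q (center Q) := Q.isPGroup'.to_subgroup _
    obtain ⟨n, hn, hcard⟩ := hpc.exists_card_eq.elim (fun n h => (⟨n, by
      rintro rfl; rw [pow_zero] at h
      exact (Finite.one_lt_card_iff_nontrivial.mpr hZ).ne' h, h⟩ : ∃ n, n ≠ 0 ∧ Nat.card (center Q) = q ^ n))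
    have hdvd : q ∣ Nat.card (center Q) := by rw [hcard]; exact dvd_pow_self q hn
    obtain ⟨w, hw⟩ := exists_prime_orderOf_dvd_card' q hdvd
    refine ⟨w.1.1, w.1.2, ?_, ?_, ?_⟩
    · intro y hy
      have := (mem_center_iff.mp w.2) ⟨y, hy⟩
      exact congrArg Subtype.val this
    · intro h
      have : w = 1 := Subtype.ext (Subtype.ext h)
      rw [this, orderOf_one] at hw
      exact hq.one_lt.ne hw
    · have : w ^ q = 1 := orderOf_dvd_iff_pow_eq_one.mp (dvd_of_eq hw)
      exact congrArg (fun t : center Q => t.1.1) this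
  refine ⟨x, hx1, ?_⟩
  have hnorm : ∀ k ∈ Q, ∀ y ∈ X x, k * y * k⁻¹ ∈ X x := by
    intro k hk y hy
    have := hconj k x hx1 y hy
    have e : k * x * k⁻¹ = x := by rw [hxc k hk]; group
    rwa [e] at this
  have hpow : ∀ y ∈ Q, y ∉ X x → y ^ q = 1 := by
    intro y hy hyX
    by_contra hne
    have hcomm : Commute x y := (hxc y hy).symm
    have h1 : (x * y) ^ q = y ^ q := by rw [hcomm.mul_pow, hxq, one_mul]
    have hy1 : y ≠ 1 := by rintro rfl; exact hne (one_pow q)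
    have hxy1 : x * y ≠ 1 := by intro h; rw [h, one_pow] at h1; exact hne h1.symm
    have h2 : X (y ^ q) = X (x * y) := hpart _ hxy1 _ (h1 ▸ pow_mem (hmem _ hxy1) q) hne
    have h3 : X (y ^ q) = X y := hpart _ hy1 _ (pow_mem (hmem _ hy1) q) hne
    have h4 : x * y ∈ X y := by rw [← h3, h2]; exact hmem _ hxy1
    have h5 : x ∈ X y := ((X y).mul_mem_cancel_right (hmem y hy1)).mp h4
    rw [hpart y hy1 x h5 hx1] at hyX
    exact hyX (hmem y hy1)
  by_contra hlt
  push Not at hlt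
  let A := X x
  let _ : CommGroup A := { (inferInstance : Group A) with mul_comm := fun a b => Subtype.ext (hab x hx1 a.1 a.2 b.1 b.2) }
  -- conjugation action
  let cj : Q →* MulAut A :=
    { toFun := fun k =>
        { toFun := fun v => ⟨k.1 * v.1 * k.1⁻¹, hnorm k.1 k.2 v.1 v.2⟩
          invFun := fun v => ⟨k.1⁻¹ * v.1 * k.1, by simpa using hnorm k.1⁻¹ (inv_mem k.2) v.1 v.2⟩
          left_inv := fun v => Subtype.ext (by simp [mul_assoc])
          right_inv := fun v => Subtype.ext (by simp [mul_assoc])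
          map_mul' := fun v w => Subtype.ext (by simp [mul_assoc]) }
      map_one' := by ext v; simp
      map_mul' := fun a b => by ext v; simp [mul_assoc] }
  have hcjA : ∀ k : Q, k.1 ∈ A → cj k = 1 := by
    intro k hk
    ext v
    show k.1 * v.1 * k.1⁻¹ = v.1
    rw [hab x hx1 k.1 hk v.1 v.2]; group
  have hnm : ∀ h : Q, h.1 ∉ A → ∀ v : A, v ^ l = 1 → ∏ j ∈ Finset.range q, ((cj h) ^ j) v = 1 := by
    intro h hh v hv
    by_contra hne
    set w : A := ∏ j ∈ Finset.range q, ((cj h) ^ j) v with hw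
    have hhq : h ^ q = 1 := Subtype.ext (hpow h.1 h.2 hh)
    have hfix : cj h w = w := by
      rw [hw, map_prod]
      have e : ∀ j ∈ Finset.range q, cj h (((cj h) ^ j) v) = ((cj h) ^ (j + 1)) v := by
        intro j _; rw [pow_succ']; rfl
      rw [Finset.prod_congr rfl e]
      have e3 := Finset.prod_range_succ (fun j => ((cj h) ^ j) v) q
      rw [Finset.prod_range_succ'] at e3
      rw [← map_pow (cj) h q, hhq, map_one, pow_zero] at e3
      exact mul_right_cancel e3
    have hcomm : Commute h.1 w.1 := by
      have := congrArg Subtype.val hfix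
      change h.1 * w.1 * h.1⁻¹ = w.1 at this
      rw [mul_inv_eq_iff_eq_mul] at this
      exact this
    have hwl : w ^ l = 1 := by
      rw [hw, ← Finset.prod_pow]
      apply Finset.prod_eq_one
      intro j _
      rw [← map_pow, hv, map_one]
    have hwl' : w.1 ^ l = 1 := congrArg Subtype.val hwl
    have hhq' : h.1 ^ q = 1 := hpow h.1 h.2 hh
    have hw1 : w.1 ≠ 1 := fun h => hne (Subtype.ext h)
    have hh1 : h.1 ≠ 1 := fun h => hh (h ▸ one_mem A)
    have c1 : Nat.Coprime q l := (Nat.coprime_primes hq hl).mpr hlq.symm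
    have hwq : w.1 ^ q ≠ 1 := by
      intro h0
      apply hw1
      rw [← mem_bot]
      exact mem_bot.mpr (by
        have := (Nat.Coprime.eq_one_of_dvd (c1.coprime_dvd_left (orderOf_dvd_of_pow_eq_one h0)) (orderOf_dvd_of_pow_eq_one hwl'))
        exact orderOf_eq_one_iff.mp this)
    have hhl : h.1 ^ l ≠ 1 := by
      intro h0
      have := (Nat.Coprime.eq_one_of_dvd (c1.coprime_dvd_left (orderOf_dvd_of_pow_eq_one hhq')) (orderOf_dvd_of_pow_eq_one h0))
      exact hh1 (orderOf_eq_one_iff.mp this)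
    have p1 : (h.1 * w.1) ^ q = w.1 ^ q := by rw [hcomm.mul_pow, hhq', one_mul]
    have p2 : (h.1 * w.1) ^ l = h.1 ^ l := by rw [hcomm.mul_pow, hwl', mul_one]
    have hhw : h.1 * w.1 ≠ 1 := by intro h0; rw [h0, one_pow] at p1; exact hwq p1.symm
    have x1 : X (w.1 ^ q) = X (h.1 * w.1) := hpart _ hhw _ (p1 ▸ pow_mem (hmem _ hhw) q) hwq
    have x2 : X (h.1 ^ l) = X (h.1 * w.1) := hpart _ hhw _ (p2 ▸ pow_mem (hmem _ hhw) l) hhl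
    have x3 : X (w.1 ^ q) = X x := hpart _ hx1 _ (pow_mem w.2 q) hwq
    have x4 : X (h.1 ^ l) = X h.1 := hpart _ hh1 _ (pow_mem (hmem _ hh1) l) hhl
    apply hh
    show h.1 ∈ X x
    rw [← x3, x1, ← x2, x4]
    exact hmem _ hh1
  -- the choice of a and b
  let Y : Subgroup Q := A.subgroupOf Q
  have hYn : Y.Normal := ⟨fun y hy k => hnorm k.1 k.2 y.1 hy⟩
  have hYc : Nat.card Y = Nat.card (Q ⊓ X x : Subgroup Γ) := by
    have e : Y.map (Q : Subgroup Γ).subtype = (Q ⊓ X x : Subgroup Γ) := by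
      rw [subgroupOf_map_subtype, inf_comm]
    rw [← e]
    exact Nat.card_congr (Y.equivMapOfInjective _ (subtype_injective _)).toEquiv
  rw [← hYc] at hlt
  have hQY : Nontrivial (Q ⧸ Y) := by
    rw [QuotientGroup.nontrivial_iff]
    intro h
    rw [h, card_top] at hlt
    have := Nat.card_pos (α := Q)
    change q * Nat.card Q < Nat.card Q at hlt
    nlinarith [hq.two_le]
  have hZ2 := (Q.isPGroup'.to_quotient Y).center_nontrivial
  obtain ⟨c, hc1⟩ := exists_ne (1 : center (Q ⧸ Y))
  obtain ⟨a, ha⟩ := QuotientGroup.mk_surjective c.1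
  have haY : a ∉ Y := by
    intro h
    apply hc1
    apply Subtype.ext
    rw [← ha]
    exact (QuotientGroup.eq_one_iff a).mpr h
  have hac : ∀ b : Q, cj a * cj b = cj b * cj a := by
    intro b
    have h1 := (mem_center_iff.mp c.2) (b : Q ⧸ Y)
    rw [← ha] at h1
    have h2 : ((b * a : Q) : Q ⧸ Y) = ((a * b : Q) : Q ⧸ Y) := h1
    rw [QuotientGroup.eq] at h2
    have h3 := hcjA ((b * a)⁻¹ * (a * b)) h2
    rw [map_mul, map_inv, inv_mul_eq_one, map_mul, map_mul] at h3
    exact h3.symm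
  have haq : a ^ q = 1 := Subtype.ext (hpow a.1 a.2 haY)
  obtain ⟨b, hb⟩ : ∃ b : Q, b ∉ (zpowers a ⊔ Y : Subgroup Q) := by
    by_contra hcon
    push Not at hcon
    have ht : (zpowers a ⊔ Y : Subgroup Q) = ⊤ := eq_top_iff.mpr (fun b _ => hcon b)
    have h1 : Nat.card (zpowers a ⊔ Y : Subgroup Q) ∣ Nat.card (zpowers a) * Nat.card Y := by
      have h2 := relIndex_mul_card' Y (zpowers a ⊔ Y) le_sup_right
      rw [relIndex_sup_right] at h2
      rw [← h2]
      exact Nat.mul_dvd_mul (relIndex_dvd_card _ _) dvd_rfl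
    rw [ht, card_top, Nat.card_zpowers] at h1
    have h3 : orderOf a ≤ q := Nat.le_of_dvd hq.pos (orderOf_dvd_of_pow_eq_one haq)
    have h4 := Nat.le_of_dvd (Nat.mul_pos (orderOf_pos a) Nat.card_pos) h1
    have h5 : orderOf a * Nat.card Y ≤ q * Nat.card Y := Nat.mul_le_mul_right _ h3
    have : Nat.card Q ≤ q * Nat.card Y := h4.trans h5
    omega
  have hlA := hld x hx1
  have := Fact.mk hl
  obtain ⟨v, hv⟩ := exists_prime_orderOf_dvd_card' l hlA
  have hvl : v ^ l = 1 := by rw [← hv]; exact pow_orderOf_eq_one v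
  have hfin := norm_trick (cj a) (cj b) (hac b) q hq (by rw [← map_pow, haq, map_one]) l
    (fun v hv => hnm a haY v hv) (fun i v hv => by
      have : cj a ^ i * cj b = cj (a ^ i * b) := by rw [map_mul, map_pow]
      rw [this]
      refine hnm _ ?_ v hv
      intro h
      apply hb
      have h1 : a ^ i * b ∈ (zpowers a ⊔ Y : Subgroup Q) := mem_sup_right (show a ^ i * b ∈ Y from h)
      exact (Subgroup.mul_mem_cancel_left _ (mem_sup_left (pow_mem (mem_zpowers a) i))).mp h1) v hvl
  have h1 := orderOf_dvd_of_pow_eq_one hfin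
  rw [hv] at h1
  exact hlq ((Nat.prime_dvd_prime_iff_eq hl hq).mp h1)

theorem gamma_lemma (X : Γ → Subgroup Γ) (hmem : ∀ g ≠ 1, g ∈ X g) (hpart : ∀ g ≠ 1, ∀ h ∈ X g, h ≠ 1 → X h = X g)
    (hab : ∀ g ≠ 1, ∀ a ∈ X g, ∀ b ∈ X g, a * b = b * a)
    (hconj : ∀ k g, g ≠ 1 → ∀ y ∈ X g, k * y * k⁻¹ ∈ X (k * g * k⁻¹))
    (hcard : ∀ g ≠ 1, ∀ h ≠ 1, Nat.card (X g) = Nat.card (X h))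
    (hdvd : ∀ q, q.Prime → q ∣ Nat.card Γ → ∀ g ≠ 1, q ∣ Nat.card (X g))
    (h2 : ∀ q, q.Prime → ∃ l, l.Prime ∧ l ≠ q ∧ l ∣ Nat.card Γ) (g : Γ) (hg : g ≠ 1) : (X g).Normal := by
  rw [← normalizer_eq_top_iff, ← index_eq_one]
  by_contra hne
  obtain ⟨q, hq, hqi⟩ := Nat.exists_prime_and_dvd hne
  have := Fact.mk hq
  have hqd : q ∣ Nat.card Γ := hqi.trans (index_dvd_card _)
  obtain ⟨l, hl, hlq, hld⟩ := h2 q hq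
  -- a Sylow subgroup of X g
  let P0 : Sylow q (X g) := default
  let P : Subgroup Γ := (P0 : Subgroup (X g)).map (X g).subtype
  have hPX : P ≤ X g := map_subtype_le _
  have hPc : Nat.card P = q ^ (Nat.card (X g)).factorization q := by
    rw [← Sylow.card_eq_multiplicity P0]
    exact (Nat.card_congr ((P0 : Subgroup (X g)).equivMapOfInjective _ (subtype_injective _)).toEquiv).symm
  have hPp : IsPGroup q P := IsPGroup.of_card hPc
  obtain ⟨Q, hPQ⟩ := hPp.exists_le_sylow
  obtain ⟨x, hx1, hx⟩ := gamma_sylow X hmem hpart hab hconj q hq hqd l hl hlq (fun g hg => hdvd l hl hld g hg) Q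
  have hle : Nat.card Q ≤ q * Nat.card P := by
    refine hx.trans (Nat.mul_le_mul_left _ ?_)
    have hp1 : IsPGroup q (Q ⊓ X x : Subgroup Γ) := Q.isPGroup'.to_le inf_le_left
    obtain ⟨n, hn⟩ := hp1.exists_card_eq
    have h1 : q ^ n ∣ Nat.card (X x) := hn ▸ card_dvd_of_le inf_le_right
    rw [hn, hPc, hcard g hg x hx1]
    exact Nat.pow_le_pow_right hq.pos ((hq.pow_dvd_iff_le_factorization Nat.card_pos.ne').mp h1)
  have hPn : (P.subgroupOf Q).Normal := by
    have h1 := relIndex_mul_card' P Q hPQ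
    have h3 : P.relIndex Q ≤ q := by
      have : P.relIndex Q * Nat.card P ≤ q * Nat.card P := h1.trans_le hle
      exact Nat.le_of_mul_le_mul_right this Nat.card_pos
    obtain ⟨n, hn⟩ := (Q.isPGroup').exists_card_eq
    have h4 : P.relIndex Q ∣ q ^ n := by rw [← hn]; exact relIndex_dvd_card _ _
    obtain ⟨j, hj, hj'⟩ := (Nat.dvd_prime_pow hq).mp h4
    have hj1 : j ≤ 1 := by
      by_contra h
      have : q ^ 2 ≤ q ^ j := Nat.pow_le_pow_right hq.pos (by omega)
      rw [hj'] at h3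
      nlinarith [hq.two_le]
    interval_cases j
    · rw [pow_zero] at hj'
      have : P.subgroupOf Q = ⊤ := index_eq_one.mp hj'
      rw [this]; infer_instance
    · apply normal_of_index_eq_minFac_card
      rw [hn, Nat.Prime.pow_minFac hq (by omega)]
      rw [pow_one] at hj'
      exact hj'
  have hPq : q ∣ Nat.card P := by
    rw [hPc]
    exact dvd_pow_self q ((hq.factorization_pos_of_dvd Nat.card_pos.ne' (hdvd q hq hqd g hg)).ne')
  obtain ⟨p, hp⟩ := exists_prime_orderOf_dvd_card' q hPq
  have hp1 : p.1 ≠ 1 := by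
    intro h
    have : p = 1 := Subtype.ext h
    rw [this, orderOf_one] at hp
    exact hq.one_lt.ne hp
  have hQN : (Q : Subgroup Γ) ≤ normalizer (X g) := by
    intro y hy
    have key : ∀ y ∈ Q, ∀ t ∈ X g, y * t * y⁻¹ ∈ X g := by
      intro y hy t ht
      have e1 : X p.1 = X g := hpart g hg p.1 (hPX p.2) hp1
      have hyp : y * p.1 * y⁻¹ ∈ P := hPn.conj_mem ⟨p.1, hPQ p.2⟩ p.2 ⟨y, hy⟩
      have e2 : X (y * p.1 * y⁻¹) = X g := hpart g hg _ (hPX hyp) (by simpa using hp1)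
      have := hconj y p.1 hp1 t (e1 ▸ ht)
      rwa [e2] at this
    rw [mem_normalizer_iff]
    intro t
    refine ⟨key y hy t, fun h => ?_⟩
    have := key y⁻¹ (inv_mem hy) _ h
    simpa [mul_assoc] using this
  exact Q.not_dvd_index (hqi.trans (index_dvd_of_le hQN))
end
end

section
open Subgroup
set_option linter.unusedSectionVars false

section
variable {G : Type*} [Group G]

theorem mem_C {x y : G} : x ∈ centralizer {y} ↔ x * y = y * x := by
  rw [mem_centralizer_singleton_iff]

theorem mem_C_comm {x y : G} : x ∈ centralizer {y} ↔ y ∈ centralizer {x} := by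
  rw [mem_C, mem_C]; exact eq_comm

theorem self_mem_C (x : G) : x ∈ centralizer {x} := mem_C.mpr rfl

theorem cent_eq [Finite G] {x y : G} (h : centralizer {x} ≤ centralizer {y}) (h2 : idx x = idx y) :
    centralizer {x} = centralizer {y} := by
  refine eq_of_le_of_card_ge h ?_
  have h3 := (centralizer {x}).card_mul_index
  have h4 := (centralizer {y}).card_mul_index
  have h5 : (centralizer {x}).index = (centralizer {y}).index := h2
  rw [h5] at h3
  have h6 : (centralizer {y}).index ≠ 0 := index_ne_zero_of_finite
  exact (Nat.eq_of_mul_eq_mul_right (Nat.pos_of_ne_zero h6) (h4.trans h3.symm)).le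

/-- an element of prime power order -/
def PEl (p : ℕ) (a : G) : Prop := ∃ i, orderOf a = p ^ i

theorem PEl.conj {p : ℕ} {a : G} (h : PEl p a) (g : G) : PEl p (g * a * g⁻¹) := by
  obtain ⟨i, hi⟩ := h
  refine ⟨i, ?_⟩
  rw [← hi]
  exact orderOf_injective (MulAut.conj g).toMonoidHom (MulAut.conj g).injective a

theorem PEl.coprime {p q : ℕ} {a b : G} (hp : p.Prime) (hq : q.Prime) (hpq : p ≠ q) (h : PEl p a) (h' : PEl q b) :
    Nat.Coprime (orderOf a) (orderOf b) := by
  obtain ⟨i, hi⟩ := h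
  obtain ⟨j, hj⟩ := h'
  rw [hi, hj]
  exact Nat.Coprime.pow _ _ ((Nat.coprime_primes hp hq).mpr hpq)

theorem PEl.coprime' {p : ℕ} {a b : G} (hp : p.Prime) (h : PEl p a) (h' : ¬ p ∣ orderOf b) :
    Nat.Coprime (orderOf a) (orderOf b) := by
  obtain ⟨i, hi⟩ := h
  rw [hi]
  exact Nat.Coprime.pow_left _ ((Nat.Prime.coprime_iff_not_dvd hp).mpr h')

theorem PEl.of_mem_pgroup {p : ℕ} (hp : p.Prime) {P : Subgroup G} (h : IsPGroup p P) {a : G} (ha : a ∈ P) : PEl p a := by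
  have := Fact.mk hp
  obtain ⟨i, hi⟩ := IsPGroup.iff_orderOf.mp h ⟨a, ha⟩
  exact ⟨i, by rw [← hi, orderOf_mk]⟩

theorem PEl.zpowers_pgroup {p : ℕ} {a : G} (h : PEl p a) : IsPGroup p (zpowers a) := by
  obtain ⟨i, hi⟩ := h
  exact IsPGroup.of_card (n := i) (by rw [Nat.card_zpowers, hi])

theorem PEl.exists_sylow [Finite G] {p : ℕ} {a : G} (h : PEl p a) : ∃ Q : Sylow p G, a ∈ Q := by
  obtain ⟨Q, hQ⟩ := h.zpowers_pgroup.exists_le_sylow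
  exact ⟨Q, hQ (mem_zpowers a)⟩

theorem mem_zpowers_mul {a b : G} (hc : a * b = b * a) (h : Nat.Coprime (orderOf a) (orderOf b)) :
    a ∈ zpowers (a * b) ∧ b ∈ zpowers (a * b) := by
  have hc' : Commute a b := hc
  constructor
  · refine mem_of_pow_coprime _ _ h (by rw [pow_orderOf_eq_one]; exact one_mem _) ?_
    have : a ^ orderOf b = (a * b) ^ orderOf b := by rw [hc'.mul_pow, pow_orderOf_eq_one, mul_one]
    rw [this]; exact pow_mem (mem_zpowers _) _
  · refine mem_of_pow_coprime _ _ h ?_ (by rw [pow_orderOf_eq_one]; exact one_mem _)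
    have : b ^ orderOf a = (a * b) ^ orderOf a := by rw [hc'.mul_pow, pow_orderOf_eq_one, one_mul]
    rw [this]; exact pow_mem (mem_zpowers _) _

/-- p-group conjugation into a subgroup of p'-index -/
theorem conj_into' [Finite G] {p : ℕ} (hp : p.Prime) (P A : Subgroup G) (hP : IsPGroup p P) (hA : ¬ p ∣ A.index) :
    ∃ g : G, ∀ x ∈ P, g⁻¹ * x * g ∈ A := by
  have := Fact.mk hp
  obtain ⟨y, hy⟩ := hP.nonempty_fixed_point_of_prime_not_dvd_card (G ⧸ A) hA
  obtain ⟨g, rfl⟩ := QuotientGroup.mk_surjective y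
  refine ⟨g, fun x hx => ?_⟩
  have h1 : ((x * g : G) : G ⧸ A) = (g : G ⧸ A) := hy ⟨x, hx⟩
  have h2 := QuotientGroup.eq.mp h1.symm
  simpa [mul_assoc] using h2

theorem conj_into [Finite G] {p : ℕ} (hp : p.Prime) (A : Subgroup G) {y : G} (hy : PEl p y) (hA : ¬ p ∣ A.index) :
    ∃ g : G, g * y * g⁻¹ ∈ A := by
  obtain ⟨g, hg⟩ := conj_into' hp (zpowers y) A hy.zpowers_pgroup hA
  exact ⟨g⁻¹, by simpa using hg y (mem_zpowers y)⟩

theorem conj_into_rel [Finite G] {p : ℕ} (hp : p.Prime) (A H : Subgroup G) {y : G} (hy : PEl p y) (hyH : y ∈ H)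
    (hA : ¬ p ∣ A.relIndex H) : ∃ g ∈ H, g * y * g⁻¹ ∈ A := by
  have hy' : PEl p (⟨y, hyH⟩ : H) := by
    obtain ⟨i, hi⟩ := hy
    exact ⟨i, by rw [← hi, orderOf_mk]⟩
  obtain ⟨g, hg⟩ := conj_into hp (A.subgroupOf H) hy' hA
  exact ⟨g.1, g.2, hg⟩

structure Bad (R : Subgroup G) (n : ℕ) : Prop where
  nor : R.Normal
  sol : Group.IsSolvable R
  max : ∀ N : Subgroup G, N.Normal → Group.IsSolvable N → N ≤ R
  out : ∀ w, w ∉ R → idx w = n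
  cls : ∀ g : G, (∃ u k, u.Prime ∧ idx g = u ^ k) ∨ idx g = n
  npp : ∀ u k, u.Prime → n ≠ u ^ k
  top : R ≠ ⊤

theorem bad_of [Finite G] (n : ℕ) (hcls : ∀ g : G, (∃ u k, u.Prime ∧ idx g = u ^ k) ∨ idx g = n)
    (hG : ¬ Group.IsSolvable G) : ∃ R : Subgroup G, Bad R n := by
  obtain ⟨R, hn, hs, hm⟩ := exists_radical G
  have htop : R ≠ ⊤ := by
    rintro rfl
    exact hG (Group.isSolvable_of_isSolvable_injective (f := (topEquiv (G := G)).symm.toMonoidHom) topEquiv.symm.injective)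
  have hpp : ∀ g : G, ∀ u k, u.Prime → idx g = u ^ k → g ∈ R := by
    intro g u k hu h
    exact hm _ inferInstance (kazarin g u k hu h) (subset_normalClosure rfl)
  have hout : ∀ w, w ∉ R → idx w = n := by
    intro w hw
    rcases hcls w with ⟨u, k, hu, h⟩ | h
    · exact absurd (hpp w u k hu h) hw
    · exact h
  refine ⟨R, hn, hs, hm, hout, hcls, ?_, htop⟩
  intro u k hu h
  apply htop
  rw [eq_top_iff]
  intro g _
  by_contra hg
  exact hg (hpp g u k hu ((hout g hg).trans h))

variable [Finite G] {R : Subgroup G} {n : ℕ}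

theorem Bad.pp_mem (B : Bad R n) {g : G} (h : idx g ≠ n) : g ∈ R := by
  by_contra hg; exact h (B.out g hg)

theorem Bad.idx_of_dvd (B : Bad R n) {g : G} (h : n ∣ idx g) : idx g = n := by
  rcases B.cls g with ⟨u, k, hu, h1⟩ | h1
  · rw [h1] at h
    obtain ⟨j, -, hj⟩ := (Nat.dvd_prime_pow hu).mp h
    exact absurd hj (B.npp u j hu)
  · exact h1

theorem Bad.fact2 (B : Bad R n) {w v : G} (hw : idx w = n) (hc : v ∈ centralizer {w})
    (ho : Nat.Coprime (orderOf w) (orderOf v)) : centralizer {w} ≤ centralizer {v} := by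
  obtain ⟨h1, h2⟩ := mem_zpowers_mul (mem_C.mp hc).symm ho
  have h3 : idx (w * v) = n := B.idx_of_dvd (hw ▸ idx_dvd_of_mem_zpowers h1)
  rw [← cent_eq (centralizer_le_of_mem_zpowers h1) (h3.trans hw.symm)]
  exact centralizer_le_of_mem_zpowers h2

def IsAb (A : Subgroup G) : Prop := ∀ a ∈ A, ∀ b ∈ A, a * b = b * a

theorem IsAb.le {A : Subgroup G} (h : IsAb A) {a : G} (ha : a ∈ A) : A ≤ centralizer {a} :=
  fun b hb => mem_C.mpr (h b hb a ha)

theorem IsAb.solvable {A : Subgroup G} (h : IsAb A) : Group.IsSolvable A :=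
  Group.isSolvable_of_comm (fun a b => Subtype.ext (h a.1 a.2 b.1 b.2))

theorem Bad.abel (B : Bad R n) {t q : ℕ} (ht : t.Prime) (hq : q.Prime) (htq : t ≠ q) {w v : G} (hw : idx w = n) (hv : idx v = n)
    (hwt : PEl t w) (hvq : PEl q v) (hc : v ∈ centralizer {w}) :
    centralizer {w} = centralizer {v} ∧ IsAb (centralizer {w}) := by
  have h1 : centralizer {w} = centralizer {v} :=
    cent_eq (B.fact2 hw hc (hwt.coprime ht hq htq hvq)) (hw.trans hv.symm)
  refine ⟨h1, ?_⟩
  intro x hx g hg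
  obtain ⟨a, ha, b, hb, hab, hat, hbt⟩ := exists_primary g t ht
  have hga : a ∈ centralizer {v} := by
    rw [← h1]; exact (zpowers_le.mpr hg) ha
  have hgb : b ∈ centralizer {w} := (zpowers_le.mpr hg) hb
  have e1 : x ∈ centralizer {a} := B.fact2 hv hga (PEl.coprime hq ht htq.symm hvq hat) (h1 ▸ hx)
  have e2 : x ∈ centralizer {b} := B.fact2 hw hgb (hwt.coprime' ht hbt) hx
  rw [mem_C] at e1 e2
  rw [hab, ← mul_assoc, e1, mul_assoc, e2, mul_assoc]

/-- centralizer of an outside element of an abelian centralizer of an outside element -/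
theorem Bad.cent_eq_of_ab (B : Bad R n) {w a : G} (hw : idx w = n) (ha : idx a = n) (hA : IsAb (centralizer {w}))
    (h : a ∈ centralizer {w}) : centralizer {a} = centralizer {w} :=
  (cent_eq (hA.le h) (hw.trans ha.symm)).symm

theorem Bad.no_normal (B : Bad R n) {w : G} (hw : w ∉ R) (hA : IsAb (centralizer {w}))
    (h : haveI := B.nor; ((centralizer {w}).map (QuotientGroup.mk' R)).Normal) : False := by
  have := B.nor
  have := B.sol
  have := hA.solvable
  have h1 := Normal.comap h (QuotientGroup.mk' R)
  rw [comap_map_eq, QuotientGroup.ker_mk'] at h1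
  have h2 := B.max _ h1 (sup_solvable R (centralizer {w}))
  exact hw (h2 (mem_sup_left (self_mem_C w)))

theorem claimX (B : Bad R n) {w e : G} (hw : w ∉ R) (hA : IsAb (centralizer {w})) {q : ℕ} (hq : q.Prime)
    (hcop : ¬ q ∣ orderOf w) (he : centralizer {e} = centralizer {w}) (Q : Sylow q G) (heQ : e ∈ Q) :
    (Q ⊓ R : Subgroup G) ≤ centralizer {w} := by
  have := B.nor
  have := Fact.mk hq
  set A := centralizer {w} with hAdef
  let T : Subgroup G := Q ⊓ (centralizer {QuotientGroup.mk' R w}).comap (QuotientGroup.mk' R)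
  have hRT : (Q ⊓ R : Subgroup G) ≤ T := by
    intro x hx
    refine ⟨hx.1, ?_⟩
    have : QuotientGroup.mk' R x = 1 := (QuotientGroup.eq_one_iff x).mpr hx.2
    show QuotientGroup.mk' R x ∈ centralizer {QuotientGroup.mk' R w}
    rw [mem_C, this]; simp
  have hQA : (Q ⊓ A : Subgroup G) ≤ T := by
    intro x hx
    refine ⟨hx.1, ?_⟩
    show QuotientGroup.mk' R x ∈ centralizer {QuotientGroup.mk' R w}
    rw [mem_C, ← map_mul, ← map_mul, mem_C.mp hx.2]
  suffices hS : T ≤ A from hRT.trans hS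
  by_contra hTA
  let S : Subgroup T := A.subgroupOf T
  have hS : S < ⊤ := by
    rw [lt_top_iff_ne_top]
    intro h
    exact hTA (subgroupOf_eq_top.mp h)
  have hTp : IsPGroup q T := Q.isPGroup'.to_le inf_le_left
  have := hTp.isNilpotent
  have hN := Group.normalizerCondition_of_isNilpotent (G := T) S hS
  obtain ⟨x, hxN, hxS⟩ := SetLike.exists_of_lt hN
  apply hxS
  show x.1 ∈ A
  have heA : e ∈ A := he ▸ self_mem_C e
  have heT : e ∈ T := hQA ⟨heQ, heA⟩
  -- x normalizes A
  have key : ∀ x : T, x ∈ normalizer S → ∀ a ∈ A, x.1 * a * x.1⁻¹ ∈ A := by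
    intro x hx a ha
    have h1 : x⁻¹ * ⟨e, heT⟩ * x⁻¹⁻¹ ∈ S := (mem_normalizer_iff.mp (inv_mem hx) ⟨e, heT⟩).mp heA
    have h2 : x.1⁻¹ * e * x.1 ∈ A := by simpa using (show x.1⁻¹ * e * x.1⁻¹⁻¹ ∈ A from h1)
    have h3 := hA _ h2 a ha
    rw [← he, mem_C]
    calc x.1 * a * x.1⁻¹ * e = x.1 * (a * (x.1⁻¹ * e * x.1)) * x.1⁻¹ := by group
      _ = x.1 * ((x.1⁻¹ * e * x.1) * a) * x.1⁻¹ := by rw [h3]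
      _ = _ := by group
  have hpow : ∀ k : ℕ, (w * x.1) ^ k * (x.1 ^ k)⁻¹ ∈ A := by
    intro k
    induction k with
    | zero => simp
    | succ k ih =>
      have h1 := key x hxN _ ih
      have h2 : (w * x.1) ^ (k + 1) * (x.1 ^ (k + 1))⁻¹ = w * (x.1 * ((w * x.1) ^ k * (x.1 ^ k)⁻¹) * x.1⁻¹) := by
        rw [pow_succ', pow_succ x.1 k]; group
      rw [h2]
      exact mul_mem (self_mem_C w) h1
  obtain ⟨m, hm⟩ := hTp x
  have hm' : x.1 ^ q ^ m = 1 := by exact_mod_cast congrArg Subtype.val hm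
  have ha := hpow (q ^ m)
  rw [hm', inv_one, mul_one] at ha
  have hcw : (w * x.1) ^ q ^ m * w = w * (w * x.1) ^ q ^ m := hA _ ha _ (self_mem_C w)
  have hcwx : (w * x.1) ^ q ^ m * (w * x.1) = (w * x.1) * (w * x.1) ^ q ^ m := by rw [← pow_succ, ← pow_succ']
  have hR : (w * x.1) ^ q ^ m ∉ R := by
    intro h
    apply hw
    have h1 := mem_C.mp (show QuotientGroup.mk' R x.1 ∈ centralizer {QuotientGroup.mk' R w} from x.2.2)
    have h2 : Commute (QuotientGroup.mk' R w) (QuotientGroup.mk' R x.1) := h1.symm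
    have h3 : QuotientGroup.mk' R ((w * x.1) ^ q ^ m) = QuotientGroup.mk' R (w ^ q ^ m) := by
      rw [map_pow, map_mul, h2.mul_pow, ← map_pow, ← map_pow, hm', map_one, mul_one]
    have h4 : QuotientGroup.mk' R ((w * x.1) ^ q ^ m) = 1 := (QuotientGroup.eq_one_iff _).mpr h
    rw [h3] at h4
    have h5 : w ^ q ^ m ∈ R := (QuotientGroup.eq_one_iff _).mp h4
    exact mem_of_pow_coprime _ _ (Nat.Coprime.pow_left m ((Nat.Prime.coprime_iff_not_dvd hq).mpr hcop)) h5
      (by rw [pow_orderOf_eq_one]; exact one_mem _)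
  have h6 := B.cent_eq_of_ab (B.out w hw) (B.out _ hR) hA ha
  rw [hAdef, ← h6, mem_C]
  set a' := (w * x.1) ^ q ^ m
  have h7 : w * (a' * x.1) = w * (x.1 * a') := by
    rw [← mul_assoc, ← hcw, mul_assoc, hcwx, mul_assoc]
  exact (mul_left_cancel h7).symm

theorem PEl.not_dvd {t q : ℕ} (ht : t.Prime) (hq : q.Prime) (htq : t ≠ q) {w : G} (h : PEl t w) : ¬ q ∣ orderOf w := by
  obtain ⟨i, hi⟩ := h
  rw [hi]
  intro hd
  exact htq ((Nat.prime_dvd_prime_iff_eq hq ht).mp (hq.dvd_of_dvd_pow hd)).symm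

/-- S3 -/
theorem Bad.S3 (B : Bad R n) {t q : ℕ} (ht : t.Prime) (hq : q.Prime) (htq : t ≠ q) {w e : G} (hw : w ∉ R)
    (hwt : PEl t w) (heq : PEl q e) (hc : e ∈ centralizer {w}) (heR : e ∈ R) : idx e ≠ n := by
  intro hen
  have := B.nor
  have := Fact.mk hq
  obtain ⟨h1, hA⟩ := B.abel ht hq htq (B.out w hw) hen hwt heq hc
  have heq' : PEl q (⟨e, heR⟩ : R) := by
    obtain ⟨i, hi⟩ := heq
    exact ⟨i, by rw [← hi, orderOf_mk]⟩
  obtain ⟨P, hP⟩ := heq'.exists_sylow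
  let P1 : Subgroup G := P.map R.subtype
  have heP : e ∈ P1 := ⟨⟨e, heR⟩, hP, rfl⟩
  have hP1 : IsPGroup q P1 := P.isPGroup'.map _
  obtain ⟨Q, hQ⟩ := hP1.exists_le_sylow
  have hX := claimX B hw hA hq (hwt.not_dvd ht hq htq) h1.symm Q (hQ heP)
  have hPA : P1 ≤ centralizer {w} := fun x hx => hX ⟨hQ hx, (map_subtype_le _) hx⟩
  have hF : normalizer (P1 : Set G) ⊔ R = ⊤ := P.normalizer_sup_eq_top
  apply B.no_normal hw hA
  constructor
  rintro _ ⟨a, ha, rfl⟩ g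
  obtain ⟨g, rfl⟩ := QuotientGroup.mk'_surjective R g
  have hg : g ∈ normalizer (P1 : Set G) ⊔ R := hF ▸ mem_top g
  obtain ⟨x, hx, r, hr, rfl⟩ := mem_sup_of_normal_right.mp hg
  have hr' : QuotientGroup.mk' R r = 1 := (QuotientGroup.eq_one_iff r).mpr hr
  rw [map_mul, hr', mul_one, ← map_inv, ← map_mul, ← map_mul]
  refine ⟨_, ?_, rfl⟩
  have h2 : x⁻¹ * e * x⁻¹⁻¹ ∈ P1 := (mem_normalizer_iff.mp (inv_mem hx) e).mp heP
  have h3 := hA _ (hPA h2) a ha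
  show _ ∈ centralizer {w}
  rw [h1, mem_C]
  calc x * a * x⁻¹ * e = x * (a * (x⁻¹ * e * x⁻¹⁻¹)) * x⁻¹ := by group
      _ = x * ((x⁻¹ * e * x⁻¹⁻¹) * a) * x⁻¹ := by rw [h3]
      _ = _ := by group
end
end

section
open Subgroup
set_option linter.unusedSectionVars false

section
variable {G : Type*} [Group G] [Finite G] {R : Subgroup G} {n : ℕ}

theorem card_rel_id (A R : Subgroup G) : Nat.card A * A.relIndex R = R.relIndex A * Nat.card R := by
  have h1 := relIndex_mul_card' (A ⊓ R) A inf_le_left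
  have h2 := relIndex_mul_card' (A ⊓ R) R inf_le_right
  rw [inf_relIndex_left] at h1
  rw [inf_relIndex_right] at h2
  rw [← h1, ← h2]; ring

theorem relIndex_sup_normal (A R : Subgroup G) [R.Normal] : A.relIndex (A ⊔ R) = A.relIndex R := by
  have h1 := relIndex_mul_card' A (A ⊔ R) le_sup_left
  have h2 := relIndex_mul_card' R (A ⊔ R) le_sup_right
  rw [relIndex_sup_right, ← card_rel_id, ← h1, mul_comm] at h2
  exact (Nat.eq_of_mul_eq_mul_right Nat.card_pos h2).symm

theorem has_iff [R.Normal] (A : Subgroup G) {s : ℕ} (hs : s.Prime) :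
    s ∣ R.relIndex A ↔ ∃ e ∈ A, e ∉ R ∧ PEl s e := by
  have := Fact.mk hs
  constructor
  · intro h
    by_contra hcon
    push Not at hcon
    let P : Sylow s A := default
    have hP : (P : Subgroup A) ≤ R.subgroupOf A := by
      intro x hx
      by_contra hxR
      apply hcon x.1 x.2 hxR
      obtain ⟨i, hi⟩ := PEl.of_mem_pgroup hs P.isPGroup' hx
      exact ⟨i, by rw [← hi, orderOf_coe]⟩
    exact P.not_dvd_index (h.trans (index_dvd_of_le hP))
  · rintro ⟨e, heA, heR, hes⟩
    by_contra h
    obtain ⟨g, -, hg⟩ := conj_into_rel hs R A hes heA h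
    apply heR
    have := Normal.conj_mem (inferInstance : R.Normal) _ hg g⁻¹
    simpa [mul_assoc] using this

theorem has_iff_top [R.Normal] {s : ℕ} (hs : s.Prime) :
    s ∣ R.index ↔ ∃ e : G, e ∉ R ∧ PEl s e := by
  rw [← relIndex_top_right, has_iff ⊤ hs]
  simp

theorem Bad.card_eq (B : Bad R n) {w w' : G} (hw : w ∉ R) (hw' : w' ∉ R) :
    Nat.card (centralizer {w}) = Nat.card (centralizer {w'}) := by
  have h3 := (centralizer {w}).card_mul_index
  have h4 := (centralizer {w'}).card_mul_index
  have h5 : (centralizer {w}).index = (centralizer {w'}).index := (B.out w hw).trans (B.out w' hw').symm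
  rw [h5] at h3
  have h6 : (centralizer {w'}).index ≠ 0 := index_ne_zero_of_finite
  exact Nat.eq_of_mul_eq_mul_right (Nat.pos_of_ne_zero h6) (h3.trans h4.symm)

theorem Bad.prim (B : Bad R n) {w : G} (hw : w ∉ R) : ∃ p, p.Prime ∧ ∃ a ∈ zpowers w, a ∉ R ∧ PEl p a ∧
    centralizer {a} = centralizer {w} := by
  obtain ⟨p, hp, a, ha, haR, h⟩ := exists_primary_not_mem R w hw
  exact ⟨p, hp, a, ha, haR, h, (cent_eq (centralizer_le_of_mem_zpowers ha) ((B.out w hw).trans (B.out a haR).symm)).symm⟩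

theorem Bad.pair_rel (B : Bad R n) {w e z : G} (hw : w ∉ R) (hA : IsAb (centralizer {w})) {s r : ℕ} (hs : s.Prime)
    (hr : r.Prime) (hsr : s ≠ r) (he : e ∈ centralizer {w}) (heR : e ∉ R) (hes : PEl s e) (hz : z ∈ centralizer {w})
    (hzR : z ∉ R) (hzr : PEl r z) : ¬ s ∣ (centralizer {w}).relIndex R := by
  have := B.nor
  have := Fact.mk hs
  have h1 := B.cent_eq_of_ab (B.out w hw) (B.out z hzR) hA hz
  have h2 := B.cent_eq_of_ab (B.out w hw) (B.out e heR) hA he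
  obtain ⟨Q, hQ⟩ := hes.exists_sylow
  have h3 := claimX B hzR (h1 ▸ hA) hs (hzr.not_dvd hr hs hsr.symm) (h2.trans h1.symm) Q hQ
  rw [h1] at h3
  intro hd
  have h4 : (centralizer {w}).relIndex R ∣ (Q ⊓ R : Subgroup G).relIndex R := relIndex_dvd_of_le_left R h3
  rw [inf_relIndex_right] at h4
  exact Q.not_dvd_index (hd.trans (h4.trans (relIndex_dvd_of_normal _ _)))

theorem Bad.fact_eq (B : Bad R n) {w : G} {s : ℕ} (hs : s.Prime)
    (h : ¬ s ∣ (centralizer {w}).relIndex R) : (Nat.card (centralizer {w})).factorization s =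
      (R.relIndex (centralizer {w})).factorization s + (Nat.card R).factorization s := by
  have h1 := congrArg (fun m => m.factorization s) (card_rel_id (centralizer {w}) R)
  rw [Nat.factorization_mul Nat.card_pos.ne' (by rw [relIndex]; exact index_ne_zero_of_finite),
    Nat.factorization_mul (by rw [relIndex]; exact index_ne_zero_of_finite) Nat.card_pos.ne', Finsupp.add_apply, Finsupp.add_apply,
    Nat.factorization_eq_zero_of_not_dvd h, add_zero] at h1
  exact h1

theorem Bad.transfer (B : Bad R n) {w w' : G} (hw : w ∉ R) (hw' : w' ∉ R) {s : ℕ} (hs : s.Prime)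
    (h : ¬ s ∣ (centralizer {w}).relIndex R) (hh : ∃ e ∈ centralizer {w}, e ∉ R ∧ PEl s e) :
    ∃ e ∈ centralizer {w'}, e ∉ R ∧ PEl s e := by
  have := B.nor
  rw [← has_iff _ hs] at hh ⊢
  have h1 := B.fact_eq hs h
  have h2 := congrArg (fun m => m.factorization s) (card_rel_id (centralizer {w'}) R)
  rw [Nat.factorization_mul Nat.card_pos.ne' (by rw [relIndex]; exact index_ne_zero_of_finite),
    Nat.factorization_mul (by rw [relIndex]; exact index_ne_zero_of_finite) Nat.card_pos.ne', Finsupp.add_apply, Finsupp.add_apply,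
    ← B.card_eq hw hw'] at h2
  have h3 : 0 < (R.relIndex (centralizer {w})).factorization s :=
    hs.factorization_pos_of_dvd (by rw [relIndex]; exact index_ne_zero_of_finite) hh
  exact Nat.dvd_of_factorization_pos (by omega)

theorem Bad.S2 (B : Bad R n) {t q : ℕ} (ht : t.Prime) (hq : q.Prime) (htq : t ≠ q) {w v : G} (hw : w ∉ R) (hv : v ∉ R)
    (hwt : PEl t w) (hvq : PEl q v) (hc : v ∈ centralizer {w}) : False := by
  have := B.nor
  obtain ⟨e1, hA⟩ := B.abel ht hq htq (B.out w hw) (B.out v hv) hwt hvq hc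
  have hqall : ∀ w' ∉ R, ∃ e ∈ centralizer {w'}, e ∉ R ∧ PEl q e := fun w' hw' =>
    B.transfer hw hw' hq (B.pair_rel hw hA hq ht htq.symm hc hv hvq (self_mem_C w) hw hwt) ⟨v, hc, hv, hvq⟩
  have htall : ∀ w' ∉ R, ∃ e ∈ centralizer {w'}, e ∉ R ∧ PEl t e := fun w' hw' =>
    B.transfer hw hw' ht (B.pair_rel hw hA ht hq htq (self_mem_C w) hw hwt hc hv hvq) ⟨w, self_mem_C w, hw, hwt⟩
  have hr : ∀ s : ℕ, ∃ r, r.Prime ∧ r ≠ s ∧ ∀ w' ∉ R, ∃ e ∈ centralizer {w'}, e ∉ R ∧ PEl r e := by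
    intro s
    by_cases h : q = s
    · exact ⟨t, ht, fun h' => htq (h'.trans h.symm), htall⟩
    · exact ⟨q, hq, h, hqall⟩
  have habs : ∀ w' ∉ R, IsAb (centralizer {w'}) := by
    intro w' hw'
    obtain ⟨s, hs, a, ha, haR, has, hac⟩ := B.prim hw'
    obtain ⟨r, hr, hrs, hall⟩ := hr s
    obtain ⟨e, he, heR, her⟩ := hall a haR
    rw [← hac]
    exact (B.abel hs hr hrs.symm (B.out a haR) (B.out e heR) has her he).2
  have hall : ∀ s, s.Prime → s ∣ R.index → ∀ w' ∉ R, (∃ e ∈ centralizer {w'}, e ∉ R ∧ PEl s e) ∧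
      ¬ s ∣ (centralizer {w'}).relIndex R := by
    intro s hs hsd
    obtain ⟨y, hy, hys⟩ := (has_iff_top hs).mp hsd
    obtain ⟨r, hr, hrs, hr2⟩ := hr s
    have h1 : ¬ s ∣ (centralizer {y}).relIndex R := by
      obtain ⟨z, hz, hzR, hzr⟩ := hr2 y hy
      exact B.pair_rel hy (habs y hy) hs hr hrs.symm (self_mem_C y) hy hys hz hzR hzr
    intro w' hw'
    have h2 := B.transfer hy hw' hs h1 ⟨y, self_mem_C y, hy, hys⟩
    refine ⟨h2, ?_⟩
    obtain ⟨e, he, heR, hes⟩ := h2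
    obtain ⟨z, hz, hzR, hzr⟩ := hr2 w' hw'
    exact B.pair_rel hw' (habs w' hw') hs hr hrs.symm he heR hes hz hzR hzr
  let mk := QuotientGroup.mk' R
  let Y : G → Subgroup (G ⧸ R) := fun w => (centralizer {w}).map mk
  have hYc : ∀ w, Nat.card (Y w) = R.relIndex (centralizer {w}) := by
    intro w
    have := relIndex_ker mk (K := centralizer {w})
    rw [QuotientGroup.ker_mk'] at this
    exact this.symm
  have hYcard : ∀ w ∉ R, ∀ w' ∉ R, Nat.card (Y w) = Nat.card (Y w') := by
    intro w hw w' hw'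
    apply Nat.eq_of_factorization_eq Nat.card_pos.ne' Nat.card_pos.ne'
    intro s
    by_cases hs : s.Prime
    · by_cases hsd : s ∣ R.index
      · rw [hYc, hYc]
        have h1 := B.fact_eq hs (hall s hs hsd w hw).2
        have h2 := B.fact_eq hs (hall s hs hsd w' hw').2
        rw [B.card_eq hw hw'] at h1
        omega
      · have h0 : ∀ w, ¬ s ∣ Nat.card (Y w) := fun w h => hsd (h.trans (card_subgroup_dvd_card (Y w)))
        rw [Nat.factorization_eq_zero_of_not_dvd (h0 w), Nat.factorization_eq_zero_of_not_dvd (h0 w')]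
    · rw [Nat.factorization_eq_zero_of_not_prime _ hs, Nat.factorization_eq_zero_of_not_prime _ hs]
  have hmk1 : ∀ {x : G}, mk x = 1 ↔ x ∈ R := fun {x} => QuotientGroup.eq_one_iff x
  have key : ∀ w ∉ R, ∀ k ∉ R, mk k ∈ Y w → Y k = Y w := by
    intro w hw k hk hkY
    have hsup : ∀ x, mk x ∈ Y w ↔ x ∈ centralizer {w} ⊔ R := by
      intro x
      have : (centralizer {w} ⊔ R : Subgroup G) = (Y w).comap mk := by
        rw [comap_map_eq, QuotientGroup.ker_mk']
      rw [this]; rfl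
    obtain ⟨s, hs, a, ha, haR, has, hac⟩ := B.prim hk
    have haH : a ∈ centralizer {w} ⊔ R := (zpowers_le.mpr ((hsup k).mp hkY)) ha
    have hsd : s ∣ R.index := (has_iff_top hs).mpr ⟨a, haR, has⟩
    have hnd := (hall s hs hsd w hw).2
    rw [← relIndex_sup_normal] at hnd
    obtain ⟨h, hhH, hh⟩ := conj_into_rel hs _ _ has haH hnd
    have hnR : h * a * h⁻¹ ∉ R := by
      intro h1
      apply haR
      have := Normal.conj_mem B.nor _ h1 h⁻¹
      simpa [mul_assoc] using this
    have hC := B.cent_eq_of_ab (B.out w hw) (B.out _ hnR) (habs w hw) hh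
    refine eq_of_le_of_card_ge ?_ (hYcard w hw k hk).le
    rintro _ ⟨x, hx, rfl⟩
    have hx' : x ∈ centralizer {a} := hac ▸ hx
    have h3 : h * x * h⁻¹ ∈ centralizer {w} := by
      rw [← hC, mem_C]
      rw [mem_C] at hx'
      calc h * x * h⁻¹ * (h * a * h⁻¹) = h * (x * a) * h⁻¹ := by group
        _ = h * (a * x) * h⁻¹ := by rw [hx']
        _ = _ := by group
    have h4 : mk (h * x * h⁻¹) ∈ Y w := ⟨_, h3, rfl⟩
    have h5 : mk h ∈ Y w := (hsup h).mpr hhH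
    rw [map_mul, map_mul, map_inv] at h4
    exact ((Y w).mul_mem_cancel_left h5).mp (((Y w).mul_mem_cancel_right (inv_mem h5)).mp h4)
  have hout : ∀ g : G ⧸ R, mk g.out = g := fun g => QuotientGroup.out_eq' g
  have hout1 : ∀ g : G ⧸ R, g ≠ 1 → g.out ∉ R := fun g hg h => hg (by rw [← hout g]; exact hmk1.mpr h)
  have hself : ∀ w, mk w ∈ Y w := fun w => ⟨w, self_mem_C w, rfl⟩
  have hgw : mk w ≠ 1 := fun h => hw (hmk1.mp h)
  have hcardΓ : Nat.card (G ⧸ R) = R.index := rfl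
  have hfinal := gamma_lemma (fun g : G ⧸ R => Y g.out)
    (fun g hg => by have := hself g.out; rwa [hout] at this)
    (fun g hg h hh h1 => key _ (hout1 g hg) _ (hout1 h h1) (by rw [hout]; exact hh))
    (by
      rintro g hg _ ⟨a, ha, rfl⟩ _ ⟨b, hb, rfl⟩
      rw [← map_mul, ← map_mul, habs _ (hout1 g hg) a ha b hb])
    (by
      rintro k g hg _ ⟨y, hy, rfl⟩
      obtain ⟨κ, rfl⟩ := QuotientGroup.mk'_surjective R k
      have h0 : κ * g.out * κ⁻¹ ∉ R := by
        intro h1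
        apply hout1 g hg
        have := Normal.conj_mem B.nor _ h1 κ⁻¹
        simpa [mul_assoc] using this
      have h1 : mk κ * g * (mk κ)⁻¹ = mk (κ * g.out * κ⁻¹) := by rw [map_mul, map_mul, map_inv, hout]
      have h2 : mk κ * g * (mk κ)⁻¹ ≠ 1 := by rw [h1]; exact fun h => h0 (hmk1.mp h)
      have h3 : Y (mk κ * g * (mk κ)⁻¹).out = Y (κ * g.out * κ⁻¹) := by
        apply key _ h0 _ (hout1 _ h2)
        rw [hout, h1]; exact hself _
      show mk κ * mk y * (mk κ)⁻¹ ∈ Y (mk κ * g * (mk κ)⁻¹).out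
      rw [h3, ← map_inv, ← map_mul, ← map_mul]
      refine ⟨_, ?_, rfl⟩
      have hy' := mem_C.mp hy
      show _ ∈ centralizer _
      rw [mem_C]
      calc κ * y * κ⁻¹ * (κ * g.out * κ⁻¹) = κ * (y * g.out) * κ⁻¹ := by group
        _ = κ * (g.out * y) * κ⁻¹ := by rw [hy']
        _ = _ := by group)
    (fun g hg h hh => hYcard _ (hout1 g hg) _ (hout1 h hh))
    (fun s hs hsd g hg => by
      rw [hYc, has_iff _ hs]
      exact (hall s hs hsd _ (hout1 g hg)).1)
    (fun s hs => by
      obtain ⟨r, hrp, hrs, h⟩ := hr s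
      obtain ⟨e, -, heR, her⟩ := h w hw
      exact ⟨r, hrp, hrs, (has_iff_top hrp).mpr ⟨e, heR, her⟩⟩)
    (mk w) hgw
  refine B.no_normal (hout1 _ hgw) (habs _ (hout1 _ hgw)) hfinal
end
end

section
open Subgroup
set_option linter.unusedSectionVars false

section
variable {G : Type*} [Group G] [Finite G] {R : Subgroup G} {n : ℕ}

theorem comap_solvable (R : Subgroup G) [R.Normal] [Group.IsSolvable R] (N : Subgroup (G ⧸ R)) [Group.IsSolvable N] :
    Group.IsSolvable (N.comap (QuotientGroup.mk' R)) := by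
  have hle : R ≤ N.comap (QuotientGroup.mk' R) := by
    intro x hx
    have : QuotientGroup.mk' R x = 1 := (QuotientGroup.eq_one_iff x).mpr hx
    rw [mem_comap, this]; exact one_mem _
  let f : R →* N.comap (QuotientGroup.mk' R) := inclusion hle
  let g : N.comap (QuotientGroup.mk' R) →* N := (QuotientGroup.mk' R).subgroupComap N
  refine Group.isSolvable_of_ker_le_range f g ?_
  intro x hx
  have h1 : QuotientGroup.mk' R x.1 = 1 := congrArg Subtype.val (MonoidHom.mem_ker.mp hx)
  have h2 : x.1 ∈ R := (QuotientGroup.eq_one_iff x.1).mp h1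
  exact ⟨⟨x.1, h2⟩, Subtype.ext rfl⟩

theorem Bad.three (B : Bad R n) (p1 p2 : ℕ) : ∃ p, p.Prime ∧ p ∣ R.index ∧ p ≠ p1 ∧ p ≠ p2 := by
  have := B.nor
  have := B.sol
  by_contra hcon
  push Not at hcon
  have hi : R.index ≠ 1 := fun h => B.top (index_eq_one.mp h)
  obtain ⟨p, hp, hpd⟩ := Nat.exists_prime_and_dvd hi
  have := Fact.mk hp
  obtain ⟨o, ho⟩ : ∃ o, ∀ s, s.Prime → s ∣ R.index → s ≠ p → s = o := by
    by_cases h : p = p1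
    · exact ⟨p2, fun s hs hsd hsp => hcon s hs hsd (h ▸ hsp)⟩
    · refine ⟨p1, fun s hs hsd hsp => ?_⟩
      by_contra h1
      exact hsp ((hcon s hs hsd h1).trans (hcon p hp hpd h).symm)
  let P : Sylow p (G ⧸ R) := default
  have hP1 : Nontrivial P := by
    rw [← Finite.one_lt_card_iff_nontrivial]
    exact lt_of_lt_of_le hp.one_lt (Nat.le_of_dvd Nat.card_pos (P.dvd_card_of_dvd_card hpd))
  have hZ := P.isPGroup'.center_nontrivial
  obtain ⟨z, hz1⟩ := exists_ne (1 : center P)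
  have hle : (P : Subgroup (G ⧸ R)) ≤ centralizer {z.1.1} := by
    intro y hy
    rw [mem_C]
    exact congrArg Subtype.val ((mem_center_iff.mp z.2) ⟨y, hy⟩)
  have hd : idx z.1.1 ∣ (P : Subgroup (G ⧸ R)).index := index_dvd_of_le hle
  have huniq : ∀ s, s.Prime → s ∣ idx z.1.1 → s = o := by
    intro s hs hsd
    apply ho s hs
    · exact (hsd.trans hd).trans (index_dvd_card _)
    · rintro rfl
      exact P.not_dvd_index (hsd.trans hd)
  have hidx : ∃ u k, u.Prime ∧ idx z.1.1 = u ^ k := by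
    by_cases h1 : idx z.1.1 = 1
    · exact ⟨2, 0, Nat.prime_two, by simpa using h1⟩
    · obtain ⟨s, hs, hsd⟩ := Nat.exists_prime_and_dvd h1
      have hso := huniq s hs hsd
      subst hso
      exact ⟨s, _, hs, Nat.eq_prime_pow_of_unique_prime_dvd index_ne_zero_of_finite (fun hd hdv => huniq _ hd hdv)⟩
  obtain ⟨u, k, hu, hk⟩ := hidx
  have := kazarin z.1.1 u k hu hk
  have h2 := B.max _ (Normal.comap inferInstance _) (comap_solvable R (normalClosure {z.1.1}))
  apply hz1
  apply Subtype.ext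
  apply Subtype.ext
  obtain ⟨x, hx⟩ := QuotientGroup.mk'_surjective R z.1.1
  show z.1.1 = 1
  rw [← hx]
  refine (QuotientGroup.eq_one_iff x).mpr (h2 ?_)
  rw [mem_comap, hx]
  exact subset_normalClosure rfl

theorem not_mem_conj [hR : R.Normal] {y : G} (hy : y ∉ R) (g : G) : g * y * g⁻¹ ∉ R := by
  intro h1
  apply hy
  have := hR.conj_mem _ h1 g⁻¹
  simpa [mul_assoc] using this

theorem Bad.dvd_n (B : Bad R n) {q : ℕ} (hq : q.Prime) (hqd : q ∣ R.index) : q ∣ n := by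
  have := B.nor
  obtain ⟨t, ht, htd, htq, -⟩ := B.three q q
  obtain ⟨w, hw, hwt⟩ := (has_iff_top ht).mp htd
  obtain ⟨y, hy, hyq⟩ := (has_iff_top hq).mp hqd
  by_contra hn
  rw [← B.out w hw] at hn
  obtain ⟨g, hg⟩ := conj_into hq (centralizer {w}) hyq hn
  exact B.S2 ht hq htq hw (not_mem_conj hy g) hwt (hyq.conj g) hg

theorem Bad.n_not_dvd (B : Bad R n) {u v i j : ℕ} (hu : u.Prime) (hv : v.Prime) : ¬ n ∣ v ^ j * u ^ i := by
  intro h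
  obtain ⟨p, hp, hpd, h1, h2⟩ := B.three u v
  rcases (hp.dvd_mul).mp ((B.dvd_n hp hpd).trans h) with h3 | h3
  · exact h2 ((Nat.prime_dvd_prime_iff_eq hp hv).mp (hp.dvd_of_dvd_pow h3))
  · exact h1 ((Nat.prime_dvd_prime_iff_eq hp hu).mp (hp.dvd_of_dvd_pow h3))

open Pointwise in
theorem Bad.lemM (B : Bad R n) : ∃ u, u.Prime ∧ ∀ q (e : G), q.Prime → q ≠ u → PEl q e → idx e ≠ n → ∃ k, idx e = u ^ k := by
  let S : Set G := {g | ∃ u k, u.Prime ∧ idx g = u ^ k}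
  have hS1 : (1 : G) ∈ S := ⟨2, 0, Nat.prime_two, by
    rw [pow_zero, idx, index_eq_one, eq_top_iff]
    intro x _; rw [mem_C]; simp⟩
  obtain ⟨g0, ⟨u, k, hu, hk⟩, hmax⟩ := Set.exists_max_image S idx (Set.toFinite _) ⟨1, hS1⟩
  refine ⟨u, hu, fun q e hq hqu heq hen => ?_⟩
  obtain ⟨v, j, hv, hj⟩ := (B.cls e).resolve_right hen
  by_cases hvu : v = u
  · exact ⟨j, hvu ▸ hj⟩
  refine ⟨0, ?_⟩
  have hcop : Nat.Coprime (idx e) (idx g0) := by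
    rw [hj, hk]; exact Nat.Coprime.pow _ _ ((Nat.coprime_primes hv hu).mpr hvu)
  -- product of classes is a class
  have hprod : ∀ x y : G, ∃ g, (x * e * x⁻¹) * (y * g0 * y⁻¹) = g * (e * g0) * g⁻¹ := by
    intro x y
    obtain ⟨a, ha, b, hb, hab⟩ := exists_mul_of_coprime (centralizer {e}) (centralizer {g0}) hcop (y⁻¹ * x)
    rw [mem_C] at ha hb
    refine ⟨x * b⁻¹, ?_⟩
    have hxy : x * b⁻¹ = y * a := by
      rw [mul_inv_eq_iff_eq_mul, mul_assoc, ← hab]; group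
    have e1 : x * e * x⁻¹ = (x * b⁻¹) * e * (x * b⁻¹)⁻¹ := by
      have : b⁻¹ * e * b = e := by rw [mul_assoc, ← hb]; group
      calc x * e * x⁻¹ = x * (b⁻¹ * e * b) * x⁻¹ := by rw [this]
        _ = _ := by group
    have e2 : y * g0 * y⁻¹ = (x * b⁻¹) * g0 * (x * b⁻¹)⁻¹ := by
      have : a * g0 * a⁻¹ = g0 := by rw [ha]; group
      rw [hxy]
      calc y * g0 * y⁻¹ = y * (a * g0 * a⁻¹) * y⁻¹ := by rw [this]
        _ = _ := by group
    rw [e1, e2]; group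
  let Bc : Set G := cl ⊤ g0
  let Cc : Set G := cl ⊤ (e * g0)
  have hsub : ∀ x : G, (x * e * x⁻¹) • Bc ⊆ Cc := by
    rintro x _ ⟨_, ⟨y, -, rfl⟩, rfl⟩
    obtain ⟨g, hg⟩ := hprod x y
    exact ⟨g, mem_top g, hg⟩
  have hcc : idx (e * g0) ∣ v ^ j * u ^ k := by
    rw [← hj, ← hk]
    have h1 : centralizer {e} ⊓ centralizer {g0} ≤ centralizer {e * g0} := by
      intro c hc
      have h1 := mem_C.mp hc.1
      have h2 := mem_C.mp hc.2
      rw [mem_C, ← mul_assoc, h1, mul_assoc, h2, mul_assoc]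
    refine (index_dvd_of_le h1).trans ?_
    have h2 : (centralizer {e}).relIndex (centralizer {g0}) * (centralizer {g0}).index = (centralizer {e} ⊓ centralizer {g0} : Subgroup G).index := by
      rw [← inf_relIndex_right]; exact relIndex_mul_index inf_le_right
    rw [← h2, relIndex_eq_of_coprime _ _ hcop]; exact dvd_rfl
  have hle : idx (e * g0) ≤ u ^ k := by
    rcases B.cls (e * g0) with h | h
    · rw [← hk]; exact hmax _ h
    · exact absurd (h ▸ hcc) (B.n_not_dvd hu hv)
  have heqs : ∀ x : G, (x * e * x⁻¹) • Bc = Cc := by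
    intro x
    apply Set.eq_of_subset_of_ncard_le (hsub x) _ (Set.toFinite _)
    rw [← idx_eq_ncard, Set.ncard_smul_set, ← idx_eq_ncard, hk]
    exact hle
  let K : Subgroup G := MulAction.stabilizer G Bc
  have hKn : K.Normal := by
    constructor
    intro κ hκ g
    have hg : ∀ g : G, ∀ b ∈ Bc, g * b * g⁻¹ ∈ Bc := by
      rintro g _ ⟨y, -, rfl⟩
      exact ⟨g * y, mem_top _, by group⟩
    rw [MulAction.mem_stabilizer_set_iff_smul_set_subset (Set.toFinite _)]
    rintro _ ⟨b, hb, rfl⟩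
    have h1 : κ • (g⁻¹ * b * g) ∈ Bc := by
      have h2 : κ • Bc = Bc := hκ
      rw [← h2]
      refine Set.smul_mem_smul_set ?_
      simpa using hg g⁻¹ b hb
    have h3 := hg g _ h1
    simp only [smul_eq_mul] at h3 ⊢
    convert h3 using 1
    group
  have hKc : Nat.card K ∣ u ^ k := by
    have : Nat.card K ∣ Nat.card Bc := by
      have h1 : ((↑) : G → G ⧸ K) ⁻¹' (((↑) : G → G ⧸ K) '' Bc⁻¹) = Bc⁻¹ := by
        ext x
        constructor
        · rintro ⟨b, hb, hbx⟩
          have h2 : b⁻¹ * x ∈ K := QuotientGroup.eq.mp hbx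
          have h3 : (b⁻¹ * x)⁻¹ • Bc = Bc := inv_mem h2
          have h4 : (b⁻¹ * x)⁻¹ • b⁻¹ ∈ (b⁻¹ * x)⁻¹ • Bc := Set.smul_mem_smul_set hb
          rw [h3] at h4
          simpa using h4
        · intro hx
          exact ⟨x, hx, rfl⟩
      have h2 := QuotientGroup.card_preimage_mk K (((↑) : G → G ⧸ K) '' Bc⁻¹)
      rw [h1] at h2
      rw [Nat.card_coe_set_eq] at h2 ⊢
      rw [Set.ncard_inv] at h2
      exact ⟨_, h2⟩
    rwa [Nat.card_coe_set_eq, ← idx_eq_ncard, hk] at this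
  obtain ⟨a, -, ha⟩ := (Nat.dvd_prime_pow hu).mp hKc
  have hKe : K ≤ centralizer {e} := by
    rw [← relIndex_eq_one]
    have h1 : (centralizer {e}).relIndex K ∣ v ^ j := by
      rw [← hj]; exact relIndex_dvd_of_normal _ _
    have h2 : (centralizer {e}).relIndex K ∣ u ^ a := by rw [← ha]; exact relIndex_dvd_card _ _
    exact Nat.Coprime.eq_one_of_dvd (Nat.Coprime.coprime_dvd_left h1 (Nat.Coprime.pow _ _ ((Nat.coprime_primes hv hu).mpr hvu))) h2
  rw [pow_zero, idx, index_eq_one, eq_top_iff]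
  intro g _
  have hκ : e⁻¹ * (g * e * g⁻¹) ∈ K := by
    show (e⁻¹ * (g * e * g⁻¹)) • Bc = Bc
    have h1 := heqs 1
    rw [mul_smul, heqs g, inv_smul_eq_iff, ← h1]; simp
  set κ := e⁻¹ * (g * e * g⁻¹) with hκd
  have hke := mem_C.mp (hKe hκ)
  have hp : (g * e * g⁻¹) ^ orderOf e = 1 := by
    rw [conj_pow, pow_orderOf_eq_one]; group
  have h2 : g * e * g⁻¹ = e * κ := by rw [hκd]; group
  rw [h2, (show Commute e κ from hke.symm).mul_pow, pow_orderOf_eq_one, one_mul] at hp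
  have hκ1 : κ = 1 := by
    have d1 := orderOf_dvd_of_pow_eq_one hp
    have d2 : orderOf κ ∣ u ^ a := by
      rw [← ha, ← orderOf_mk κ hκ]; exact orderOf_dvd_natCard _
    obtain ⟨i, hi⟩ := heq
    rw [hi] at d1
    exact orderOf_eq_one_iff.mp (Nat.Coprime.eq_one_of_dvd (Nat.Coprime.coprime_dvd_left d1 (Nat.Coprime.pow _ _ ((Nat.coprime_primes hq hu).mpr hqu))) d2)
  rw [hκ1, mul_one, mul_inv_eq_iff_eq_mul] at h2
  exact mem_C.mpr h2
end
end

section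
open Subgroup
set_option linter.unusedSectionVars false

section
variable {G : Type*} [Group G] [Finite G] {R : Subgroup G} {n : ℕ}

abbrev conjOn (Ω : Set G) (hΩ : ∀ e ∈ Ω, ∀ g : G, g * e * g⁻¹ ∈ Ω) (H : Subgroup G) : MulAction H Ω where
  smul h e := ⟨h.1 * e.1 * h.1⁻¹, hΩ e.1 e.2 h.1⟩
  one_smul e := Subtype.ext (by show (1 : G) * e.1 * (1 : G)⁻¹ = e.1; simp)
  mul_smul a b e := Subtype.ext (by
    show (a.1 * b.1) * e.1 * (a.1 * b.1)⁻¹ = a.1 * (b.1 * e.1 * b.1⁻¹) * a.1⁻¹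
    group)

theorem burn (Ω : Set G) (hΩ : ∀ e ∈ Ω, ∀ g : G, g * e * g⁻¹ ∈ Ω) (H : Subgroup G) [Fintype G] [DecidablePred (· ∈ H)] :
    letI := conjOn Ω hΩ H
    ∑ b ∈ Finset.univ.filter (· ∈ H), (Ω ∩ centralizer {b}).ncard = Nat.card (MulAction.orbitRel.Quotient H Ω) * Nat.card H := by
  classical
  let _ := conjOn Ω hΩ H
  have : Fintype Ω := Fintype.ofFinite _
  have : Fintype (Quotient (MulAction.orbitRel H Ω)) := Fintype.ofFinite _
  have h1 := MulAction.sum_card_fixedBy_eq_card_orbits_mul_card_group H Ω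
  rw [← Nat.card_eq_fintype_card, ← Nat.card_eq_fintype_card] at h1
  refine Eq.trans ?_ h1
  rw [Finset.sum_subtype (p := (· ∈ H)) (F := inferInstance) (Finset.univ.filter (· ∈ H)) (by simp)]
  refine Finset.sum_congr rfl (fun b _ => ?_)
  rw [← Nat.card_eq_fintype_card, ← Nat.card_coe_set_eq]
  refine Nat.card_congr ⟨fun e => ⟨⟨e.1, e.2.1⟩, ?_⟩, fun e => ⟨e.1.1, e.1.2, ?_⟩, fun e => rfl, fun e => rfl⟩
  · apply Subtype.ext
    show b.1 * e.1 * b.1⁻¹ = e.1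
    rw [← mem_C.mp e.2.2]; group
  · have h2 : b.1 * e.1.1 * b.1⁻¹ = e.1.1 := congrArg Subtype.val e.2
    show _ ∈ centralizer _
    rw [mem_C, ← mul_inv_eq_iff_eq_mul]
    rw [mul_inv_eq_iff_eq_mul] at h2 ⊢
    exact h2.symm

theorem burnside_count (Ω : Set G) (hΩ : ∀ e ∈ Ω, ∀ g : G, g * e * g⁻¹ ∈ Ω) (R B : Subgroup G) (hRB : R ≤ B)
    (hne : ∃ b ∈ B, b ∉ R)
    (hB : ∀ e ∈ Ω, ∀ g : G, ∃ b ∈ B, g * e * g⁻¹ = b * e * b⁻¹) (Z : Subgroup G) (hZ : ∀ e ∈ Ω, ∃ g : G, g * e * g⁻¹ ∈ Z)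
    (hfix : ∀ b ∈ B, b ∉ R → Nat.card Z < (Ω ∩ centralizer {b}).ncard) : False := by
  classical
  have : Fintype G := Fintype.ofFinite _
  have hbB := burn Ω hΩ B
  have hbR := burn Ω hΩ R
  let iB := conjOn Ω hΩ B
  let iR := conjOn Ω hΩ R
  set NB := Nat.card (MulAction.orbitRel.Quotient B Ω) with hNB
  set NR := Nat.card (MulAction.orbitRel.Quotient R Ω) with hNR
  change _ = NB * _ at hbB
  change _ = NR * _ at hbR
  have h1 : NB ≤ NR := by
    let f : MulAction.orbitRel.Quotient R Ω → MulAction.orbitRel.Quotient B Ω :=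
      Quotient.map' id (fun a b h => by
        rw [MulAction.orbitRel_apply] at h ⊢
        obtain ⟨r, hr⟩ := h
        exact ⟨⟨r.1, hRB r.2⟩, hr⟩)
    refine Nat.card_le_card_of_surjective f ?_
    intro y
    induction y using Quotient.inductionOn' with
    | h e => exact ⟨Quotient.mk'' e, rfl⟩
  have h2 : NB ≤ Nat.card Z := by
    have hch : ∀ y : MulAction.orbitRel.Quotient B Ω, ∃ z : Z, ∃ g : G, g * (Quotient.out y).1 * g⁻¹ = z.1 := fun y => by
      obtain ⟨g, hg⟩ := hZ _ (Quotient.out y).2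
      exact ⟨⟨_, hg⟩, g, rfl⟩
    choose f hf using hch
    refine Nat.card_le_card_of_injective f ?_
    intro y y' hy
    obtain ⟨g, hg⟩ := hf y
    obtain ⟨g', hg'⟩ := hf y'
    rw [hy, ← hg'] at hg
    obtain ⟨b, hb, hbe⟩ := hB _ (Quotient.out y).2 (g'⁻¹ * g)
    rw [← Quotient.out_eq' y, ← Quotient.out_eq' y']
    apply Quotient.sound'
    rw [MulAction.orbitRel_apply]
    refine ⟨⟨b⁻¹, inv_mem hb⟩, ?_⟩
    apply Subtype.ext
    show b⁻¹ * (Quotient.out y').1 * b⁻¹⁻¹ = (Quotient.out y).1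
    have h3 : (Quotient.out y').1 = b * (Quotient.out y).1 * b⁻¹ := by
      rw [← hbe]
      calc (Quotient.out y').1 = g'⁻¹ * (g' * (Quotient.out y').1 * g'⁻¹) * g' := by group
        _ = g'⁻¹ * (g * (Quotient.out y).1 * g⁻¹) * g' := by rw [hg]
        _ = _ := by group
    rw [h3]; group
  have hsub : Finset.univ.filter (· ∈ R) ⊆ Finset.univ.filter (· ∈ B) := by
    intro x hx
    rw [Finset.mem_filter] at hx ⊢
    exact ⟨hx.1, hRB hx.2⟩
  have hcard : ∀ H : Subgroup G, (Finset.univ.filter (· ∈ H)).card = Nat.card H := by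
    intro H
    rw [Nat.card_eq_fintype_card, Fintype.card_subtype]
  have h3 := Finset.sum_sdiff hsub (f := fun b => (Ω ∩ centralizer {b} : Set G).ncard)
  rw [hbB, hbR] at h3
  have h4 : ∑ b ∈ Finset.univ.filter (· ∈ B) \ Finset.univ.filter (· ∈ R), NB <
      ∑ b ∈ Finset.univ.filter (· ∈ B) \ Finset.univ.filter (· ∈ R), (Ω ∩ centralizer {b} : Set G).ncard := by
    apply Finset.sum_lt_sum_of_nonempty
    · obtain ⟨b, hb, hbR⟩ := hne
      exact ⟨b, by simp [hb, hbR]⟩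
    · intro b hb
      simp only [Finset.mem_sdiff, Finset.mem_filter, Finset.mem_univ, true_and] at hb
      exact h2.trans_lt (hfix b hb.1 hb.2)
  rw [Finset.sum_const, smul_eq_mul] at h4
  have h5 := Finset.card_sdiff_add_card_eq_card hsub
  rw [hcard, hcard] at h5
  have h6 : NB * Nat.card R ≤ NR * Nat.card R := Nat.mul_le_mul_right _ h1
  rw [← h5] at h3
  nlinarith

theorem Bad.false (B : Bad R n) : False := by
  have := B.nor
  obtain ⟨u, hu, hM⟩ := B.lemM
  obtain ⟨q, hq, hqd, hqu, -⟩ := B.three u u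
  have := Fact.mk hq
  obtain ⟨l, hl, hld, hlq, hlu⟩ : ∃ l, l.Prime ∧ l ∣ R.index ∧ l ≠ q ∧ (l = u ∨ ¬ u ∣ R.index) := by
    by_cases h : u ∣ R.index
    · exact ⟨u, hu, h, hqu.symm, Or.inl rfl⟩
    · obtain ⟨l, hl, hld, hlq, -⟩ := B.three q q
      exact ⟨l, hl, hld, hlq, Or.inr h⟩
  have := Fact.mk hl
  let Ω : Set G := {e | PEl q e ∧ ∃ k, idx e = u ^ k}
  have hΩ : ∀ e ∈ Ω, ∀ g : G, g * e * g⁻¹ ∈ Ω := fun e he g => ⟨he.1.conj g, by rw [idx_conj]; exact he.2⟩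
  have hin : ∀ a ∉ R, PEl l a → ∀ v ∈ centralizer {a}, PEl q v → v ∈ Ω := by
    intro a ha hal v hv hvq
    have hvR : v ∈ R := by
      by_contra hvR
      exact B.S2 hl hq hlq ha hvR hal hvq hv
    exact ⟨hvq, hM q v hq hqu hvq (B.S3 hl hq hlq ha hal hvq hv hvR)⟩
  obtain ⟨w', hw', hw'q⟩ := (has_iff_top hq).mp hqd
  obtain ⟨Q, hw'Q⟩ := hw'q.exists_sylow
  let Z : Subgroup G := Q ⊓ centralizer (Q : Set G)
  have hqn := B.dvd_n hq hqd
  let L : Sylow l (G ⧸ R) := default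
  let D : Subgroup G := (L : Subgroup (G ⧸ R)).comap (QuotientGroup.mk' R)
  have hDi : D.index = (L : Subgroup (G ⧸ R)).index := index_comap_of_surjective _ (QuotientGroup.mk'_surjective R)
  have hRD : R ≤ D := by
    intro x hx
    have : QuotientGroup.mk' R x = 1 := (QuotientGroup.eq_one_iff x).mpr hx
    rw [mem_comap, this]; exact one_mem _
  have huD : ¬ u ∣ D.index := by
    rw [hDi]
    rcases hlu with rfl | h
    · exact L.not_dvd_index
    · exact fun h' => h (h'.trans (index_dvd_card _))
  refine burnside_count Ω hΩ R D hRD ?_ ?_ Z ?_ ?_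
  · by_contra hcon
    push Not at hcon
    have hDR : D = R := le_antisymm hcon hRD
    rw [hDR] at hDi
    exact L.not_dvd_index (hDi ▸ hld)
  · rintro e ⟨-, k, hk⟩ g
    have hcop : Nat.Coprime (centralizer {e}).index D.index := by
      have : (centralizer {e}).index = u ^ k := hk
      rw [this]
      exact Nat.Coprime.pow_left _ ((Nat.Prime.coprime_iff_not_dvd hu).mpr huD)
    obtain ⟨b, hb, h, hh, rfl⟩ := exists_mul_of_coprime _ _ hcop g
    refine ⟨b, hb, ?_⟩
    have h1 : h * e * h⁻¹ = e := by rw [mem_C.mp hh]; group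
    calc b * h * e * (b * h)⁻¹ = b * (h * e * h⁻¹) * b⁻¹ := by group
      _ = _ := by rw [h1]
  · rintro e ⟨heq, k, hk⟩
    have hnd : ¬ q ∣ (centralizer {e}).index := by
      have : (centralizer {e}).index = u ^ k := hk
      rw [this]
      intro h
      exact hqu ((Nat.prime_dvd_prime_iff_eq hq hu).mp (hq.dvd_of_dvd_pow h))
    obtain ⟨g, hg⟩ := conj_into' hq (Q : Subgroup G) _ Q.isPGroup' hnd
    have hcc : ∀ x ∈ Q, x * (g * e * g⁻¹) = (g * e * g⁻¹) * x := by
      intro x hx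
      have h1 := mem_C.mp (hg x hx)
      calc x * (g * e * g⁻¹) = g * ((g⁻¹ * x * g) * e) * g⁻¹ := by group
        _ = g * (e * (g⁻¹ * x * g)) * g⁻¹ := by rw [h1]
        _ = _ := by group
    refine ⟨g, ?_, ?_⟩
    · have h1 := (heq.conj g).zpowers_pgroup.inf_normalizer_sylow Q
      have h2 : g * e * g⁻¹ ∈ (zpowers (g * e * g⁻¹) ⊓ normalizer (Q : Set G) : Subgroup G) := by
        refine ⟨mem_zpowers _, ?_⟩
        show _ ∈ normalizer ((Q : Subgroup G) : Set G)
        rw [mem_normalizer_iff]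
        intro x
        constructor
        · intro hx
          have : g * e * g⁻¹ * x * (g * e * g⁻¹)⁻¹ = x := by rw [← hcc x hx]; group
          rw [this]; exact hx
        · intro hx
          have h3 := hcc _ hx
          have : g * e * g⁻¹ * x * (g * e * g⁻¹)⁻¹ = x := by
            rw [inv_mul_cancel_right] at h3
            exact (mul_left_cancel h3).symm
          rwa [this] at hx
      have h3 : g * e * g⁻¹ ∈ (zpowers (g * e * g⁻¹) ⊓ (Q : Subgroup G) : Subgroup G) := h1 ▸ h2
      exact h3.2
    · exact mem_centralizer_iff.mpr hcc
  · intro b hb hbR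
    obtain ⟨a, ha, b', hb', hab, hal, hbl⟩ := exists_primary b l hl
    have hb'R : b' ∈ R := by
      have hb'D : b' ∈ D := (zpowers_le.mpr hb) hb'
      obtain ⟨m, hm⟩ := L.isPGroup' ⟨_, hb'D⟩
      have hm' : (QuotientGroup.mk' R b') ^ l ^ m = 1 := congrArg Subtype.val hm
      rw [← map_pow] at hm'
      have h5 : b' ^ l ^ m ∈ R := (QuotientGroup.eq_one_iff _).mp hm'
      exact mem_of_pow_coprime _ _ (Nat.Coprime.pow_left m ((Nat.Prime.coprime_iff_not_dvd hl).mpr hbl)) h5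
        (by rw [pow_orderOf_eq_one]; exact one_mem _)
    have haR : a ∉ R := fun h => hbR (hab ▸ mul_mem h hb'R)
    have hC : centralizer {b} = centralizer {a} :=
      cent_eq (centralizer_le_of_mem_zpowers ha) ((B.out b hbR).trans (B.out a haR).symm)
    rw [hC]
    -- a Sylow subgroup of the centralizer
    let P : Sylow q (centralizer {a}) := default
    have hP : Nat.card P ≤ (Ω ∩ centralizer {a} : Set G).ncard := by
      have h1 : Nat.card ((P : Subgroup (centralizer {a})).map (centralizer {a}).subtype) = Nat.card P :=
        (Nat.card_congr ((P : Subgroup (centralizer {a})).equivMapOfInjective _ (subtype_injective _)).toEquiv).symm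
      rw [← h1]
      refine Set.ncard_le_ncard (s := (((P : Subgroup (centralizer {a})).map (centralizer {a}).subtype : Subgroup G) : Set G)) ?_ (Set.toFinite _)
      rintro _ ⟨x, hx, rfl⟩
      refine ⟨hin a haR hal x.1 x.2 ?_, x.2⟩
      obtain ⟨i, hi⟩ := PEl.of_mem_pgroup hq P.isPGroup' hx
      exact ⟨i, by rw [← hi]; exact orderOf_coe x⟩
    refine lt_of_lt_of_le ?_ hP
    have hW : Nat.card (Q ⊓ centralizer {w'} : Subgroup G) ≤ Nat.card P := by
      have hp1 : IsPGroup q (Q ⊓ centralizer {w'} : Subgroup G) := Q.isPGroup'.to_le inf_le_left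
      obtain ⟨i, hi⟩ := hp1.exists_card_eq
      have h1 : q ^ i ∣ Nat.card (centralizer {a}) := by
        rw [B.card_eq haR hw', ← hi]; exact card_dvd_of_le inf_le_right
      rw [hi, Sylow.card_eq_multiplicity P]
      exact Nat.pow_le_pow_right hq.pos ((hq.pow_dvd_iff_le_factorization Nat.card_pos.ne').mp h1)
    refine lt_of_lt_of_le ?_ hW
    have hZR : Z ≤ R := by
      intro z hz
      apply B.pp_mem
      intro h
      have h1 : (Q : Subgroup G) ≤ centralizer {z} := by
        intro x hx
        exact mem_C.mpr (mem_centralizer_iff.mp hz.2 x hx)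
      have h2 : idx z ∣ (Q : Subgroup G).index := index_dvd_of_le h1
      rw [h] at h2
      exact Q.not_dvd_index (hqn.trans h2)
    have hZle : Z ≤ (Q ⊓ centralizer {w'} : Subgroup G) := by
      intro z hz
      exact ⟨hz.1, mem_C.mpr (mem_centralizer_iff.mp hz.2 w' hw'Q).symm⟩
    refine lt_of_le_of_ne (Nat.le_of_dvd Nat.card_pos (card_dvd_of_le hZle)) ?_
    intro h
    have h3 := eq_of_le_of_card_ge hZle h.ge
    have h4 : w' ∈ Z := by rw [h3]; exact ⟨hw'Q, self_mem_C w'⟩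
    exact hw' (hZR h4)

theorem solvable_of_cls (n : ℕ) (hcls : ∀ g : G, (∃ u k, u.Prime ∧ idx g = u ^ k) ∨ idx g = n) : Group.IsSolvable G := by
  by_contra hG
  obtain ⟨R, B⟩ := bad_of n hcls hG
  exact B.false
end
end

/-- If a finite group with `|cs(G)| ≥ 4` has exactly two composite conjugacy class sizes,
one of which is a prime power, then `G` is soluble. -/
theorem stmt_6 (G : Type*) [Group G] [Finite G]
    (hcard : 4 ≤ (csSet G).ncard)
    (hcomp : {n ∈ csSet G | IsCompositeNat n}.ncard = 2)
    (hpp : ∃ m ∈ csSet G, IsCompositeNat m ∧ IsPrimePow m) :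
    IsSolvable G := by
  obtain ⟨m, hm, hmc, hmp⟩ := hpp
  obtain ⟨x, y, hxy, hS⟩ := Set.ncard_eq_two.mp hcomp
  have hmS : m ∈ ({x, y} : Set ℕ) := by rw [← hS]; exact ⟨hm, hmc⟩
  obtain ⟨n, hn⟩ : ∃ n, ∀ k ∈ csSet G, IsCompositeNat k → k = m ∨ k = n := by
    rcases hmS with h | h
    · refine ⟨y, fun k hk hkc => ?_⟩
      have : k ∈ ({x, y} : Set ℕ) := by rw [← hS]; exact ⟨hk, hkc⟩
      rw [h]; exact this
    · refine ⟨x, fun k hk hkc => ?_⟩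
      have : k ∈ ({x, y} : Set ℕ) := by rw [← hS]; exact ⟨hk, hkc⟩
      have h' : m = y := h
      rw [h']; exact Or.symm this
  show Group.IsSolvable G
  refine solvable_of_cls n (fun g => ?_)
  have hg : idx g ∈ csSet G := ⟨g, rfl⟩
  by_cases h1 : IsCompositeNat (idx g)
  · rcases hn _ hg h1 with h | h
    · left
      obtain ⟨p, k, hp, -, hk⟩ := hmp
      exact ⟨p, k, hp.nat_prime, by rw [h, hk]⟩
    · exact Or.inr h
  · left
    have hpos : idx g ≠ 0 := Subgroup.index_ne_zero_of_finite
    by_cases hp : (idx g).Prime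
    · exact ⟨idx g, 1, hp, (pow_one _).symm⟩
    · have h2 : ¬ 1 < idx g := fun h => h1 ⟨h, hp⟩
      exact ⟨2, 0, Nat.prime_two, by rw [pow_zero]; omega⟩
end
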